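/- Let W ⊆ ℂ be a domain, let d be a metric on W inducing its subspace topology, let γ : [0,∞) → W be an injective, continuously differentiable curve that tends to the boundary of W, and let δ : [0,∞) → (0,∞) be continuous. Then there exist an open, connected, simply connected set V ⊆ W containing the image of γ and a holomorphic bijection φ : H → V such that: for every z ∈ V there is t ≥ 0 with d(z, γ(t)) < δ(t); for every compact set C ⊆ W the preimage φ⁻¹(C ∩ V) is a bounded subset of ℂ; and Re(φ⁻¹(γ(t))) → ∞ as t → ∞. -/

import Mathlib

open Set Filter Topology Metric

theorem exists_tendstoLocallyUniformlyOn_hyperfilter {V : Set ℂ} (hV : IsOpen V) {F : ℕ → ℂ → ℂ}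
    (hF : ∀ n, DifferentiableOn ℂ (F n) V) (hb : ∀ n, ∀ z ∈ V, ‖F n z‖ ≤ 1) :
    ∃ f : ℂ → ℂ, TendstoLocallyUniformlyOn F f (hyperfilter ℕ) V := by
  have hlim : ∀ z, ∃ y, z ∈ V → Tendsto (fun n => F n z) (hyperfilter ℕ) (𝓝 y) := by
    intro z
    by_cases hz : z ∈ V
    · obtain ⟨y, -, hy⟩ := (isCompact_closedBall (0 : ℂ) 1).ultrafilter_le_nhds
        ((hyperfilter ℕ).map (fun n => F n z)) (by
          rw [le_principal_iff]
          exact Filter.mem_map.2 (Filter.univ_mem' fun n => by simpa using hb n z hz))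
      exact ⟨y, fun _ => hy⟩
    · exact ⟨0, fun h => absurd h hz⟩
  choose f hf using hlim
  refine ⟨f, ?_⟩
  rw [Metric.tendstoLocallyUniformlyOn_iff]
  intro ε hε x hx
  obtain ⟨ρ, hρ, hball⟩ := Metric.isOpen_iff.1 hV x hx
  have hlip : ∀ n, ∀ y ∈ ball x ρ, dist (F n y) (F n x) ≤ 3 / ρ * dist y x := by
    intro n y hy
    refine Complex.dist_le_div_mul_dist_of_mapsTo_ball ((hF n).mono hball) ?_ hy
    intro w hw
    rw [mem_closedBall, dist_eq_norm]
    calc ‖F n w - F n x‖ ≤ ‖F n w‖ + ‖F n x‖ := norm_sub_le _ _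
      _ ≤ 1 + 1 := add_le_add (hb n w (hball hw)) (hb n x hx)
      _ ≤ 3 := by norm_num
  have hlipf : ∀ y ∈ ball x ρ, dist (f y) (f x) ≤ 3 / ρ * dist y x := fun y hy =>
    le_of_tendsto' ((hf y (hball hy)).dist (hf x hx)) fun n => hlip n y hy
  set r := min ρ (ρ * ε / 12) with hr
  have hr0 : 0 < r := lt_min hρ (by positivity)
  refine ⟨ball x r ∩ V, inter_mem (mem_nhdsWithin_of_mem_nhds (ball_mem_nhds x hr0))
    self_mem_nhdsWithin, ?_⟩
  filter_upwards [(hf x hx).eventually (ball_mem_nhds (f x) (show 0 < ε / 3 by positivity))] with n hn y hy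
  have hy1 : y ∈ ball x ρ := ball_subset_ball (min_le_left _ _) hy.1
  have hb1 : 3 / ρ * dist y x ≤ ε / 4 := by
    have : dist y x ≤ ρ * ε / 12 := (mem_ball.1 hy.1).le.trans (min_le_right _ _)
    calc 3 / ρ * dist y x ≤ 3 / ρ * (ρ * ε / 12) := by gcongr
      _ = ε / 4 := by field_simp; norm_num
  have h1 := hlip n y hy1
  have h2 := hlipf y hy1
  have h3 := dist_triangle4 (f y) (f x) (F n x) (F n y)
  rw [dist_comm (F n x) (F n y)] at h3
  rw [dist_comm] at hn
  linarith

theorem injOn_of_tendstoLocallyUniformlyOn {ι : Type*} {l : Filter ι} [l.NeBot] {V : Set ℂ}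
    (hV : IsOpen V) (hVc : IsPreconnected V) {F : ι → ℂ → ℂ} {f : ℂ → ℂ}
    (hF : ∀ n, DifferentiableOn ℂ (F n) V) (hinj : ∀ n, InjOn (F n) V)
    (hlim : TendstoLocallyUniformlyOn F f l V) {z₀ : ℂ} (hz₀ : z₀ ∈ V) (hf' : deriv f z₀ ≠ 0) :
    InjOn f V := by
  have hfd : DifferentiableOn ℂ f V := hlim.differentiableOn (Eventually.of_forall hF) hV
  have hfa : AnalyticOnNhd ℂ f V := hfd.analyticOnNhd hV
  have key : ∀ c, ∀ a ∈ V, f a = c → ∀ R > 0, ∃ ρ, 0 < ρ ∧ ρ < R ∧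
      ∀ᶠ n in l, c ∈ F n '' closedBall a ρ ∧ closedBall a ρ ⊆ V := by
    intro c a ha hac R hR
    have hne : ∀ᶠ z in 𝓝[≠] a, f z ≠ c := by
      rcases (hfa a ha).eventually_eq_or_eventually_ne (analyticAt_const (v := c)) with h | h
      · exfalso
        have : EqOn f (fun _ => c) V :=
          hfa.eqOn_of_preconnected_of_eventuallyEq analyticOnNhd_const hVc ha h
        apply hf'
        rw [Filter.EventuallyEq.deriv_eq
          (Filter.eventuallyEq_of_mem (hV.mem_nhds hz₀) this)]
        simp
      · exact h
    rw [eventually_nhdsWithin_iff, Metric.eventually_nhds_iff_ball] at hne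
    obtain ⟨r₁, hr₁, h₁⟩ := hne
    obtain ⟨r₂, hr₂, h₂⟩ := Metric.isOpen_iff.1 hV a ha
    set ρ := min (min r₁ r₂) R / 2 with hρ
    have hρ0 : 0 < ρ := by positivity
    have hρ1 : ρ < r₁ := by
      have : min (min r₁ r₂) R ≤ r₁ := (min_le_left _ _).trans (min_le_left _ _)
      linarith
    have hρ2 : ρ < r₂ := by
      have : min (min r₁ r₂) R ≤ r₂ := (min_le_left _ _).trans (min_le_right _ _)
      linarith
    have hρ3 : ρ < R := by
      have : min (min r₁ r₂) R ≤ R := min_le_right _ _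
      linarith
    have hcb : closedBall a ρ ⊆ V := (closedBall_subset_ball hρ2).trans h₂
    refine ⟨ρ, hρ0, hρ3, ?_⟩
    have hcont : ContinuousOn (fun z => ‖f z - c‖) (sphere a ρ) :=
      ((hfd.continuousOn.mono (sphere_subset_closedBall.trans hcb)).sub continuousOn_const).norm
    obtain ⟨w, hw, hmin⟩ := (isCompact_sphere a ρ).exists_isMinOn
      (NormedSpace.sphere_nonempty.2 hρ0.le) hcont
    have hm : 0 < ‖f w - c‖ := by
      rw [norm_pos_iff, sub_ne_zero]
      refine h₁ w (mem_ball.2 ((mem_sphere.1 hw).trans_lt hρ1)) ?_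
      rintro rfl
      simp at hw; linarith
    set m := ‖f w - c‖ / 4 with hmdef
    have hunif := (tendstoLocallyUniformlyOn_iff_forall_isCompact hV).1 hlim _ hcb
      (isCompact_closedBall a ρ)
    filter_upwards [Metric.tendstoUniformlyOn_iff.1 hunif m (by positivity)] with n hn
    refine ⟨?_, hcb⟩
    have hna : dist (f a) (F n a) < m := hn a (mem_closedBall_self hρ0.le)
    have hdc : DiffContOnCl ℂ (F n) (ball a ρ) :=
      ((hF n).mono (by rwa [closure_ball a hρ0.ne'])).diffContOnCl
    have := hdc.ball_subset_image_closedBall (ε := 2 * m) hρ0 (by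
      intro z hz
      have h4 : 4 * m ≤ ‖f z - c‖ := by
        have := hmin hz
        simp only [mem_ofPred_eq] at this
        rw [hmdef]; linarith
      have hnz : dist (f z) (F n z) < m := hn z (sphere_subset_closedBall hz)
      rw [dist_eq_norm] at hna hnz
      rw [hac] at hna
      have : ‖f z - c‖ ≤ ‖f z - F n z‖ + ‖F n z - F n a‖ + ‖c - F n a‖ := by
        calc ‖f z - c‖ = ‖(f z - F n z) + (F n z - F n a) - (c - F n a)‖ := by ring_nf
          _ ≤ _ := (norm_sub_le _ _).trans (by gcongr; exact norm_add_le _ _)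
      linarith) (by
      refine Filter.Eventually.frequently (f := 𝓝[≠] a) ?_ |>.filter_mono nhdsWithin_le_nhds
      filter_upwards [mem_nhdsWithin_of_mem_nhds (hV.mem_nhds ha), self_mem_nhdsWithin] with z hz hza
      exact fun h => hza (hinj n hz ha h))
    apply this
    rw [mem_ball, ← hac]
    linarith
  intro a ha b hb hab
  by_contra hne
  have hd : 0 < dist a b / 2 := by have := dist_pos.2 hne; linarith
  obtain ⟨ρ₁, -, hρ₁, h₁⟩ := key (f b) a ha hab _ hd
  obtain ⟨ρ₂, -, hρ₂, h₂⟩ := key (f b) b hb rfl _ hd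
  obtain ⟨n, ⟨⟨x, hx, hxc⟩, hxV⟩, ⟨y, hy, hyc⟩, hyV⟩ := (h₁.and h₂).exists
  have hxy : x = y := hinj n (hxV hx) (hyV hy) (hxc.trans hyc.symm)
  subst hxy
  have := dist_triangle_left a b x
  rw [mem_closedBall] at hx hy
  linarith

/-- The disc automorphism sending `a` to `0`. -/
noncomputable def discMap (a w : ℂ) : ℂ := (w - a) / (1 - (starRingEnd ℂ) a * w)

theorem one_sub_conj_mul_ne_zero {a w : ℂ} (ha : ‖a‖ ≤ 1) (hw : ‖w‖ < 1) :
    1 - (starRingEnd ℂ) a * w ≠ 0 := by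
  intro h
  have h1 : ‖(starRingEnd ℂ) a * w‖ = 1 := by
    rw [← sub_eq_zero.1 h]; simp
  rw [norm_mul, RCLike.norm_conj] at h1
  nlinarith [norm_nonneg a, norm_nonneg w]

theorem normSq_one_sub_conj_mul (a w : ℂ) :
    ‖1 - (starRingEnd ℂ) a * w‖ ^ 2 = ‖w - a‖ ^ 2 + (1 - ‖a‖ ^ 2) * (1 - ‖w‖ ^ 2) := by
  simp only [← Complex.normSq_eq_norm_sq, Complex.normSq_apply, Complex.sub_re, Complex.sub_im,
    Complex.mul_re, Complex.mul_im, Complex.conj_re, Complex.conj_im, Complex.one_re,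
    Complex.one_im]
  ring

theorem norm_discMap_lt_one {a w : ℂ} (ha : ‖a‖ < 1) (hw : ‖w‖ < 1) : ‖discMap a w‖ < 1 := by
  have h0 := one_sub_conj_mul_ne_zero ha.le hw
  rw [discMap, norm_div, div_lt_one (norm_pos_iff.2 h0)]
  refine lt_of_pow_lt_pow_left₀ 2 (norm_nonneg _) ?_
  rw [normSq_one_sub_conj_mul]
  have h1 : 0 < 1 - ‖a‖ ^ 2 := by nlinarith [norm_nonneg a]
  have h2 : 0 < 1 - ‖w‖ ^ 2 := by nlinarith [norm_nonneg w]
  nlinarith [mul_pos h1 h2]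

theorem hasDerivAt_discMap {a w : ℂ} (ha : ‖a‖ ≤ 1) (hw : ‖w‖ < 1) :
    HasDerivAt (discMap a) ((1 - (starRingEnd ℂ) a * a) / (1 - (starRingEnd ℂ) a * w) ^ 2) w := by
  have h0 := one_sub_conj_mul_ne_zero ha hw
  have := ((hasDerivAt_id w).sub_const a).div
    (((hasDerivAt_id w).const_mul ((starRingEnd ℂ) a)).const_sub 1) h0
  refine this.congr_deriv ?_
  simp only [id]
  ring

theorem injOn_discMap {a : ℂ} (ha : ‖a‖ < 1) : InjOn (discMap a) (ball 0 1) := by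
  intro x hx y hy h
  rw [mem_ball_zero_iff] at hx hy
  have hx0 := one_sub_conj_mul_ne_zero ha.le hx
  have hy0 := one_sub_conj_mul_ne_zero ha.le hy
  rw [discMap, discMap, div_eq_div_iff hx0 hy0] at h
  have h1 : (x - y) * (1 - (starRingEnd ℂ) a * a) = 0 := by linear_combination h
  rcases mul_eq_zero.1 h1 with h2 | h2
  · exact sub_eq_zero.1 h2
  · exact absurd h2 (one_sub_conj_mul_ne_zero ha.le ha)

theorem discMap_eq_zero_iff {a w : ℂ} (ha : ‖a‖ < 1) (hw : ‖w‖ < 1) :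
    discMap a w = 0 ↔ w = a := by
  rw [discMap, div_eq_zero_iff, or_iff_left (one_sub_conj_mul_ne_zero ha.le hw), sub_eq_zero]

/-- The competitors in the extremal problem behind the Riemann mapping theorem. -/
structure IsDiscEmbedding (V : Set ℂ) (z₀ : ℂ) (f : ℂ → ℂ) : Prop where
  differentiableOn : DifferentiableOn ℂ f V
  injOn : InjOn f V
  norm_lt_one : ∀ z ∈ V, ‖f z‖ < 1
  map_base : f z₀ = 0

theorem exists_isDiscEmbedding_isMax {V : Set ℂ} (hV : IsOpen V) (hVc : IsPreconnected V)
    {z₀ : ℂ} (hz₀ : z₀ ∈ V) {g : ℂ → ℂ} (hg : IsDiscEmbedding V z₀ g) (hg' : deriv g z₀ ≠ 0) :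
    ∃ f, IsDiscEmbedding V z₀ f ∧ deriv f z₀ ≠ 0 ∧
      ∀ h, IsDiscEmbedding V z₀ h → ‖deriv h z₀‖ ≤ ‖deriv f z₀‖ := by
  set S : Set ℝ := {x | ∃ h, IsDiscEmbedding V z₀ h ∧ ‖deriv h z₀‖ = x}
  obtain ⟨ρ, hρ, hball⟩ := Metric.isOpen_iff.1 hV z₀ hz₀
  have hbdd : BddAbove S := by
    refine ⟨1 / ρ, ?_⟩
    rintro _ ⟨h, hh, rfl⟩
    refine Complex.norm_deriv_le_div_of_mapsTo_ball (hh.differentiableOn.mono hball) ?_ hρ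
    intro z hz
    rw [hh.map_base, mem_closedBall_zero_iff]
    exact (hh.norm_lt_one z (hball hz)).le
  obtain ⟨u, -, hu, huS⟩ := exists_seq_tendsto_sSup (S := S) ⟨_, g, hg, rfl⟩ hbdd
  choose F hF hFu using huS
  obtain ⟨f, hf⟩ := exists_tendstoLocallyUniformlyOn_hyperfilter hV
    (fun n => (hF n).differentiableOn) (fun n z hz => ((hF n).norm_lt_one z hz).le)
  have hder := (hf.deriv (Eventually.of_forall fun n => (hF n).differentiableOn) hV).tendsto_at hz₀
  have hS : ‖deriv f z₀‖ = sSup S := by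
    refine tendsto_nhds_unique hder.norm ?_
    simp only [Function.comp_apply, hFu]
    exact hu.mono_left Nat.hyperfilter_le_atTop
  have hpos : 0 < ‖deriv f z₀‖ := by
    rw [hS]
    exact (norm_pos_iff.2 hg').trans_le (le_csSup hbdd ⟨g, hg, rfl⟩)
  have hfd : DifferentiableOn ℂ f V :=
    hf.differentiableOn (Eventually.of_forall fun n => (hF n).differentiableOn) hV
  have hinj : InjOn f V := injOn_of_tendstoLocallyUniformlyOn hV hVc
    (fun n => (hF n).differentiableOn) (fun n => (hF n).injOn) hf hz₀ (norm_pos_iff.1 hpos)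
  have hle : ∀ z ∈ V, ‖f z‖ ≤ 1 := fun z hz =>
    le_of_tendsto' (hf.tendsto_at hz).norm fun n => ((hF n).norm_lt_one z hz).le
  refine ⟨f, ⟨hfd, hinj, ?_, ?_⟩, norm_pos_iff.1 hpos, fun h hh => hS ▸ le_csSup hbdd ⟨h, hh, rfl⟩⟩
  · intro z hz
    refine (hle z hz).lt_of_ne fun h1 => ?_
    have hmax : IsMaxOn (norm ∘ f) V z := fun w hw => by
      change ‖f w‖ ≤ ‖f z‖
      rw [h1]; exact hle w hw
    have hc := Complex.eqOn_of_isPreconnected_of_isMaxOn_norm hVc hV hfd hz hmax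
    apply norm_pos_iff.1 hpos
    rw [Filter.EventuallyEq.deriv_eq (Filter.eventuallyEq_of_mem (hV.mem_nhds hz₀) hc)]
    exact deriv_const _ _
  · refine tendsto_nhds_unique (hf.tendsto_at hz₀) ?_
    rw [tendsto_congr fun n => (hF n).map_base]
    exact tendsto_const_nhds

theorem IsDiscEmbedding.exists_larger_deriv {V : Set ℂ} (hV : IsOpen V) {z₀ : ℂ} (hz₀ : z₀ ∈ V)
    (hsqrt : ∀ f : ℂ → ℂ, DifferentiableOn ℂ f V → (∀ z ∈ V, f z ≠ 0) →
      ∃ h : ℂ → ℂ, DifferentiableOn ℂ h V ∧ ∀ z ∈ V, f z = h z ^ 2)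
    {f : ℂ → ℂ} (hf : IsDiscEmbedding V z₀ f) (hf' : deriv f z₀ ≠ 0) {a : ℂ} (ha : ‖a‖ < 1)
    (haf : ∀ z ∈ V, f z ≠ a) :
    ∃ h, IsDiscEmbedding V z₀ h ∧ ‖deriv f z₀‖ < ‖deriv h z₀‖ := by
  have hfat : ∀ z ∈ V, HasDerivAt f (deriv f z) z := fun z hz =>
    (hf.differentiableOn.differentiableAt (hV.mem_nhds hz)).hasDerivAt
  have hTf : ∀ z ∈ V, HasDerivAt (fun z => discMap a (f z)) _ z := fun z hz =>
    (hasDerivAt_discMap ha.le (hf.norm_lt_one z hz)).comp z (hfat z hz)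
  obtain ⟨q, hq, hqs⟩ := hsqrt (fun z => discMap a (f z))
    (fun z hz => (hTf z hz).differentiableAt.differentiableWithinAt)
    (fun z hz h => haf z hz ((discMap_eq_zero_iff ha (hf.norm_lt_one z hz)).1 h))
  have hq1 : ∀ z ∈ V, ‖q z‖ < 1 := by
    intro z hz
    have := norm_discMap_lt_one ha (hf.norm_lt_one z hz)
    rw [hqs z hz, norm_pow] at this
    nlinarith [norm_nonneg (q z)]
  have hqat : ∀ z ∈ V, HasDerivAt q (deriv q z) z := fun z hz =>
    (hq.differentiableAt (hV.mem_nhds hz)).hasDerivAt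
  set b := q z₀ with hb
  have hb1 : ‖b‖ < 1 := hq1 z₀ hz₀
  have hb2 : b ^ 2 = -a := by
    rw [hb, ← hqs z₀ hz₀, hf.map_base]; simp [discMap]
  have hG : ∀ z ∈ V, HasDerivAt (fun z => discMap b (q z)) _ z := fun z hz =>
    (hasDerivAt_discMap hb1.le (hq1 z hz)).comp z (hqat z hz)
  refine ⟨fun z => discMap b (q z), ⟨fun z hz => (hG z hz).differentiableAt.differentiableWithinAt,
    ?_, fun z hz => norm_discMap_lt_one hb1 (hq1 z hz), by simp [discMap, ← hb]⟩, ?_⟩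
  · intro x hx y hy hxy
    have h1 : q x = q y := injOn_discMap hb1 (by simpa using hq1 x hx) (by simpa using hq1 y hy) hxy
    have h2 : discMap a (f x) = discMap a (f y) := by rw [hqs x hx, hqs y hy, h1]
    exact hf.injOn hx hy (injOn_discMap ha (by simpa using hf.norm_lt_one x hx)
      (by simpa using hf.norm_lt_one y hy) h2)
  · have ha0 : a ≠ 0 := fun h => haf z₀ hz₀ (by rw [hf.map_base, h])
    have hb0 : b ≠ 0 := by
      rintro h; rw [h] at hb2; simp at hb2; exact ha0 hb2
    have e1 : 2 * b * deriv q z₀ = (1 - (starRingEnd ℂ) a * a) * deriv f z₀ := by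
      have h1 := (hqat z₀ hz₀).pow 2
      have h2 := (hTf z₀ hz₀).congr_of_eventuallyEq
        (f₁ := fun z => q z ^ 2) (Filter.eventuallyEq_of_mem (hV.mem_nhds hz₀)
          fun z hz => (hqs z hz).symm)
      have := h1.unique h2
      rw [hf.map_base] at this
      simpa using this
    rw [(hG z₀ hz₀).deriv, ← hb]
    have hca : (starRingEnd ℂ) a * a = ((‖a‖ ^ 2 : ℝ) : ℂ) := by
      rw [mul_comm, Complex.mul_conj, Complex.normSq_eq_norm_sq]
    have hcb : (starRingEnd ℂ) b * b = ((‖b‖ ^ 2 : ℝ) : ℂ) := by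
      rw [mul_comm, Complex.mul_conj, Complex.normSq_eq_norm_sq]
    rw [hca] at e1
    rw [hcb]
    have hβ : 0 < ‖b‖ := norm_pos_iff.2 hb0
    have hab : ‖a‖ = ‖b‖ ^ 2 := by rw [← norm_pow, hb2, norm_neg]
    have hb3 : 0 < 1 - ‖b‖ ^ 2 := by nlinarith
    have n1 := congrArg norm e1
    rw [norm_mul, norm_mul, norm_mul, ← Complex.ofReal_one, ← Complex.ofReal_sub,
      Complex.norm_real, Real.norm_of_nonneg (by rw [hab]; nlinarith), hab] at n1
    rw [norm_mul, norm_div, norm_pow, ← Complex.ofReal_one, ← Complex.ofReal_sub, Complex.norm_real,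
      Real.norm_of_nonneg hb3.le]
    have hD : 0 < ‖deriv f z₀‖ := norm_pos_iff.2 hf'
    have hQ : ‖deriv q z₀‖ = (1 - (‖b‖ ^ 2) ^ 2) * ‖deriv f z₀‖ / (2 * ‖b‖) := by
      rw [eq_div_iff (by positivity)]
      have : ‖(2 : ℂ)‖ = 2 := by simp
      rw [this] at n1
      linarith
    rw [hQ]
    have : (1 - ‖b‖ ^ 2) / (1 - ‖b‖ ^ 2) ^ 2 * ((1 - (‖b‖ ^ 2) ^ 2) * ‖deriv f z₀‖ / (2 * ‖b‖))
        = (1 + ‖b‖ ^ 2) / (2 * ‖b‖) * ‖deriv f z₀‖ := by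
      have := hb3.ne'
      field_simp
      ring
    rw [this]
    have : 1 < (1 + ‖b‖ ^ 2) / (2 * ‖b‖) := by
      rw [one_lt_div (by positivity)]
      nlinarith [sq_nonneg (1 - ‖b‖), mul_pos (show 0 < 1 - ‖b‖ by linarith) (show 0 < 1 - ‖b‖ by linarith)]
    nlinarith

/-- **Riemann mapping theorem** for a domain whose complement has interior and on which
nonvanishing holomorphic functions have square roots. -/
theorem exists_bijOn_unit_ball {V : Set ℂ} (hV : IsOpen V) (hVc : IsPreconnected V)
    {z₀ : ℂ} (hz₀ : z₀ ∈ V) {a : ℂ} {ρ : ℝ} (hρ : 0 < ρ) (hdisj : Disjoint V (ball a ρ))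
    (hsqrt : ∀ f : ℂ → ℂ, DifferentiableOn ℂ f V → (∀ z ∈ V, f z ≠ 0) →
      ∃ h : ℂ → ℂ, DifferentiableOn ℂ h V ∧ ∀ z ∈ V, f z = h z ^ 2) :
    ∃ ψ : ℂ → ℂ, DifferentiableOn ℂ ψ V ∧ BijOn ψ V (ball 0 1) ∧ ψ z₀ = 0 := by
  have hfar : ∀ z ∈ V, ρ ≤ ‖z - a‖ := by
    intro z hz
    by_contra h
    exact hdisj.notMem_of_mem_left hz (by rw [mem_ball, dist_eq_norm]; exact not_le.1 h)
  have hne : ∀ z ∈ V, z - a ≠ 0 := fun z hz =>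
    norm_pos_iff.1 (hρ.trans_le (hfar z hz))
  set g : ℂ → ℂ := fun z => (ρ / (z - a) - ρ / (z₀ - a)) / 3 with hgdef
  have hρc : (ρ : ℂ) ≠ 0 := by exact_mod_cast hρ.ne'
  have hgd : ∀ z ∈ V, HasDerivAt g (-ρ / (z - a) ^ 2 / 3) z := by
    intro z hz
    have := (((hasDerivAt_const z (ρ : ℂ)).div ((hasDerivAt_id z).sub_const a)
      (hne z hz)).sub_const (ρ / (z₀ - a))).div_const 3
    refine this.congr_deriv ?_
    simp
  have hg : IsDiscEmbedding V z₀ g := by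
    refine ⟨fun z hz => (hgd z hz).differentiableAt.differentiableWithinAt, ?_, ?_, by simp [hgdef]⟩
    · intro x hx y hy hxy
      have h1 : (ρ : ℂ) / (x - a) = ρ / (y - a) := by
        simp only [hgdef] at hxy
        linear_combination 3 * hxy
      rw [div_eq_div_iff (hne x hx) (hne y hy)] at h1
      have := mul_left_cancel₀ hρc h1
      linear_combination -this
    · intro z hz
      have h1 : ∀ z ∈ V, ‖(ρ : ℂ) / (z - a)‖ ≤ 1 := by
        intro z hz
        rw [norm_div, Complex.norm_real, Real.norm_of_nonneg hρ.le]
        exact div_le_one_of_le₀ (hfar z hz) (norm_nonneg _)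
      have h2 : ‖(3 : ℂ)‖ = 3 := by simp
      rw [hgdef]
      simp only [norm_div _ (3 : ℂ), h2]
      rw [div_lt_one (by norm_num)]
      calc _ ≤ ‖(ρ : ℂ) / (z - a)‖ + ‖(ρ : ℂ) / (z₀ - a)‖ := norm_sub_le _ _
        _ ≤ 1 + 1 := add_le_add (h1 z hz) (h1 z₀ hz₀)
        _ < 3 := by norm_num
  have hg' : deriv g z₀ ≠ 0 := by
    rw [(hgd z₀ hz₀).deriv]
    have := hne z₀ hz₀
    exact div_ne_zero (div_ne_zero (neg_ne_zero.2 hρc) (pow_ne_zero 2 this)) (by norm_num)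
  obtain ⟨f, hf, hf', hmax⟩ := exists_isDiscEmbedding_isMax hV hVc hz₀ hg hg'
  refine ⟨f, hf.differentiableOn, ⟨fun z hz => by simpa using hf.norm_lt_one z hz, hf.injOn, ?_⟩,
    hf.map_base⟩
  intro a ha
  by_contra hna
  obtain ⟨h, hh, hlt⟩ := hf.exists_larger_deriv hV hz₀ hsqrt hf' (a := a) (by simpa using ha)
    (fun z hz h => hna ⟨z, hz, h⟩)
  exact absurd (hmax h hh) (not_le.2 hlt)

theorem isOpen_image_of_injOn {V : Set ℂ} (hV : IsOpen V) (hVc : IsPreconnected V) {f : ℂ → ℂ}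
    (hf : DifferentiableOn ℂ f V) (hinj : InjOn f V) {s : Set ℂ} (hs : s ⊆ V) (hso : IsOpen s) :
    IsOpen (f '' s) := by
  rcases (hf.analyticOnNhd hV).is_constant_or_isOpen hVc with ⟨w, hw⟩ | h
  · rcases s.eq_empty_or_nonempty with rfl | ⟨x, hx⟩
    · simp
    · exfalso
      have h1 : ∀ᶠ y in 𝓝[≠] x, y ∈ V :=
        mem_nhdsWithin_of_mem_nhds (hV.mem_nhds (hs hx))
      obtain ⟨y, hy, hyx⟩ := (h1.and self_mem_nhdsWithin).exists
      exact hyx (hinj hy (hs hx) ((hw y hy).trans (hw x (hs hx)).symm))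
  · exact h s hs hso

theorem differentiableOn_of_leftInvOn {V : Set ℂ} (hV : IsOpen V) (hVc : IsPreconnected V)
    {f g : ℂ → ℂ} (hf : DifferentiableOn ℂ f V) (hinj : InjOn f V) (hg : LeftInvOn g f V) :
    DifferentiableOn ℂ g (f '' V) := by
  have hcont : ∀ z ∈ V, ContinuousAt g (f z) := by
    intro z hz
    rw [ContinuousAt, hg hz]
    intro s hs
    obtain ⟨u, hus, huo, hzu⟩ := _root_.mem_nhds_iff.1 (inter_mem hs (hV.mem_nhds hz))
    have ho := isOpen_image_of_injOn hV hVc hf hinj (fun x hx => (hus hx).2) huo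
    refine Filter.mem_map.2 (Filter.mem_of_superset (ho.mem_nhds ⟨z, hzu, rfl⟩) ?_)
    rintro _ ⟨x, hx, rfl⟩
    rw [mem_preimage, hg (hus hx).2]
    exact (hus hx).1
  have hopen : IsOpen (f '' V) := isOpen_image_of_injOn hV hVc hf hinj subset_rfl hV
  have hinvr : ∀ w ∈ f '' V, f (g w) = w := by
    rintro _ ⟨z, hz, rfl⟩; rw [hg hz]
  have hmem : ∀ w ∈ f '' V, g w ∈ V := by
    rintro _ ⟨z, hz, rfl⟩; rwa [hg hz]
  have hd : ∀ z ∈ V, deriv f z ≠ 0 → DifferentiableAt ℂ g (f z) := by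
    intro z hz h0
    have h1 : HasDerivAt f (deriv f z) (g (f z)) := by
      rw [hg hz]; exact (hf.differentiableAt (hV.mem_nhds hz)).hasDerivAt
    exact (HasDerivAt.of_local_left_inverse (hcont z hz) h1 h0
      (Filter.eventually_of_mem (hopen.mem_nhds ⟨z, hz, rfl⟩) hinvr)).differentiableAt
  rintro _ ⟨z, hz, rfl⟩
  refine AnalyticAt.differentiableAt ?_ |>.differentiableWithinAt
  refine Complex.analyticAt_of_differentiable_on_punctured_nhds_of_continuousAt ?_ (hcont z hz)
  have hfa := hf.analyticOnNhd hV
  have hne : ∀ᶠ x in 𝓝[≠] z, deriv f x ≠ 0 := by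
    rcases (hfa.deriv z hz).eventually_eq_zero_or_eventually_ne_zero with h | h
    · exfalso
      obtain ⟨r, hr, hb⟩ := Metric.eventually_nhds_iff_ball.1 (h.and (hV.eventually_mem hz))
      have hzr : z ∈ ball z r := mem_ball_self hr
      have hconst : ∀ x ∈ ball z r, f x = f z := by
        intro x hx
        refine (convex_ball z r).is_const_of_fderivWithin_eq_zero (𝕜 := ℂ)
          (hf.mono fun y hy => (hb y hy).2) (fun y hy => ?_) hx hzr
        rw [fderivWithin_of_isOpen isOpen_ball hy]
        ext
        simpa using (hb y hy).1
      have h1 : ∀ᶠ y in 𝓝[≠] z, y ∈ ball z r :=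
        mem_nhdsWithin_of_mem_nhds (ball_mem_nhds z hr)
      obtain ⟨y, hy, hyx⟩ := (h1.and self_mem_nhdsWithin).exists
      exact hyx (hinj (hb y hy).2 hz (hconst y hy))
    · exact h
  rw [eventually_nhdsWithin_iff] at hne ⊢
  have hc := (hcont z hz).eventually (by rw [hg hz]; exact hne)
  filter_upwards [hc, hopen.mem_nhds ⟨z, hz, rfl⟩] with w hw hwm hwne
  have := hd (g w) (hmem w hwm) (hw fun h => hwne (by
    rw [mem_singleton_iff] at h
    rw [mem_singleton_iff, ← h, hinvr w hwm]))
  rwa [hinvr w hwm] at this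

theorem differentiableOn_integral_of_continuousOn {U : Set ℂ} (hU : IsOpen U) {K : ℂ → ℝ → ℂ}
    (hK : ContinuousOn (Function.uncurry K) (U ×ˢ Icc (0 : ℝ) 1))
    (hd : ∀ t ∈ Icc (0 : ℝ) 1, DifferentiableOn ℂ (fun z => K z t) U) :
    DifferentiableOn ℂ (fun z => ∫ t in (0 : ℝ)..1, K z t) U := by
  intro z₀ hz₀
  obtain ⟨ρ, hρ, hball⟩ := Metric.nhds_basis_closedBall.mem_iff.1 (hU.mem_nhds hz₀)
  have hcpt : IsCompact (closedBall z₀ ρ ×ˢ Icc (0 : ℝ) 1) :=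
    (isCompact_closedBall _ _).prod isCompact_Icc
  obtain ⟨M, hM⟩ := hcpt.exists_bound_of_continuousOn
    (hK.mono (prod_mono hball subset_rfl))
  have hcont : ∀ z ∈ U, ContinuousOn (K z) (Icc 0 1) := fun z hz =>
    hK.comp (f := fun t => (z, t)) (by fun_prop) fun t ht => ⟨hz, ht⟩
  have hmeas : ∀ z ∈ U, MeasureTheory.AEStronglyMeasurable (K z)
      (MeasureTheory.volume.restrict (uIoc (0 : ℝ) 1)) := fun z hz => by
    rw [uIoc_of_le zero_le_one]
    exact ((hcont z hz).mono Ioc_subset_Icc_self).aestronglyMeasurable measurableSet_Ioc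
  have hder : ∀ t ∈ uIoc (0 : ℝ) 1, ∀ z ∈ ball z₀ (ρ / 2),
      HasDerivAt (fun z => K z t) (deriv (fun z => K z t) z) z := by
    intro t ht z hz
    rw [uIoc_of_le zero_le_one] at ht
    exact ((hd t (Ioc_subset_Icc_self ht)).differentiableAt (hU.mem_nhds
      (hball (ball_subset_closedBall (ball_subset_ball (by linarith) hz))))).hasDerivAt
  have hz₀' : z₀ ∈ ball z₀ (ρ / 2) := mem_ball_self (by positivity)
  have := intervalIntegral.hasDerivAt_integral_of_dominated_loc_of_deriv_le
    (F := K) (F' := fun z t => deriv (fun z => K z t) z) (x₀ := z₀) (a := 0) (b := 1)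
    (μ := MeasureTheory.volume)
    (bound := fun _ => M / (ρ / 2)) (s := ball z₀ (ρ / 2)) (ball_mem_nhds _ (by positivity))
    (Filter.eventually_of_mem (hU.mem_nhds hz₀) hmeas)
    ((hcont z₀ hz₀).intervalIntegrable_of_Icc zero_le_one) ?_ ?_ (by simp) ?_
  · exact this.2.differentiableAt.differentiableWithinAt
  · have hseq : Tendsto (fun n : ℕ => z₀ + (1 / ((n : ℝ) + 1) : ℝ)) atTop (𝓝[≠] z₀) := by
      refine tendsto_nhdsWithin_iff.2 ⟨?_, Filter.Eventually.of_forall fun n => ?_⟩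
      · have h1 := (Complex.continuous_ofReal.tendsto 0).comp tendsto_one_div_add_atTop_nhds_zero_nat
        simpa using h1.const_add z₀
      · have : (0 : ℝ) < 1 / ((n : ℝ) + 1) := by positivity
        rw [mem_compl_iff, mem_singleton_iff, add_eq_left]
        exact_mod_cast this.ne'
    have hU' : ∀ᶠ n : ℕ in atTop, z₀ + (1 / ((n : ℝ) + 1) : ℝ) ∈ U :=
      (hseq.mono_right nhdsWithin_le_nhds).eventually_mem (hU.mem_nhds hz₀)
    obtain ⟨N, hN⟩ := eventually_atTop.1 hU'
    refine aestronglyMeasurable_of_tendsto_ae atTop (f := fun (n : ℕ) t =>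
      slope (fun z => K z t) z₀ (z₀ + (1 / (((n + N : ℕ) : ℝ) + 1) : ℝ))) (fun n => ?_) ?_
    · simp only [slope_def_field, div_eq_mul_inv]
      exact ((hmeas _ (hN (n + N) (Nat.le_add_left N n))).sub (hmeas _ hz₀)).mul_const _
    · refine (MeasureTheory.ae_restrict_iff' measurableSet_uIoc).2 (Filter.Eventually.of_forall fun t ht => ?_)
      exact ((hasDerivAt_iff_tendsto_slope.1 (hder t ht z₀ hz₀')).comp hseq).comp
        (tendsto_add_atTop_nat N)
  · refine Filter.Eventually.of_forall fun t ht z hz => ?_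
    have hsub : closedBall z (ρ / 2) ⊆ closedBall z₀ ρ := by
      refine closedBall_subset_closedBall' ?_
      have := mem_ball.1 hz; linarith
    rw [uIoc_of_le zero_le_one] at ht
    refine Complex.norm_deriv_le_of_forall_mem_sphere_norm_le (by positivity)
      (DifferentiableOn.diffContOnCl ?_) fun w hw => ?_
    · rw [closure_ball _ (by positivity)]
      exact (hd t (Ioc_subset_Icc_self ht)).mono (hsub.trans hball)
    · exact hM (w, t) ⟨hsub (sphere_subset_closedBall hw), Ioc_subset_Icc_self ht⟩
  · exact Filter.Eventually.of_forall hder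

/-- The integral of `h` along the segment from `p` to `q`. -/
noncomputable def segInt (h : ℂ → ℂ) (p q : ℂ) : ℂ :=
  ∫ t in (0 : ℝ)..1, h (p + t * (q - p)) * (q - p)

theorem add_mul_sub_mem_segment (p q : ℂ) {t : ℝ} (ht : t ∈ Icc (0 : ℝ) 1) :
    p + t * (q - p) ∈ segment ℝ p q :=
  (segment_eq_image' ℝ p q).symm ▸ ⟨t, ht, by simp⟩

theorem continuousOn_segInt_integrand {h : ℂ → ℂ} {p q : ℂ} (hh : ContinuousOn h (segment ℝ p q)) :
    ContinuousOn (fun t : ℝ => h (p + t * (q - p)) * (q - p)) (Icc 0 1) :=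
  (hh.comp (by fun_prop) fun _ ht => add_mul_sub_mem_segment p q ht).mul continuousOn_const

theorem segInt_sub {f g : ℂ → ℂ} {p q : ℂ} (hf : ContinuousOn f (segment ℝ p q))
    (hg : ContinuousOn g (segment ℝ p q)) :
    segInt (fun w => f w - g w) p q = segInt f p q - segInt g p q := by
  simp only [segInt, sub_mul]
  exact intervalIntegral.integral_sub
    ((continuousOn_segInt_integrand hf).intervalIntegrable_of_Icc zero_le_one)
    ((continuousOn_segInt_integrand hg).intervalIntegrable_of_Icc zero_le_one)

theorem segInt_const_mul (c : ℂ) (f : ℂ → ℂ) (p q : ℂ) :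
    segInt (fun w => c * f w) p q = c * segInt f p q := by
  simp only [segInt, mul_assoc]
  exact intervalIntegral.integral_const_mul c _

theorem segInt_congr {f g : ℂ → ℂ} {p q : ℂ} (h : EqOn f g (segment ℝ p q)) :
    segInt f p q = segInt g p q := by
  refine intervalIntegral.integral_congr fun t ht => ?_
  rw [uIcc_of_le zero_le_one] at ht
  simp only [h (add_mul_sub_mem_segment p q ht)]

theorem segInt_eq_sub {F f : ℂ → ℂ} {p q : ℂ} (hF : ∀ z ∈ segment ℝ p q, HasDerivAt F (f z) z)
    (hf : ContinuousOn f (segment ℝ p q)) : segInt f p q = F q - F p := by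
  have hd : ∀ t ∈ uIcc (0 : ℝ) 1, HasDerivAt (fun t : ℝ => F (p + t * (q - p)))
      (f (p + t * (q - p)) * (q - p)) t := by
    intro t ht
    rw [uIcc_of_le zero_le_one] at ht
    have h1 : HasDerivAt (fun t : ℝ => p + (t : ℂ) * (q - p)) (q - p) t := by
      simpa using ((Complex.ofRealCLM.hasDerivAt (x := t)).mul_const (q - p)).const_add p
    exact HasDerivAt.comp t (hF _ (add_mul_sub_mem_segment p q ht)) h1
  have := intervalIntegral.integral_eq_sub_of_hasDerivAt hd
    ((continuousOn_segInt_integrand hf).intervalIntegrable_of_Icc zero_le_one)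
  simpa [segInt] using this

theorem segInt_swap (h : ℂ → ℂ) (p q : ℂ) : segInt h q p = -segInt h p q := by
  have := intervalIntegral.integral_comp_sub_left (a := 0) (b := 1)
    (fun t : ℝ => h (p + t * (q - p)) * (q - p)) 1
  simp only [sub_self, sub_zero] at this
  rw [segInt, segInt, ← this, ← intervalIntegral.integral_neg]
  refine intervalIntegral.integral_congr fun t _ => ?_
  have : p + ((1 - t : ℝ) : ℂ) * (q - p) = q + t * (p - q) := by push_cast; ring
  simp only [this]
  ring

theorem differentiableOn_segInt {U : Set ℂ} (hU : IsOpen U) {K : ℂ → ℂ → ℂ} {p q : ℂ}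
    (hK : ContinuousOn (Function.uncurry K) (U ×ˢ segment ℝ p q))
    (hd : ∀ w ∈ segment ℝ p q, DifferentiableOn ℂ (fun z => K z w) U) :
    DifferentiableOn ℂ (fun z => segInt (K z) p q) U := by
  refine differentiableOn_integral_of_continuousOn hU ?_ fun t ht =>
    (hd _ (add_mul_sub_mem_segment p q ht)).mul_const _
  refine ContinuousOn.mul ?_ continuousOn_const
  exact hK.comp (f := fun x : ℂ × ℝ => (x.1, p + (x.2 : ℂ) * (q - p))) (by fun_prop)
    fun x hx => ⟨hx.1, add_mul_sub_mem_segment p q hx.2⟩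

theorem norm_segInt_le {h : ℂ → ℂ} {p q : ℂ} {C : ℝ} (hC : ∀ w ∈ segment ℝ p q, ‖h w‖ ≤ C) :
    ‖segInt h p q‖ ≤ C * ‖q - p‖ := by
  have := intervalIntegral.norm_integral_le_of_norm_le_const (a := 0) (b := 1)
    (f := fun t : ℝ => h (p + t * (q - p)) * (q - p)) (C := C * ‖q - p‖) fun t ht => by
      rw [uIoc_of_le zero_le_one] at ht
      rw [norm_mul]
      gcongr
      exact hC _ (add_mul_sub_mem_segment p q (Ioc_subset_Icc_self ht))
  simpa [segInt] using this

theorem continuousOn_dslope_uncurry {U : Set ℂ} (hU : IsOpen U) {h : ℂ → ℂ}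
    (hh : DifferentiableOn ℂ h U) :
    ContinuousOn (fun x : ℂ × ℂ => dslope h x.1 x.2) (U ×ˢ U) := by
  rintro ⟨z, w⟩ ⟨hz, hw⟩
  simp only at hz hw
  refine ContinuousAt.continuousWithinAt ?_
  by_cases hzw : w = z
  · subst hzw
    have hs : HasStrictDerivAt h (deriv h w) w :=
      (hh.analyticOnNhd hU w hw).hasStrictDerivAt
    have hs1 := hasStrictDerivAt_iff_hasStrictFDerivAt.1 hs |>.isLittleO
    rw [ContinuousAt, dslope_same, Metric.tendsto_nhds]
    intro ε hε
    have hb := hs1.def (half_pos hε)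
    have hderiv : ∀ᶠ x : ℂ × ℂ in 𝓝 (w, w), dist (deriv h x.1) (deriv h w) < ε :=
      (((hh.deriv hU).differentiableAt (hU.mem_nhds hw)).continuousAt.comp
        continuousAt_fst (x := (w, w))).eventually (ball_mem_nhds _ hε)
    filter_upwards [hb, hderiv] with x hx hx'
    by_cases hxx : x.2 = x.1
    · rw [hxx, dslope_same]; exact hx'
    · rw [dslope_of_ne _ hxx, slope_def_field, dist_eq_norm]
      have hne : x.2 - x.1 ≠ 0 := sub_ne_zero.2 hxx
      have : (h x.2 - h x.1) / (x.2 - x.1) - deriv h w =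
          (h x.1 - h x.2 - (x.1 - x.2) * deriv h w) / (x.1 - x.2) := by
        have : x.1 - x.2 ≠ 0 := sub_ne_zero.2 (Ne.symm hxx)
        field_simp
        ring
      rw [this, norm_div, div_lt_iff₀ (norm_pos_iff.2 (sub_ne_zero.2 (Ne.symm hxx)))]
      have hx2 : ‖h x.1 - h x.2 - (x.1 - x.2) * deriv h w‖ ≤ ε / 2 * ‖x.1 - x.2‖ := by
        simpa using hx
      have : 0 < ‖x.1 - x.2‖ := norm_pos_iff.2 (sub_ne_zero.2 (Ne.symm hxx))
      nlinarith
  · have hev : ∀ᶠ x : ℂ × ℂ in 𝓝 (z, w), dslope h x.1 x.2 = (h x.2 - h x.1) / (x.2 - x.1) := by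
      have : ∀ᶠ x : ℂ × ℂ in 𝓝 (z, w), x.2 ≠ x.1 :=
        (isOpen_ne_fun continuous_snd continuous_fst).mem_nhds hzw
      filter_upwards [this] with x hx
      rw [dslope_of_ne _ hx, slope_def_field]
    refine ContinuousAt.congr ?_ (hev.mono fun _ h => h.symm)
    have c1 : ContinuousAt h z := (hh.differentiableAt (hU.mem_nhds hz)).continuousAt
    have c2 : ContinuousAt h w := (hh.differentiableAt (hU.mem_nhds hw)).continuousAt
    exact ((c2.comp continuousAt_snd (x := (z, w))).sub (c1.comp continuousAt_fst (x := (z, w)))).div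
      (continuousAt_snd.sub continuousAt_fst) (sub_ne_zero.2 hzw)

theorem dslope_symm (h : ℂ → ℂ) (z w : ℂ) : dslope h z w = dslope h w z := by
  by_cases hzw : w = z
  · rw [hzw]
  · rw [dslope_of_ne _ hzw, dslope_of_ne _ (Ne.symm hzw), slope_comm]

/-- The integral of `h` along a chain of oriented segments. -/
noncomputable def chainInt (h : ℂ → ℂ) (L : List (ℂ × ℂ)) : ℂ :=
  (L.map fun s => segInt h s.1 s.2).sum

/-- A chain of oriented segments in `D` without boundary. -/
structure IsCycleIn (D : Set ℂ) (L : List (ℂ × ℂ)) : Prop where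
  subset : ∀ s ∈ L, segment ℝ s.1 s.2 ⊆ D
  closed : ∀ F : ℂ → ℂ, (L.map fun s => F s.2 - F s.1).sum = 0

/-- The union of the segments of a chain. -/
def chainSupport (L : List (ℂ × ℂ)) : Set ℂ := ⋃ s ∈ L, segment ℝ s.1 s.2

theorem segment_subset_chainSupport {L : List (ℂ × ℂ)} {s : ℂ × ℂ} (hs : s ∈ L) :
    segment ℝ s.1 s.2 ⊆ chainSupport L := subset_biUnion_of_mem (u := fun s : ℂ × ℂ => segment ℝ s.1 s.2) hs

theorem isCompact_chainSupport (L : List (ℂ × ℂ)) : IsCompact (chainSupport L) := by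
  refine (List.finite_toSet L).isCompact_biUnion fun s _ => ?_
  rw [← Path.range_segment]
  exact isCompact_range (Path.segment s.1 s.2).continuous

theorem IsCycleIn.chainSupport_subset {D : Set ℂ} {L : List (ℂ × ℂ)} (hL : IsCycleIn D L) :
    chainSupport L ⊆ D := iUnion₂_subset hL.subset

theorem chainInt_congr {f g : ℂ → ℂ} {L : List (ℂ × ℂ)} (h : EqOn f g (chainSupport L)) :
    chainInt f L = chainInt g L := by
  rw [chainInt, chainInt]
  congr 1
  exact List.map_congr_left fun s hs => segInt_congr (h.mono (segment_subset_chainSupport hs))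

theorem list_sum_map_sub {α : Type*} (f g : α → ℂ) (L : List α) :
    (L.map fun s => f s - g s).sum = (L.map f).sum - (L.map g).sum := by
  induction L with
  | nil => simp
  | cons a L ih => simp only [List.map_cons, List.sum_cons, ih]; ring

theorem chainInt_sub {f g : ℂ → ℂ} {L : List (ℂ × ℂ)} (hf : ContinuousOn f (chainSupport L))
    (hg : ContinuousOn g (chainSupport L)) :
    chainInt (fun w => f w - g w) L = chainInt f L - chainInt g L := by
  rw [chainInt, chainInt, chainInt, ← list_sum_map_sub]
  congr 1
  exact List.map_congr_left fun s hs => segInt_sub (hf.mono (segment_subset_chainSupport hs))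
    (hg.mono (segment_subset_chainSupport hs))

theorem chainInt_const_mul (c : ℂ) (f : ℂ → ℂ) (L : List (ℂ × ℂ)) :
    chainInt (fun w => c * f w) L = c * chainInt f L := by
  simp only [chainInt, segInt_const_mul, List.sum_map_mul_left]

theorem IsCycleIn.chainInt_eq_zero {D : Set ℂ} {L : List (ℂ × ℂ)} (hL : IsCycleIn D L)
    {F f : ℂ → ℂ} (hF : ∀ z ∈ chainSupport L, HasDerivAt F (f z) z)
    (hf : ContinuousOn f (chainSupport L)) : chainInt f L = 0 := by
  rw [chainInt, ← hL.closed F]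
  congr 1
  exact List.map_congr_left fun s hs => segInt_eq_sub
    (fun z hz => hF z (segment_subset_chainSupport hs hz)) (hf.mono (segment_subset_chainSupport hs))

theorem differentiableOn_list_sum {U : Set ℂ} {α : Type*} (L : List α) {G : α → ℂ → ℂ}
    (h : ∀ s ∈ L, DifferentiableOn ℂ (G s) U) :
    DifferentiableOn ℂ (fun z => (L.map fun s => G s z).sum) U := by
  induction L with
  | nil => simp
  | cons a L ih =>
    simp only [List.map_cons, List.sum_cons]
    exact (h a (by simp)).add (ih fun s hs => h s (by simp [hs]))

theorem differentiableOn_chainInt {U : Set ℂ} (hU : IsOpen U) {K : ℂ → ℂ → ℂ} {L : List (ℂ × ℂ)}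
    (hK : ContinuousOn (Function.uncurry K) (U ×ˢ chainSupport L))
    (hd : ∀ w ∈ chainSupport L, DifferentiableOn ℂ (fun z => K z w) U) :
    DifferentiableOn ℂ (fun z => chainInt (K z) L) U :=
  differentiableOn_list_sum L fun _ hs => differentiableOn_segInt hU
    (hK.mono (prod_mono subset_rfl (segment_subset_chainSupport hs)))
    fun w hw => hd w (segment_subset_chainSupport hs hw)

theorem exists_norm_chainInt_le (L : List (ℂ × ℂ)) : ∃ A, 0 ≤ A ∧ ∀ (h : ℂ → ℂ) (C : ℝ),
    (∀ w ∈ chainSupport L, ‖h w‖ ≤ C) → ‖chainInt h L‖ ≤ C * A := by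
  have key : ∀ (L L' : List (ℂ × ℂ)), (∀ s ∈ L', s ∈ L) →
      ∃ A, 0 ≤ A ∧ ∀ (h : ℂ → ℂ) (C : ℝ),
    (∀ w ∈ chainSupport L, ‖h w‖ ≤ C) → ‖chainInt h L'‖ ≤ C * A := by
    intro L L'
    induction L' with
    | nil => exact fun _ => ⟨0, le_rfl, fun h C _ => by simp [chainInt]⟩
    | cons a L' ih =>
      intro hsub
      obtain ⟨A, hA, h⟩ := ih fun s hs => hsub s (by simp [hs])
      refine ⟨‖a.2 - a.1‖ + A, by positivity, fun f C hC => ?_⟩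
      have h1 := norm_segInt_le (h := f) (p := a.1) (q := a.2) (C := C) fun w hw =>
        hC w (segment_subset_chainSupport (hsub a (by simp)) hw)
      have h2 := h f C hC
      have : chainInt f (a :: L') = segInt f a.1 a.2 + chainInt f L' := by simp [chainInt]
      rw [this, mul_add]
      exact (norm_add_le _ _).trans (add_le_add h1 h2)
  exact key L L fun _ h => h

theorem continuousOn_inv_sub {S : Set ℂ} {z : ℂ} (hz : z ∉ S) :
    ContinuousOn (fun w => 1 / (w - z)) S :=
  continuousOn_const.div (by fun_prop) fun _ hw => sub_ne_zero.2 (ne_of_mem_of_not_mem hw hz)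

theorem continuousOn_cauchyKernel {S : Set ℂ} {H : ℂ → ℂ} (hH : ContinuousOn H S) :
    ContinuousOn (Function.uncurry fun z w : ℂ => H w / (w - z)) (Sᶜ ×ˢ S) :=
  (hH.comp continuousOn_snd fun x hx => hx.2).div (by fun_prop)
    fun x hx => sub_ne_zero.2 (ne_of_mem_of_not_mem hx.2 hx.1)

theorem differentiableOn_cauchyTransform {L : List (ℂ × ℂ)} {H : ℂ → ℂ}
    (hH : ContinuousOn H (chainSupport L)) :
    DifferentiableOn ℂ (fun z => chainInt (fun w => H w / (w - z)) L) (chainSupport L)ᶜ :=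
  differentiableOn_chainInt (isCompact_chainSupport L).isClosed.isOpen_compl
    (continuousOn_cauchyKernel hH) fun _ hw z hz =>
      ((differentiableAt_const _).div ((differentiableAt_const _).sub differentiableAt_id)
        (sub_ne_zero.2 (ne_of_mem_of_not_mem hw hz))).differentiableWithinAt

/-- The winding integral of a cycle is locally constant off the cycle. -/
theorem IsCycleIn.chainInt_inv_eq {D : Set ℂ} {L : List (ℂ × ℂ)} (hL : IsCycleIn D L)
    {S : Set ℂ} (hS : IsPreconnected S) (hSL : Disjoint S (chainSupport L)) {a b : ℂ}
    (ha : a ∈ S) (hb : b ∈ S) :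
    chainInt (fun w => 1 / (w - a)) L = chainInt (fun w => 1 / (w - b)) L := by
  refine hS.induction₂ (fun a b => chainInt (fun w => 1 / (w - a)) L =
    chainInt (fun w => 1 / (w - b)) L) ?_ (fun x y z _ _ _ => Eq.trans)
    (fun x y _ _ => Eq.symm) ha hb
  intro b hb
  have hbL : b ∉ chainSupport L := hSL.notMem_of_mem_left hb
  obtain ⟨r, hr, hball⟩ := Metric.isOpen_iff.1 (isCompact_chainSupport L).isClosed.isOpen_compl b hbL
  refine mem_nhdsWithin_of_mem_nhds (Filter.mem_of_superset (ball_mem_nhds b hr) ?_)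
  intro a ha
  have haL : a ∉ chainSupport L := hball ha
  rw [mem_ofPred_eq, eq_comm, ← sub_eq_zero, ← chainInt_sub (continuousOn_inv_sub haL)
    (continuousOn_inv_sub hbL)]
  refine hL.chainInt_eq_zero (F := fun w => Complex.log ((w - a) / (w - b))) (fun w hw => ?_)
    ((continuousOn_inv_sub haL).sub (continuousOn_inv_sub hbL))
  have hwa : w - a ≠ 0 := sub_ne_zero.2 (ne_of_mem_of_not_mem hw haL)
  have hwb : w - b ≠ 0 := sub_ne_zero.2 (ne_of_mem_of_not_mem hw hbL)
  have hslit : (w - a) / (w - b) ∈ Complex.slitPlane := by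
    apply Complex.ball_one_subset_slitPlane
    have h1 : (w - a) / (w - b) - 1 = (b - a) / (w - b) := by field_simp; ring
    rw [mem_ball, dist_eq_norm, h1, norm_div, div_lt_one (norm_pos_iff.2 hwb)]
    have h2 : ¬ w ∈ ball b r := fun h => hball h hw
    rw [mem_ball, dist_eq_norm, not_lt] at h2
    rw [mem_ball, dist_comm, dist_eq_norm] at ha
    linarith
  have := (((hasDerivAt_id w).sub_const a).div ((hasDerivAt_id w).sub_const b) hwb).clog hslit
  refine this.congr_deriv ?_
  simp only [id, Pi.div_apply]
  field_simp

theorem IsCycleIn.chainInt_inv_eq_zero_of_ball {L : List (ℂ × ℂ)} {R : ℝ}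
    (hL : IsCycleIn (ball 0 R) L) {a : ℂ} (ha : R ≤ ‖a‖) :
    chainInt (fun w => 1 / (w - a)) L = 0 := by
  have haL : ∀ w ∈ chainSupport L, ‖w‖ < ‖a‖ := fun w hw =>
    (mem_ball_zero_iff.1 (hL.chainSupport_subset hw)).trans_le ha
  refine hL.chainInt_eq_zero (F := fun w => Complex.log (1 - w / a)) (fun w hw => ?_)
    (continuousOn_inv_sub fun h => (haL a h).false)
  have h1 := haL w hw
  have ha0 : a ≠ 0 := norm_pos_iff.1 ((norm_nonneg w).trans_lt h1)
  have hwa : w - a ≠ 0 := sub_ne_zero.2 (by rintro rfl; exact h1.false)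
  have hslit : 1 - w / a ∈ Complex.slitPlane := by
    apply Complex.ball_one_subset_slitPlane
    rw [mem_ball, dist_eq_norm, sub_sub_cancel_left, norm_neg, norm_div,
      div_lt_one (norm_pos_iff.2 ha0)]
    exact h1
  have := (((hasDerivAt_id w).div_const a).const_sub 1).clog hslit
  refine this.congr_deriv ?_
  have : a - w ≠ 0 := sub_ne_zero.2 (by rintro rfl; exact h1.false)
  simp only [id]
  field_simp
  ring

theorem tendsto_cauchyTransform_cocompact {L : List (ℂ × ℂ)} {H : ℂ → ℂ}
    (hH : ContinuousOn H (chainSupport L)) :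
    Tendsto (fun z => chainInt (fun w => H w / (w - z)) L) (cocompact ℂ) (𝓝 0) := by
  obtain ⟨A, hA, hbound⟩ := exists_norm_chainInt_le L
  obtain ⟨M, hM⟩ := (isCompact_chainSupport L).exists_bound_of_continuousOn hH
  obtain ⟨R, hR⟩ := (isCompact_chainSupport L).isBounded.exists_norm_le
  have ht : Tendsto (fun z : ℂ => |M| / (‖z‖ - R) * A) (cocompact ℂ) (𝓝 0) := by
    have h1 : Tendsto (fun z : ℂ => ‖z‖ - R) (cocompact ℂ) atTop :=
      tendsto_atTop_add_const_right _ _ (tendsto_norm_cocompact_atTop)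
    simpa using (h1.const_div_atTop |M|).mul_const A
  refine squeeze_zero_norm' ?_ ht
  filter_upwards [tendsto_norm_cocompact_atTop.eventually_gt_atTop R] with z hz
  refine hbound _ _ fun w hw => ?_
  rw [norm_div]
  have h1 : ‖z‖ - R ≤ ‖w - z‖ := by
    have := norm_sub_norm_le z w
    rw [norm_sub_rev] at this
    linarith [hR w hw]
  have : 0 < ‖z‖ - R := by linarith
  gcongr
  exact (hM w hw).trans (le_abs_self M)

/-- **Cauchy's theorem, homology version** (Dixon's proof). -/
theorem IsCycleIn.chainInt_eq_zero_of_winding {D : Set ℂ} (hD : IsOpen D) {L : List (ℂ × ℂ)}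
    (hL : IsCycleIn D L) (hwind : ∀ a, a ∉ D → chainInt (fun w => 1 / (w - a)) L = 0)
    {h : ℂ → ℂ} (hh : DifferentiableOn ℂ h D) : chainInt h L = 0 := by
  classical
  rcases L with _ | ⟨s, L'⟩
  · simp [chainInt]
  set L := s :: L' with hLdef
  have hsub := hL.chainSupport_subset
  have hz₀ : s.1 ∈ D := hL.subset s (by simp [hLdef]) (left_mem_segment ℝ _ _)
  set H : ℂ → ℂ := fun w => h w * (w - s.1) with hHdef
  have hH : DifferentiableOn ℂ H D := hh.mul (by fun_prop)
  have hHc : ContinuousOn H (chainSupport L) := hH.continuousOn.mono hsub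
  set Φ₁ : ℂ → ℂ := fun z => chainInt (dslope H z) L with hΦ₁
  set Φ₂ : ℂ → ℂ := fun z => chainInt (fun w => H w / (w - z)) L with hΦ₂
  set O : Set ℂ := {z | z ∉ chainSupport L ∧ chainInt (fun w => 1 / (w - z)) L = 0} with hO
  have hOo : IsOpen O := by
    rw [Metric.isOpen_iff]
    rintro z ⟨hz, hz'⟩
    obtain ⟨r, hr, hball⟩ :=
      Metric.isOpen_iff.1 (isCompact_chainSupport L).isClosed.isOpen_compl z hz
    refine ⟨r, hr, fun y hy => ⟨hball hy, ?_⟩⟩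
    rw [← hz']
    exact hL.chainInt_inv_eq (convex_ball z r).isPreconnected
      (disjoint_left.2 fun x hx => hball hx) hy (mem_ball_self hr)
  have hΦ₁d : DifferentiableOn ℂ Φ₁ D := by
    refine differentiableOn_chainInt hD
      ((continuousOn_dslope_uncurry hD hH).mono (prod_mono subset_rfl hsub)) fun w hw => ?_
    refine DifferentiableOn.congr (f := dslope H w) ?_ fun z _ => dslope_symm H z w
    exact (Complex.differentiableOn_dslope (hD.mem_nhds (hsub hw))).2 hH
  have hΦ₂d : DifferentiableOn ℂ Φ₂ O :=
    (differentiableOn_cauchyTransform hHc).mono fun z hz => hz.1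
  have heq : ∀ z ∈ D, z ∈ O → Φ₁ z = Φ₂ z := by
    intro z hzD hz
    have h1 : EqOn (dslope H z) (fun w => H w / (w - z) - H z * (1 / (w - z))) (chainSupport L) := by
      intro w hw
      rw [dslope_of_ne _ (ne_of_mem_of_not_mem hw hz.1), slope_def_field]
      ring
    rw [hΦ₁, hΦ₂]
    simp only
    rw [chainInt_congr h1, chainInt_sub, chainInt_const_mul, hz.2, mul_zero, sub_zero]
    · exact hHc.div (by fun_prop) fun w hw => sub_ne_zero.2 (ne_of_mem_of_not_mem hw hz.1)
    · exact continuousOn_const.mul (continuousOn_inv_sub hz.1)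
  have hcover : ∀ z, z ∉ D → z ∈ O := fun z hz => ⟨fun h => hz (hsub h), hwind z hz⟩
  set Ψ : ℂ → ℂ := fun z => if z ∈ D then Φ₁ z else Φ₂ z with hΨ
  have hΨO : ∀ z ∈ O, Ψ z = Φ₂ z := by
    intro z hz
    by_cases hzD : z ∈ D
    · simp only [hΨ, if_pos hzD, heq z hzD hz]
    · simp only [hΨ, if_neg hzD]
  have hΨd : Differentiable ℂ Ψ := by
    intro z
    by_cases hzD : z ∈ D
    · exact ((hΦ₁d.differentiableAt (hD.mem_nhds hzD))).congr_of_eventuallyEq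
        (Filter.eventuallyEq_of_mem (hD.mem_nhds hzD) fun y hy => by simp only [hΨ, if_pos hy])
    · have hzO := hcover z hzD
      exact ((hΦ₂d.differentiableAt (hOo.mem_nhds hzO))).congr_of_eventuallyEq
        (Filter.eventuallyEq_of_mem (hOo.mem_nhds hzO) hΨO)
  have hlim : Tendsto Ψ (cocompact ℂ) (𝓝 0) := by
    refine (tendsto_cauchyTransform_cocompact hHc).congr' ?_
    obtain ⟨R, hR⟩ := (isCompact_chainSupport L).isBounded.exists_norm_le
    have hLR : IsCycleIn (ball 0 (R + 1)) L := ⟨fun s hs x hx => by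
      rw [mem_ball_zero_iff]
      linarith [hR x (segment_subset_chainSupport hs hx)], hL.closed⟩
    filter_upwards [tendsto_norm_cocompact_atTop.eventually_ge_atTop (R + 1)] with z hz
    refine (hΨO z ⟨fun h => ?_, hLR.chainInt_inv_eq_zero_of_ball hz⟩).symm
    linarith [hR z h]
  have h0 := hΨd.apply_eq_of_tendsto_cocompact s.1 hlim
  simp only [hΨ, if_pos hz₀, hΦ₁] at h0
  rw [← h0]
  refine chainInt_congr fun w _ => ?_
  by_cases hw : w = s.1
  · rw [hw, dslope_same]
    have h1 : HasDerivAt H (deriv h s.1 * (s.1 - s.1) + h s.1 * 1) s.1 :=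
      ((hh.differentiableAt (hD.mem_nhds hz₀)).hasDerivAt).mul ((hasDerivAt_id _).sub_const _)
    rw [h1.deriv]; ring
  · rw [dslope_of_ne _ hw, slope_def_field]
    have : w - s.1 ≠ 0 := sub_ne_zero.2 hw
    simp only [hHdef]
    field_simp
    ring

/-- A chain of oriented segments in `V` leading from `a` to `b`. -/
structure IsChainIn (V : Set ℂ) (a b : ℂ) (L : List (ℂ × ℂ)) : Prop where
  subset : ∀ s ∈ L, segment ℝ s.1 s.2 ⊆ V
  boundary : ∀ F : ℂ → ℂ, (L.map fun s => F s.2 - F s.1).sum = F b - F a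

theorem list_sum_map_neg {α : Type*} (f : α → ℂ) (L : List α) :
    (L.map fun s => -f s).sum = -(L.map f).sum := by
  induction L with
  | nil => simp
  | cons a L ih => simp only [List.map_cons, List.sum_cons, ih]; ring

theorem IsChainIn.append {V : Set ℂ} {a b c : ℂ} {L M : List (ℂ × ℂ)} (hL : IsChainIn V a b L)
    (hM : IsChainIn V b c M) : IsChainIn V a c (L ++ M) := by
  refine ⟨fun s hs => ?_, fun F => ?_⟩
  · rcases List.mem_append.1 hs with h | h
    exacts [hL.subset s h, hM.subset s h]
  · rw [List.map_append, List.sum_append, hL.boundary, hM.boundary]; ring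

theorem IsChainIn.swap {V : Set ℂ} {a b : ℂ} {L : List (ℂ × ℂ)} (hL : IsChainIn V a b L) :
    IsChainIn V b a (L.map Prod.swap) := by
  refine ⟨fun s hs => ?_, fun F => ?_⟩
  · obtain ⟨s', hs', rfl⟩ := List.mem_map.1 hs
    rw [Prod.fst_swap, Prod.snd_swap, segment_symm]
    exact hL.subset _ hs'
  · rw [List.map_map, ← neg_sub, ← hL.boundary F, ← list_sum_map_neg]
    congr 1
    exact List.map_congr_left fun s _ => by simp

theorem isChainIn_singleton {V : Set ℂ} {a b : ℂ} (h : segment ℝ a b ⊆ V) :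
    IsChainIn V a b [(a, b)] := ⟨by simpa using h, by simp⟩

theorem chainInt_append (h : ℂ → ℂ) (L M : List (ℂ × ℂ)) :
    chainInt h (L ++ M) = chainInt h L + chainInt h M := by
  simp [chainInt]

theorem chainInt_swap (h : ℂ → ℂ) (L : List (ℂ × ℂ)) :
    chainInt h (L.map Prod.swap) = -chainInt h L := by
  rw [chainInt, chainInt, ← list_sum_map_neg, List.map_map]
  congr 1
  exact List.map_congr_left fun s _ => by simp [segInt_swap h s.1 s.2]

theorem exists_isChainIn {V : Set ℂ} (hV : IsOpen V) (hVc : IsPreconnected V) {a b : ℂ}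
    (ha : a ∈ V) (hb : b ∈ V) : ∃ L, IsChainIn V a b L := by
  refine hVc.induction₂ (fun a b => ∃ L, IsChainIn V a b L) ?_ ?_ ?_ ha hb
  · intro x hx
    obtain ⟨r, hr, hball⟩ := Metric.isOpen_iff.1 hV x hx
    refine mem_nhdsWithin_of_mem_nhds (Filter.mem_of_superset (ball_mem_nhds x hr) fun y hy => ?_)
    exact ⟨_, isChainIn_singleton (((convex_ball x r).segment_subset (mem_ball_self hr) hy).trans hball)⟩
  · rintro x y z - - - ⟨L, hL⟩ ⟨M, hM⟩
    exact ⟨_, hL.append hM⟩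
  · rintro x y - - ⟨L, hL⟩
    exact ⟨_, hL.swap⟩

theorem exists_primitive_of_cycles {V : Set ℂ} (hV : IsOpen V) (hVc : IsPreconnected V)
    {h : ℂ → ℂ} (hh : DifferentiableOn ℂ h V) (hcyc : ∀ L, IsCycleIn V L → chainInt h L = 0) :
    ∃ F : ℂ → ℂ, ∀ z ∈ V, HasDerivAt F (h z) z := by
  rcases V.eq_empty_or_nonempty with rfl | ⟨z₀, hz₀⟩
  · exact ⟨0, by simp⟩
  have hex : ∀ z, ∃ L, z ∈ V → IsChainIn V z₀ z L := fun z => by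
    by_cases hz : z ∈ V
    · obtain ⟨L, hL⟩ := exists_isChainIn hV hVc hz₀ hz
      exact ⟨L, fun _ => hL⟩
    · exact ⟨[], fun h => absurd h hz⟩
  choose P hP using hex
  refine ⟨fun z => chainInt h (P z), fun z hz => ?_⟩
  obtain ⟨r, hr, hball⟩ := Metric.isOpen_iff.1 hV z hz
  obtain ⟨G, hG⟩ := (hh.mono hball).isExactOn_ball
  have heq : ∀ y ∈ ball z r, chainInt h (P y) = G y + (chainInt h (P z) - G z) := by
    intro y hy
    have hseg : segment ℝ z y ⊆ ball z r := (convex_ball z r).segment_subset (mem_ball_self hr) hy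
    have hc := ((hP z hz).append (isChainIn_singleton (hseg.trans hball))).append
      (hP y (hball hy)).swap
    have h0 := hcyc _ ⟨hc.subset, fun F => by rw [hc.boundary]; ring⟩
    rw [chainInt_append, chainInt_append, chainInt_swap] at h0
    have h1 : chainInt h [(z, y)] = G y - G z := by
      simp only [chainInt, List.map_cons, List.map_nil, List.sum_cons, List.sum_nil, add_zero]
      exact segInt_eq_sub (fun w hw => hG w (hseg hw))
        (hh.continuousOn.mono (hseg.trans hball))
    rw [h1] at h0
    linear_combination -h0
  exact ((hG z (mem_ball_self hr)).add_const _).congr_of_eventuallyEq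
    (Filter.eventuallyEq_of_mem (ball_mem_nhds z hr) heq)

theorem exists_sqrt_of_cycles {V : Set ℂ} (hV : IsOpen V) (hVc : IsPreconnected V)
    (hcyc : ∀ h, DifferentiableOn ℂ h V → ∀ L, IsCycleIn V L → chainInt h L = 0) {f : ℂ → ℂ}
    (hf : DifferentiableOn ℂ f V) (hf0 : ∀ z ∈ V, f z ≠ 0) :
    ∃ g : ℂ → ℂ, DifferentiableOn ℂ g V ∧ ∀ z ∈ V, f z = g z ^ 2 := by
  rcases V.eq_empty_or_nonempty with rfl | ⟨z₀, hz₀⟩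
  · exact ⟨0, by simp, by simp⟩
  have hfat : ∀ z ∈ V, HasDerivAt f (deriv f z) z := fun z hz =>
    (hf.differentiableAt (hV.mem_nhds hz)).hasDerivAt
  have hq : DifferentiableOn ℂ (fun z => deriv f z / f z) V := (hf.deriv hV).div hf hf0
  obtain ⟨F, hF⟩ := exists_primitive_of_cycles hV hVc hq (hcyc _ hq)
  have hG : ∀ z ∈ V, HasDerivAt (fun z => f z * Complex.exp (-F z)) 0 z := by
    intro z hz
    refine ((hfat z hz).mul (hF z hz).neg.cexp).congr_deriv ?_
    have := hf0 z hz
    simp only [Pi.neg_apply]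
    field_simp
    ring
  have hconst : ∀ z ∈ V, f z * Complex.exp (-F z) = f z₀ * Complex.exp (-F z₀) := by
    intro z hz
    refine hV.is_const_of_deriv_eq_zero hVc
      (fun z hz => (hG z hz).differentiableAt.differentiableWithinAt)
      (fun z hz => (hG z hz).deriv) hz hz₀
  refine ⟨fun z => Complex.exp ((F z + (Complex.log (f z₀) - F z₀)) / 2), fun z hz =>
    ((((hF z hz).add_const _).div_const 2).cexp).differentiableAt.differentiableWithinAt,
    fun z hz => ?_⟩
  rw [← Complex.exp_nat_mul]
  have e : ((2 : ℕ) : ℂ) * ((F z + (Complex.log (f z₀) - F z₀)) / 2) =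
      F z + Complex.log (f z₀) + -F z₀ := by push_cast; ring
  rw [e, Complex.exp_add, Complex.exp_add, Complex.exp_log (hf0 z₀ hz₀), mul_assoc, ← hconst z hz,
    Complex.exp_neg]
  have := Complex.exp_ne_zero (F z)
  field_simp

theorem exists_sqrt_of_winding {D V : Set ℂ} (hV : IsOpen V) (hVc : IsPreconnected V)
    (hVD : V ⊆ D) (hDV : IsOpen (D \ V))
    (hwind : ∀ L, IsCycleIn D L → ∀ a, a ∉ D → chainInt (fun w => 1 / (w - a)) L = 0) {f : ℂ → ℂ}
    (hf : DifferentiableOn ℂ f V) (hf0 : ∀ z ∈ V, f z ≠ 0) :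
    ∃ g : ℂ → ℂ, DifferentiableOn ℂ g V ∧ ∀ z ∈ V, f z = g z ^ 2 := by
  classical
  refine exists_sqrt_of_cycles hV hVc (fun h hh L hL => ?_) hf hf0
  have hD : IsOpen D := by rw [← union_sdiff_cancel hVD]; exact hV.union hDV
  have hLD : IsCycleIn D L := ⟨fun s hs => (hL.subset s hs).trans hVD, hL.closed⟩
  have hh' : DifferentiableOn ℂ (V.piecewise h 0) D := by
    intro z hz
    by_cases hzV : z ∈ V
    · refine ((hh.differentiableAt (hV.mem_nhds hzV)).congr_of_eventuallyEq
        (Filter.eventuallyEq_of_mem (hV.mem_nhds hzV) fun y hy => ?_)).differentiableWithinAt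
      exact piecewise_eq_of_mem _ _ _ hy
    · refine ((differentiableAt_const (0 : ℂ)).congr_of_eventuallyEq
        (Filter.eventuallyEq_of_mem (hDV.mem_nhds ⟨hz, hzV⟩) fun y hy => ?_)).differentiableWithinAt
      exact piecewise_eq_of_notMem _ _ _ hy.2
  rw [← hLD.chainInt_eq_zero_of_winding hD (hwind L hLD) hh']
  exact chainInt_congr fun w hw => (piecewise_eq_of_mem _ _ _ (hL.chainSupport_subset hw)).symm

theorem const_of_exp_eq_one {G : ℝ → ℂ} (hG : Continuous G) (h1 : ∀ t, Complex.exp (G t) = 1)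
    (s t : ℝ) : G s = G t := by
  have hmem : ∀ t, ∃ n : ℤ, G t = n * (2 * Real.pi * Complex.I) := fun t =>
    Complex.exp_eq_one_iff.1 (h1 t)
  choose n hn using hmem
  have hcont : Continuous fun t => (n t : ℝ) := by
    have : (fun t => (n t : ℝ)) = fun t => (G t).im / (2 * Real.pi) := by
      funext t
      rw [hn t]
      simp [Real.pi_ne_zero]
    rw [this]
    fun_prop
  have hcn : Continuous n := Int.isClosedEmbedding_coe_real.isEmbedding.continuous_iff.2 hcont
  have := (isPreconnected_univ (α := ℝ)).constant hcn.continuousOn (mem_univ s) (mem_univ t)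
  rw [hn s, hn t, this]

theorem isSimplyConnected_of_convex {s : Set ℂ} (hs : Convex ℝ s) (hne : s.Nonempty) :
    IsSimplyConnected s := by
  have := hs.contractibleSpace hne
  exact (inferInstance : SimplyConnectedSpace s)

theorem not_exists_log_sub_on_sphere {a : ℂ} {R : ℝ} (ha : ‖a‖ < R) {G : ℂ → ℂ}
    (hG : Continuous G) (h : ∀ z, ‖z‖ = R → Complex.exp (G z) = z - a) : False := by
  have hR : 0 < R := (norm_nonneg a).trans_lt ha
  set c : ℝ → ℂ := fun t => circleMap 0 R t with hc
  have hcc : Continuous c := continuous_circleMap 0 R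
  have hcn : ∀ t, ‖c t‖ = R := fun t => by simp [hc, abs_of_pos hR]
  have hc0 : ∀ t, c t ≠ 0 := fun t h0 => by
    have := hcn t
    rw [h0, norm_zero] at this
    exact hR.ne this
  have hslit : ∀ t, 1 - a / c t ∈ Complex.slitPlane := fun t => by
    refine Complex.mem_slitPlane_of_norm_lt_one (z := -(a / c t)) ?_ |> fun h => by simpa [sub_eq_add_neg] using h
    rw [norm_neg, norm_div, hcn, div_lt_one hR]
    exact ha
  set K : ℝ → ℂ := fun t => G (c t) - Complex.log (1 - a / c t) - Complex.log R - t * Complex.I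
  have hK : Continuous K := by
    have : Continuous fun t => Complex.log (1 - a / c t) :=
      Continuous.clog (continuous_const.sub (continuous_const.div hcc hc0)) hslit
    fun_prop
  have hR0 : (R : ℂ) ≠ 0 := by exact_mod_cast hR.ne'
  have hK1 : ∀ t, Complex.exp (K t) = 1 := fun t => by
    simp only [K]
    rw [Complex.exp_sub, Complex.exp_sub, Complex.exp_sub, h _ (hcn t),
      Complex.exp_log (Complex.slitPlane_ne_zero (hslit t)), Complex.exp_log hR0]
    have h1 : c t = R * Complex.exp (t * Complex.I) := by simp [hc, circleMap]
    have h2 : 1 - a / c t = (c t - a) / c t := by field_simp [hc0 t]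
    have h3 : c t - a ≠ 0 := fun h0 => by
      have := hcn t
      rw [sub_eq_zero.1 h0] at this
      exact ha.ne this
    rw [h2, div_div_eq_mul_div, div_div, ← h1]
    have := hc0 t
    field_simp
  have := const_of_exp_eq_one hK hK1 0 (2 * Real.pi)
  simp only [K] at this
  have hper : c (2 * Real.pi) = c 0 := by simp [hc, circleMap]
  rw [hper] at this
  have h2 : (2 * Real.pi : ℂ) * Complex.I = 0 := by
    push_cast at this
    linear_combination this
  simp [Real.pi_ne_zero] at h2

/-- If `C` is a compact set surrounded by an open set carrying a continuous branch of `log (z - a)`,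
then `a ∉ C`. -/
theorem not_exists_log_sub_of_isCompact {C U : Set ℂ} {R : ℝ} (hC : IsCompact C)
    (hCR : C ⊆ ball 0 R) {ε : ℝ} (hε : 0 < ε)
    (hU : ∀ z ∈ ball (0 : ℂ) R, z ∉ C → infDist z C < ε → z ∈ U) {a : ℂ} (ha : a ∈ C) {L : ℂ → ℂ}
    (hL : ContinuousOn L U) (h : ∀ z ∈ U, Complex.exp (L z) = z - a) : False := by
  obtain ⟨η, hη, hηR⟩ := hC.exists_cthickening_subset_open isOpen_ball hCR
  have hne : C.Nonempty := ⟨a, ha⟩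
  set ρ := min (ε / 2) η with hρ
  have hρ0 : 0 < ρ := by positivity
  set Q : Set ℂ := {z | infDist z C = ρ} with hQ
  have hQc : IsClosed Q := isClosed_eq (continuous_infDist_pt C) continuous_const
  have hin : ∀ z, infDist z C ≤ ρ → z ∈ ball (0 : ℂ) R := fun z hz => hηR (by
    rw [mem_cthickening_iff, ← ENNReal.ofReal_toReal (infEDist_ne_top hne)]
    exact ENNReal.ofReal_le_ofReal (hz.trans (min_le_right _ _)))
  have hQU : Q ⊆ U := fun z hz => by
    have hz : infDist z C = ρ := hz
    refine hU z (hin z hz.le) (fun hzC => ?_) ?_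
    · rw [infDist_zero_of_mem hzC] at hz
      exact hρ0.ne hz
    · rw [hz]
      exact (min_le_left _ _).trans_lt (half_lt_self hε)
  obtain ⟨L', hL'⟩ := ContinuousMap.exists_restrict_eq hQc
    ⟨fun z : Q => L z, continuousOn_iff_continuous_domRestrict.1 (hL.mono hQU)⟩
  have hL'Q : ∀ z ∈ Q, L' z = L z := fun z hz => by
    exact DFunLike.congr_fun hL' (⟨z, hz⟩ : Q)
  set F : ℂ → ℂ := fun z => if infDist z C ≤ ρ then Complex.exp (L' z) else z - a with hF
  have hFc : Continuous F := by
    refine Continuous.if_le (by fun_prop) (by fun_prop) (continuous_infDist_pt C) continuous_const ?_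
    intro z hz
    rw [hL'Q z hz, h z (hQU hz)]
  have hF0 : (0 : ℂ) ∉ F '' univ := by
    rintro ⟨z, -, hz⟩
    simp only [hF] at hz
    split_ifs at hz with h1
    · exact Complex.exp_ne_zero _ hz
    · rw [sub_eq_zero.1 hz, infDist_zero_of_mem ha] at h1
      exact h1 hρ0.le
  obtain ⟨G, hGc, hG⟩ := Complex.exists_continuousOn_eqOn_exp_comp
    (isSimplyConnected_of_convex convex_univ univ_nonempty) isOpen_univ hFc.continuousOn hF0
  have haR : ‖a‖ < R := by simpa using hCR ha
  refine not_exists_log_sub_on_sphere haR (continuousOn_univ.1 hGc) fun z hz => ?_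
  have : Complex.exp (G z) = F z := hG (mem_univ z)
  rw [this]
  simp only [hF]
  rw [if_neg]
  intro h1
  have := hin z h1
  rw [mem_ball_zero_iff] at this
  exact this.ne hz

theorem isOpen_sdiff_connectedComponentIn {D : Set ℂ} (hD : IsOpen D) (x : ℂ) :
    IsOpen (D \ connectedComponentIn D x) := by
  have : D \ connectedComponentIn D x =
      ⋃ y ∈ D \ connectedComponentIn D x, connectedComponentIn D y := by
    refine Subset.antisymm (fun y hy => mem_biUnion hy (mem_connectedComponentIn hy.1)) ?_
    refine iUnion₂_subset fun y hy z hz => ⟨connectedComponentIn_subset _ _ hz, fun hzx => ?_⟩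
    have h1 := connectedComponentIn_eq hz
    have h2 := connectedComponentIn_eq hzx
    exact hy.2 (by rw [h2, ← h1]; exact mem_connectedComponentIn hy.1)
  rw [this]
  exact isOpen_biUnion fun y _ => hD.connectedComponentIn

theorem exists_fill_of_isBounded {U₁ U₀ : Set ℂ} (h1 : IsOpen U₁) (h1c : IsConnected U₁)
    (hb : Bornology.IsBounded U₁) (h10 : U₁ ⊆ U₀)
    (hlog : ∀ a, a ∉ U₀ → ∃ L : ℂ → ℂ, ContinuousOn L U₁ ∧ ∀ z ∈ U₁, Complex.exp (L z) = z - a) :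
    ∃ V : Set ℂ, IsOpen V ∧ IsConnected V ∧ U₁ ⊆ V ∧ V ⊆ U₀ ∧
      ∀ f : ℂ → ℂ, DifferentiableOn ℂ f V → (∀ z ∈ V, f z ≠ 0) →
        ∃ h : ℂ → ℂ, DifferentiableOn ℂ h V ∧ ∀ z ∈ V, f z = h z ^ 2 := by
  obtain ⟨R, hR0, hR⟩ := hb.subset_ball_lt 0 0
  set F := closedBall (0 : ℂ) R \ U₁ with hF
  have hFc : IsCompact F := (isCompact_closedBall _ _).diff h1
  have hsph : sphere (0 : ℂ) R ⊆ F := fun z hz => by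
    rw [mem_sphere_zero_iff_norm] at hz
    refine ⟨by simp [hz], fun h => ?_⟩
    have := hR h
    rw [mem_ball_zero_iff] at this
    exact this.ne hz
  have hpS : (R : ℂ) ∈ sphere (0 : ℂ) R := by simp [abs_of_pos hR0]
  have hp := hsph hpS
  set A := connectedComponentIn F R with hA
  have hAF : A ⊆ F := connectedComponentIn_subset _ _
  have hAc : IsClosed A := by
    rw [hA, connectedComponentIn_eq_image hp]
    exact hFc.isClosed.isClosedMap_subtype_val _ isClosed_connectedComponent
  set D := ball (0 : ℂ) R \ A with hD
  have hDo : IsOpen D := isOpen_ball.sdiff hAc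
  have hUD : U₁ ⊆ D := fun z hz => ⟨hR hz, fun h => (hAF h).2 hz⟩
  obtain ⟨x, hx⟩ := h1c.nonempty
  have hVD : connectedComponentIn D x ⊆ D := connectedComponentIn_subset _ _
  refine ⟨connectedComponentIn D x, hDo.connectedComponentIn,
    isConnected_connectedComponentIn_iff.2 (hUD hx), h1c.isPreconnected.subset_connectedComponentIn hx hUD, ?_, ?_⟩
  · intro a haV
    by_contra haU
    obtain ⟨L, hL, hLe⟩ := hlog a haU
    have haD := hVD haV
    have haF : a ∈ F := ⟨ball_subset_closedBall haD.1, fun h => haU (h10 h)⟩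
    have : CompactSpace F := isCompact_iff_compactSpace.1 hFc
    have hna : (⟨a, haF⟩ : F) ∉ connectedComponent (⟨R, hp⟩ : F) := fun h => haD.2 (by
      rw [hA, connectedComponentIn_eq_image hp]
      exact ⟨_, h, rfl⟩)
    rw [connectedComponent_eq_iInter_isClopen] at hna
    simp only [mem_iInter, not_forall] at hna
    obtain ⟨⟨s, hs, hps⟩, has⟩ := hna
    have hCc : IsCompact (Subtype.val '' sᶜ : Set ℂ) :=
      hs.compl.1.isCompact.image continuous_subtype_val
    have hEc : IsCompact (Subtype.val '' s : Set ℂ) := hs.1.isCompact.image continuous_subtype_val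
    have hdisj : Disjoint (Subtype.val '' sᶜ : Set ℂ) (Subtype.val '' s) := by
      rw [disjoint_image_iff Subtype.val_injective]
      exact disjoint_compl_left
    have hsphE : sphere (0 : ℂ) R ⊆ Subtype.val '' s := by
      have hcon : IsPreconnected (sphere (0 : ℂ) R) :=
        isPreconnected_sphere (by rw [Complex.rank_real_complex]; norm_num) 0 R
      have := hcon.subset_connectedComponentIn hpS hsph
      refine this.trans ?_
      rw [connectedComponentIn_eq_image hp]
      exact image_mono (hs.connectedComponent_subset hps)
    have hCR : (Subtype.val '' sᶜ : Set ℂ) ⊆ ball 0 R := by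
      rintro _ ⟨z, hz, rfl⟩
      rw [mem_ball_zero_iff]
      refine lt_of_le_of_ne (by simpa using z.2.1) fun h => ?_
      obtain ⟨w, hw, hwz⟩ := hsphE (show (z : ℂ) ∈ sphere (0 : ℂ) R by simpa using h)
      exact hz (Subtype.val_injective hwz ▸ hw)
    obtain ⟨ε, hε, hdε⟩ := hdisj.exists_thickenings hCc hEc.isClosed
    refine not_exists_log_sub_of_isCompact hCc hCR hε (fun z hzR hzC hzε => ?_)
      ⟨⟨a, haF⟩, has, rfl⟩ hL hLe
    by_contra hzU
    have hzF : z ∈ F := ⟨ball_subset_closedBall hzR, hzU⟩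
    have hzs : z ∈ Subtype.val '' s := by
      by_contra h
      exact hzC ⟨⟨z, hzF⟩, fun h' => h ⟨_, h', rfl⟩, rfl⟩
    have hza : z ∈ thickening ε (Subtype.val '' sᶜ) := by
      refine (mem_thickening_iff_infDist_lt (Set.Nonempty.image _ ?_)).2 hzε
      exact ⟨⟨a, haF⟩, has⟩
    exact disjoint_left.1 hdε hza (self_subset_thickening hε _ hzs)
  · intro f hf hf0
    refine exists_sqrt_of_winding hDo.connectedComponentIn isPreconnected_connectedComponentIn hVD
      (isOpen_sdiff_connectedComponentIn hDo x) (fun L hL a haD => ?_) hf hf0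
    have hLb : IsCycleIn (ball 0 R) L := ⟨fun s hs => (hL.subset s hs).trans sdiff_subset, hL.closed⟩
    rcases le_or_gt R ‖a‖ with h | h
    · exact hLb.chainInt_inv_eq_zero_of_ball h
    · have haA : a ∈ A := by
        by_contra h'
        exact haD ⟨by simpa using h, h'⟩
      rw [hL.chainInt_inv_eq isPreconnected_connectedComponentIn
        (disjoint_left.2 fun z hz hz' => (hL.chainSupport_subset hz').2 hz) haA
        (mem_connectedComponentIn hp)]
      exact hLb.chainInt_inv_eq_zero_of_ball (by simp [abs_of_pos hR0])

theorem exists_fill_of_disjoint_ball {U₁ U₀ : Set ℂ} (h1 : IsOpen U₁) (h1c : IsConnected U₁)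
    {c : ℂ} {ρ : ℝ} (hρ : 0 < ρ) (hdisj : Disjoint U₀ (ball c ρ)) (h10 : U₁ ⊆ U₀)
    (hlog : ∀ a, a ∉ U₀ → ∃ L : ℂ → ℂ, ContinuousOn L U₁ ∧ ∀ z ∈ U₁, Complex.exp (L z) = z - a) :
    ∃ V : Set ℂ, IsOpen V ∧ IsConnected V ∧ U₁ ⊆ V ∧ V ⊆ U₀ ∧
      ∀ f : ℂ → ℂ, DifferentiableOn ℂ f V → (∀ z ∈ V, f z ≠ 0) →
        ∃ h : ℂ → ℂ, DifferentiableOn ℂ h V ∧ ∀ z ∈ V, f z = h z ^ 2 := by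
  have hc0 : c ∉ U₀ := fun h => disjoint_left.1 hdisj h (mem_ball_self hρ)
  set J : ℂ → ℂ := fun z => (z - c)⁻¹ with hJ
  set K : ℂ → ℂ := fun w => c + w⁻¹ with hK
  have hKJ : ∀ z, K (J z) = z := fun z => by simp [hJ, hK]
  have hJK : ∀ w, J (K w) = w := fun w => by simp [hJ, hK]
  have hKd : DifferentiableOn ℂ K {0}ᶜ := fun w hw =>
    ((differentiableAt_inv hw).const_add c).differentiableWithinAt
  have hJd : DifferentiableOn ℂ J {c}ᶜ := fun z hz =>
    ((differentiableAt_id.sub_const c).inv (sub_ne_zero.2 hz)).differentiableWithinAt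
  have hJ0 : ∀ z, J z = 0 ↔ z = c := fun z => by simp [hJ, sub_eq_zero]
  have hKc : ∀ w, K w = c ↔ w = 0 := fun z => by simp [hK]
  have himg : ∀ S : Set ℂ, J '' S = K ⁻¹' S := fun S =>
    congrFun (image_eq_preimage_of_inverse hKJ hJK) S
  have himg' : ∀ S : Set ℂ, K '' S = J ⁻¹' S := fun S =>
    congrFun (image_eq_preimage_of_inverse hJK hKJ) S
  have hsub1 : ∀ S : Set ℂ, S ⊆ U₀ → J '' S ⊆ {0}ᶜ := by
    rintro S hS _ ⟨z, hz, rfl⟩ h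
    exact hc0 ((hJ0 z).1 h ▸ hS hz)
  have hopen : IsOpen (J '' U₁) := by
    rw [himg, ← inter_eq_right.2 ((himg U₁).symm.subset.trans (hsub1 _ h10))]
    exact hKd.continuousOn.isOpen_inter_preimage isOpen_compl_singleton h1
  have hU1c : U₁ ⊆ {c}ᶜ := fun z hz h => hc0 (h ▸ h10 hz)
  have hbdd : Bornology.IsBounded (J '' U₁) := by
    refine (isBounded_closedBall (x := (0 : ℂ)) (r := ρ⁻¹)).subset ?_
    rintro _ ⟨z, hz, rfl⟩
    have h2 : z ∉ ball c ρ := fun h => disjoint_left.1 hdisj (h10 hz) h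
    rw [mem_ball, not_lt, dist_eq_norm] at h2
    rw [mem_closedBall_zero_iff, hJ, norm_inv]
    exact inv_anti₀ hρ h2
  have hmaps : MapsTo K (J '' U₁) U₁ := by
    rintro _ ⟨z, hz, rfl⟩
    rwa [hKJ]
  have hKon : ContinuousOn K (J '' U₁) := hKd.continuousOn.mono (hsub1 _ h10)
  obtain ⟨V, hVo, hVc, hUV, hVU, hV⟩ := exists_fill_of_isBounded hopen
    (h1c.image J (hJd.continuousOn.mono hU1c)) hbdd (image_mono h10) (fun b hb => by
      obtain ⟨L₁, hL₁, hL₁e⟩ := hlog c hc0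
      by_cases hb0 : b = 0
      · refine ⟨fun w => -L₁ (K w), (hL₁.comp hKon hmaps).neg, fun w hw => ?_⟩
        rw [Complex.exp_neg, hL₁e _ (hmaps hw), hb0, sub_zero]
        exact hJK w
      · obtain ⟨L₂, hL₂, hL₂e⟩ := hlog (K b) (fun h => hb ⟨_, h, hJK b⟩)
        refine ⟨fun w => L₂ (K w) - L₁ (K w) + Complex.log (-b),
          ((hL₂.comp hKon hmaps).sub (hL₁.comp hKon hmaps)).add continuousOn_const, fun w hw => ?_⟩
        have hw0 : w ≠ 0 := hsub1 _ h10 hw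
        rw [Complex.exp_add, Complex.exp_sub, hL₁e _ (hmaps hw), hL₂e _ (hmaps hw),
          Complex.exp_log (neg_ne_zero.2 hb0)]
        simp only [hK]
        field_simp
        ring)
  have hV0 : V ⊆ {0}ᶜ := hVU.trans (hsub1 _ subset_rfl)
  have hKV0 : K '' V ⊆ {c}ᶜ := by
    rintro _ ⟨w, hw, rfl⟩ h
    exact hV0 hw ((hKc w).1 h)
  have hmJ : MapsTo J (K '' V) V := by
    rintro _ ⟨w, hw, rfl⟩
    rwa [hJK]
  refine ⟨K '' V, ?_, hVc.image K (hKd.continuousOn.mono hV0), ?_, ?_, ?_⟩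
  · rw [himg', ← inter_eq_right.2 ((himg' V).symm.subset.trans hKV0)]
    exact hJd.continuousOn.isOpen_inter_preimage isOpen_compl_singleton hVo
  · exact fun z hz => ⟨J z, hUV ⟨z, hz, rfl⟩, hKJ z⟩
  · rintro _ ⟨w, hw, rfl⟩
    obtain ⟨z, hz, rfl⟩ := hVU hw
    rwa [hKJ]
  · intro f hf hf0
    obtain ⟨h, hh, he⟩ := hV (f ∘ K) (hf.comp (hKd.mono hV0) (mapsTo_image K V))
      fun w hw => hf0 _ ⟨w, hw, rfl⟩
    refine ⟨h ∘ J, hh.comp (hJd.mono hKV0) hmJ, ?_⟩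
    rintro _ ⟨w, hw, rfl⟩
    simpa [hJK] using he w hw

/-- A domain `U₁ ⊆ U₀` such that no closed curve in `U₁` winds around a point outside `U₀` can be
enlarged inside `U₀` to a conformal disc. -/
theorem exists_bijOn_unit_ball_between {U₁ U₀ : Set ℂ} (h1 : IsOpen U₁) (h1c : IsConnected U₁)
    {c : ℂ} {ρ : ℝ} (hρ : 0 < ρ) (hdisj : Disjoint U₀ (ball c ρ)) (h10 : U₁ ⊆ U₀)
    (hlog : ∀ a, a ∉ U₀ → ∃ L : ℂ → ℂ, ContinuousOn L U₁ ∧ ∀ z ∈ U₁, Complex.exp (L z) = z - a) :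
    ∃ (V : Set ℂ) (ψ : ℂ → ℂ), IsOpen V ∧ IsConnected V ∧ U₁ ⊆ V ∧ V ⊆ U₀ ∧
      DifferentiableOn ℂ ψ V ∧ BijOn ψ V (ball 0 1) := by
  obtain ⟨V, hVo, hVc, hUV, hVU, hV⟩ := exists_fill_of_disjoint_ball h1 h1c hρ hdisj h10 hlog
  obtain ⟨z₀, hz₀⟩ := hVc.nonempty
  obtain ⟨ψ, hψ, hbij, -⟩ := exists_bijOn_unit_ball hVo hVc.isPreconnected hz₀ hρ
    (hdisj.mono_left hVU) hV
  exact ⟨V, ψ, hVo, hVc, hUV, hVU, hψ, hbij⟩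

section

open InnerProductSpace

theorem eventually_eq_of_isLocalMax_of_harmonicAt {f : ℂ → ℝ} {z : ℂ} (hf : HarmonicAt f z)
    (hmax : IsLocalMax f z) : ∀ᶠ y in 𝓝 z, f y = f z := by
  obtain ⟨ε, hε, hball⟩ := Metric.isOpen_iff.1 (isOpen_setOfPred_harmonicAt (f := f)) z hf
  obtain ⟨F, hF, hre⟩ := HarmonicOnNhd.exists_analyticOnNhd_ball_re_eq (f := f) (z := z) (R := ε)
    fun y hy => hball hy
  have hz := mem_ball_self hε (x := z)
  have hb : ball z ε ∈ 𝓝 z := ball_mem_nhds z hε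
  have h1 : ∀ᶠ y in 𝓝 z, DifferentiableAt ℂ (fun y => Complex.exp (F y)) y := by
    filter_upwards [hb] with y hy
    exact (hF y hy).differentiableAt.cexp
  have h2 : IsLocalMax (norm ∘ fun y => Complex.exp (F y)) z := by
    filter_upwards [hmax, hb] with y hy hyb
    simp only [Function.comp, Complex.norm_exp]
    rw [Real.exp_le_exp, show (F y).re = f y from hre hyb, show (F z).re = f z from hre hz]
    exact hy
  filter_upwards [Complex.norm_eventually_eq_of_isLocalMax h1 h2, hb] with y hy hyb
  simp only [Complex.norm_exp] at hy
  rw [← show (F y).re = f y from hre hyb, ← show (F z).re = f z from hre hz]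
  exact Real.exp_injective hy

/-- **Maximum principle** for harmonic functions on bounded open sets. -/
theorem le_of_harmonicOnNhd_of_frontier_le {D : Set ℂ} (hD : IsOpen D)
    (hb : Bornology.IsBounded D) {f : ℂ → ℝ} (hf : HarmonicOnNhd f D)
    (hc : ContinuousOn f (closure D)) {M : ℝ} (hM : ∀ z ∈ frontier D, f z ≤ M) {z : ℂ}
    (hz : z ∈ D) : f z ≤ M := by
  have hcomp : IsCompact (closure D) := hb.isCompact_closure
  obtain ⟨x, hx, hxmax⟩ := hcomp.exists_isMaxOn ⟨z, subset_closure hz⟩ hc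
  refine (hxmax (subset_closure hz)).trans ?_
  by_contra! hlt
  set K := closure D ∩ f ⁻¹' {f x} with hK
  have hKcl : IsClosed K := hc.preimage_isClosed_of_isClosed isClosed_closure isClosed_singleton
  have hKD : K ⊆ D := fun y hy => by
    by_contra hyD
    have : y ∈ frontier D := ⟨hy.1, by rwa [hD.interior_eq]⟩
    have h1 := hM y this
    rw [show f y = f x from hy.2] at h1
    exact hlt.not_ge h1
  have hKo : IsOpen K := by
    rw [isOpen_iff_mem_nhds]
    intro y hy
    have hyD := hKD hy
    have hfy : f y = f x := hy.2
    have hDy := hD.mem_nhds hyD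
    have hloc : IsLocalMax f y := by
      filter_upwards [hDy] with w hw
      rw [hfy]
      exact hxmax (subset_closure hw)
    filter_upwards [eventually_eq_of_isLocalMax_of_harmonicAt (hf y hyD) hloc, hDy] with w hw hwD
    exact ⟨subset_closure hwD, hw.trans hfy⟩
  rcases isClopen_iff.1 ⟨hKcl, hKo⟩ with h | h
  · exact (h ▸ (⟨hx, rfl⟩ : x ∈ K) : x ∈ (∅ : Set ℂ))
  · have : D = univ := univ_subset_iff.1 (h ▸ hKD)
    rw [this] at hb
    exact NormedSpace.unbounded_univ ℝ ℂ hb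

theorem continuousOn_poissonKernel_sphere {c w : ℂ} {R : ℝ} (hw : w ∈ ball c R) :
    ContinuousOn (poissonKernel c w) (sphere c R) := by
  have : ∀ z ∈ sphere c R, ‖z - c - (w - c)‖ ^ 2 ≠ 0 := fun z hz => by
    rw [sub_sub_sub_cancel_right]
    refine pow_ne_zero 2 (norm_ne_zero_iff.2 (sub_ne_zero.2 fun h => ?_))
    rw [h, mem_sphere] at hz
    exact (mem_ball.1 hw).ne hz
  have e : poissonKernel c w =
      fun z => (‖z - c‖ ^ 2 - ‖w - c‖ ^ 2) / ‖z - c - (w - c)‖ ^ 2 := by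
    funext z
    rw [poissonKernel_def]
  rw [e]
  exact ContinuousOn.div (by fun_prop) (by fun_prop) this

theorem le_mul_of_poissonKernel_le {g : ℂ → ℝ} {c z y : ℂ} {R K : ℝ}
    (hg : HarmonicContOnCl g (ball c R)) (hpos : ∀ ζ ∈ sphere c R, 0 ≤ g ζ)
    (hz : z ∈ ball c R) (hy : y ∈ ball c R)
    (hK : ∀ ζ ∈ sphere c R, g ζ ≠ 0 → poissonKernel c z ζ ≤ K * poissonKernel c y ζ) :
    g z ≤ K * g y := by
  have hR : 0 < R := pos_of_mem_ball hz
  have habs : |R| = R := abs_of_pos hR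
  have hgc : ContinuousOn g (sphere c R) := hg.2.mono (by
    rw [closure_ball c hR.ne']
    exact sphere_subset_closedBall)
  have hint : ∀ w ∈ ball c R, CircleIntegrable (poissonKernel c w • g) c R := fun w hw =>
    ((continuousOn_poissonKernel_sphere hw).smul hgc).circleIntegrable hR.le
  rw [← hg.circleAverage_poissonKernel_smul hz, ← hg.circleAverage_poissonKernel_smul hy,
    ← smul_eq_mul, ← Real.circleAverage_smul]
  refine Real.circleAverage_mono (hint z hz) ((hint y hy).const_smul) fun ζ hζ => ?_
  rw [habs] at hζ
  simp only [Pi.smul_apply, Pi.mul_apply, smul_eq_mul, Pi.smul_apply']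
  rcases eq_or_ne (g ζ) 0 with h0 | h0
  · simp [h0]
  · rw [← mul_assoc]
    exact mul_le_mul_of_nonneg_right (hK ζ hζ h0) (hpos ζ hζ)

theorem harnack_ball {g : ℂ → ℝ} {c y : ℂ} {R : ℝ} (hg : HarmonicOnNhd g (ball c R))
    (hpos : ∀ z ∈ ball c R, 0 ≤ g z) (hy : y ∈ ball c (R / 4)) :
    g c ≤ 3 * g y ∧ g y ≤ 4 * g c := by
  have hR : 0 < R := by linarith [pos_of_mem_ball hy]
  have hsub : closedBall c (R / 2) ⊆ ball c R := closedBall_subset_ball (by linarith)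
  have hcl : HarmonicContOnCl g (ball c (R / 2)) := HarmonicOnNhd.harmonicContOnCl (by
    rw [closure_ball c (by positivity)]
    exact hg.mono hsub)
  have hp : ∀ ζ ∈ sphere c (R / 2), 0 ≤ g ζ := fun ζ hζ => hpos ζ (hsub (sphere_subset_closedBall hζ))
  have hyb : y ∈ ball c (R / 2) := ball_subset_ball (by linarith) hy
  have hcb : c ∈ ball c (R / 2) := mem_ball_self (by positivity)
  rw [mem_ball, dist_eq_norm] at hy
  have key : ∀ ζ ∈ sphere c (R / 2), ‖ζ - c‖ = R / 2 ∧ R / 4 < ‖ζ - c - (y - c)‖ ∧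
      ‖ζ - c - (y - c)‖ < 3 * R / 4 := fun ζ hζ => by
    rw [mem_sphere, dist_eq_norm] at hζ
    refine ⟨hζ, ?_, ?_⟩
    · linarith [norm_sub_norm_le (ζ - c) (y - c)]
    · linarith [norm_sub_le (ζ - c) (y - c)]
  constructor
  · refine le_mul_of_poissonKernel_le hcl hp hcb hyb fun ζ hζ _ => ?_
    obtain ⟨h1, h2, h3⟩ := key ζ hζ
    have h4 : 0 < ‖ζ - c - (y - c)‖ := by linarith
    rw [poissonKernel_def, poissonKernel_def, sub_self, sub_zero, norm_zero, h1, mul_div_assoc',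
      div_le_div_iff₀ (by positivity) (by positivity)]
    have h5 : ‖y - c‖ ^ 2 ≤ (R / 4) ^ 2 := by gcongr
    have h6 : ‖ζ - c - (y - c)‖ ^ 2 ≤ (3 * R / 4) ^ 2 := by gcongr
    nlinarith [sq_nonneg R]
  · refine le_mul_of_poissonKernel_le hcl hp hyb hcb fun ζ hζ _ => ?_
    obtain ⟨h1, h2, h3⟩ := key ζ hζ
    have h4 : 0 < ‖ζ - c - (y - c)‖ := by linarith
    rw [poissonKernel_def, poissonKernel_def, sub_self, sub_zero, norm_zero, h1, mul_div_assoc',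
      div_le_div_iff₀ (by positivity) (by positivity)]
    have h5 : 0 ≤ ‖y - c‖ ^ 2 := by positivity
    have h6 : (R / 4) ^ 2 ≤ ‖ζ - c - (y - c)‖ ^ 2 := by gcongr
    nlinarith [sq_nonneg R]

/-- **Harnack's inequality** on compact connected sets. -/
theorem exists_harnack_const {O K : Set ℂ} (hO : IsOpen O) (hK : IsCompact K)
    (hKc : IsPreconnected K) (hKO : K ⊆ O) :
    ∃ h : ℝ, 0 < h ∧ ∀ g : ℂ → ℝ, HarmonicOnNhd g O → (∀ z ∈ O, 0 ≤ g z) →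
      ∀ x ∈ K, ∀ y ∈ K, h * g x ≤ g y := by
  rcases K.eq_empty_or_nonempty with rfl | ⟨x₀, hx₀⟩
  · exact ⟨1, one_pos, by simp⟩
  have hball : ∀ x ∈ K, ∃ R > 0, ∀ y ∈ ball x R, ∀ g : ℂ → ℝ, HarmonicOnNhd g O →
      (∀ z ∈ O, 0 ≤ g z) → g x ≤ 4 * g y ∧ g y ≤ 4 * g x := fun x hx => by
    obtain ⟨R, hR, hRO⟩ := Metric.isOpen_iff.1 hO x (hKO hx)
    refine ⟨R / 4, by positivity, fun y hy g hg hpos => ?_⟩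
    have := harnack_ball (hg.mono hRO) (fun z hz => hpos z (hRO hz)) hy
    have hy0 := hpos y (hRO (ball_subset_ball (by linarith) hy))
    exact ⟨by linarith [this.1], this.2⟩
  have hpair : ∀ y ∈ K, ∃ C > 0, ∀ g : ℂ → ℝ, HarmonicOnNhd g O →
      (∀ z ∈ O, 0 ≤ g z) → g x₀ ≤ C * g y ∧ g y ≤ C * g x₀ := by
    intro y hy
    refine hKc.induction₂ (fun a b => ∃ C > 0, ∀ g : ℂ → ℝ, HarmonicOnNhd g O →
      (∀ z ∈ O, 0 ≤ g z) → g a ≤ C * g b ∧ g b ≤ C * g a) ?_ ?_ ?_ hx₀ hy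
    · intro x hx
      obtain ⟨R, hR, h⟩ := hball x hx
      exact mem_nhdsWithin_of_mem_nhds (Filter.mem_of_superset (ball_mem_nhds x hR)
        fun y hy => ⟨4, by norm_num, h y hy⟩)
    · rintro a b c - - - ⟨C, hC, h1⟩ ⟨C', hC', h2⟩
      refine ⟨C * C', by positivity, fun g hg hpos => ?_⟩
      obtain ⟨ha, hb⟩ := h1 g hg hpos
      obtain ⟨hb', hc⟩ := h2 g hg hpos
      exact ⟨by nlinarith, by nlinarith⟩
    · rintro a b - - ⟨C, hC, h1⟩
      exact ⟨C, hC, fun g hg hpos => (h1 g hg hpos).symm⟩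
  have huni : ∃ C > 0, ∀ y ∈ K, ∀ g : ℂ → ℝ, HarmonicOnNhd g O →
      (∀ z ∈ O, 0 ≤ g z) → g x₀ ≤ C * g y ∧ g y ≤ C * g x₀ := by
    have hnn : ∀ z ∈ K, ∀ g : ℂ → ℝ, (∀ z ∈ O, 0 ≤ g z) → 0 ≤ g z := fun z hz g h => h z (hKO hz)
    refine hK.induction_on (p := fun S => ∃ C > 0, ∀ y ∈ S, ∀ g : ℂ → ℝ, HarmonicOnNhd g O →
      (∀ z ∈ O, 0 ≤ g z) → 0 ≤ g y → g x₀ ≤ C * g y ∧ g y ≤ C * g x₀) ?_ ?_ ?_ ?_ |> fun ⟨C, hC, h⟩ =>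
      ⟨C, hC, fun y hy g hg hpos => h y hy g hg hpos (hnn y hy g hpos)⟩
    · exact ⟨1, one_pos, by simp⟩
    · rintro s t hst ⟨C, hC, h⟩
      exact ⟨C, hC, fun y hy => h y (hst hy)⟩
    · rintro s t ⟨C, hC, h⟩ ⟨C', hC', h'⟩
      refine ⟨C + C', by positivity, fun y hy g hg hpos hy0 => ?_⟩
      have hx0 := hnn x₀ hx₀ g hpos
      rcases hy with hy | hy
      · obtain ⟨h1, h2⟩ := h y hy g hg hpos hy0
        exact ⟨by nlinarith, by nlinarith⟩
      · obtain ⟨h1, h2⟩ := h' y hy g hg hpos hy0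
        exact ⟨by nlinarith, by nlinarith⟩
    · intro x hx
      obtain ⟨R, hR, h⟩ := hball x hx
      obtain ⟨C, hC, h'⟩ := hpair x hx
      refine ⟨_, mem_nhdsWithin_of_mem_nhds (ball_mem_nhds x hR), 4 * C, by positivity,
        fun y hy g hg hpos _ => ?_⟩
      obtain ⟨h1, h2⟩ := h y hy g hg hpos
      obtain ⟨h3, h4⟩ := h' g hg hpos
      exact ⟨by nlinarith, by nlinarith⟩
  obtain ⟨C, hC, h⟩ := huni
  refine ⟨(C * C)⁻¹, by positivity, fun g hg hpos x hx y hy => ?_⟩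
  have h1 := (h x hx g hg hpos).2
  have h2 := (h y hy g hg hpos).1
  rw [inv_mul_le_iff₀ (by positivity)]
  nlinarith

theorem HarmonicAt.comp_analyticAt {g : ℂ → ℝ} {f : ℂ → ℂ} {z : ℂ} (hg : HarmonicAt g (f z))
    (hf : AnalyticAt ℂ f z) : HarmonicAt (fun w => g (f w)) z := by
  obtain ⟨ε, hε, hball⟩ := Metric.isOpen_iff.1 (isOpen_setOfPred_harmonicAt (f := g)) _ hg
  obtain ⟨F, hF, hre⟩ := HarmonicOnNhd.exists_analyticOnNhd_ball_re_eq (f := g) (z := f z) (R := ε)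
    fun y hy => hball hy
  have h1 : (fun w => (F (f w)).re) =ᶠ[𝓝 z] fun w => g (f w) := by
    filter_upwards [hf.continuousAt.preimage_mem_nhds (ball_mem_nhds _ hε)] with w hw
    exact hre hw
  rw [← harmonicAt_congr_nhds h1]
  exact ((hF _ (mem_ball_self hε)).comp hf).harmonicAt_re

/-- The properties of the Green function of `V` with pole `s`, extended by zero, that are used
below. -/
structure IsGreen (V : Set ℂ) (s : ℂ) (g : ℂ → ℝ) : Prop where
  nonneg : ∀ z, 0 ≤ g z
  eq_zero : ∀ z, z ∉ V → g z = 0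
  cont : ContinuousOn g {s}ᶜ
  harm : HarmonicOnNhd g (V \ {s})

/-- Two tangent discs joined by a small disc at the point of tangency. -/
def gateSet (r : ℝ) : Set ℂ := ball (-1) 1 ∪ ball 0 r ∪ ball 1 1

theorem mem_ball_re_iff {σ : ℝ} (hσ : σ ^ 2 = 1) {z : ℂ} :
    z ∈ ball (σ : ℂ) 1 ↔ ‖z‖ ^ 2 < 2 * (σ * z.re) := by
  have h : ‖z - σ‖ ^ 2 = ‖z‖ ^ 2 - 2 * (σ * z.re) + 1 := by
    rw [← Complex.normSq_eq_norm_sq, ← Complex.normSq_eq_norm_sq, Complex.normSq_apply,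
      Complex.normSq_apply]
    simp
    linear_combination hσ
  rw [mem_ball, dist_eq_norm, ← sq_lt_one_iff₀ (norm_nonneg _), h]
  constructor <;> intro h <;> linarith

theorem norm_sub_ofReal_sq {σ : ℝ} (hσ : σ ^ 2 = 1) (z : ℂ) :
    ‖z - σ‖ ^ 2 = ‖z‖ ^ 2 - 2 * (σ * z.re) + 1 := by
  rw [← Complex.normSq_eq_norm_sq, ← Complex.normSq_eq_norm_sq, Complex.normSq_apply,
    Complex.normSq_apply]
  simp
  linear_combination hσ

theorem mem_ball_one_one_iff {z : ℂ} : z ∈ ball (1 : ℂ) 1 ↔ ‖z‖ ^ 2 < 2 * z.re := by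
  simpa using mem_ball_re_iff (σ := 1) (by norm_num) (z := z)

theorem mem_ball_neg_one_one_iff {z : ℂ} : z ∈ ball (-1 : ℂ) 1 ↔ ‖z‖ ^ 2 < -(2 * z.re) := by
  simpa using mem_ball_re_iff (σ := -1) (by norm_num) (z := z)

/-- Comparison of a positive harmonic function on a disc at two points with equal real part, when
its boundary values live far from both points. -/
theorem le_of_chord {g : ℂ → ℝ} {σ r l : ℝ} (hσ : σ ^ 2 = 1) (hr : 0 < r) (h1 : 2 * r ≤ l)
    (h2 : l ≤ 1 / 2) (hg : HarmonicContOnCl g (ball (σ : ℂ) 1)) (hpos : ∀ z, 0 ≤ g z)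
    (hsupp : ∀ ζ ∈ sphere (σ : ℂ) 1, g ζ ≠ 0 → ‖ζ‖ < r ∨ 5 / 4 ≤ ‖ζ‖) {z y : ℂ}
    (hz : z ∈ ball (σ : ℂ) 1) (hzr : σ * z.re = l) (hyr : σ * y.re = l)
    (hyi : |y.im| ≤ |y.re| / 10) : g z ≤ 64 * ((1 - ‖z - σ‖ ^ 2) / l) * g y := by
  have hl : 0 < l := by linarith
  have hz2 := (mem_ball_re_iff hσ).1 hz
  rw [hzr] at hz2
  have hyre : y.re ^ 2 = l ^ 2 := by rw [← hyr, mul_pow, hσ, one_mul]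
  have hyre' : |y.re| = l := by
    rw [← abs_of_pos hl]
    exact (sq_eq_sq_iff_abs_eq_abs _ _).1 hyre
  have hyim : y.im ^ 2 ≤ (l / 10) ^ 2 := by
    rw [← sq_abs y.im]
    rw [hyre'] at hyi
    gcongr
  have hyn : ‖y‖ ^ 2 = y.re ^ 2 + y.im ^ 2 := by
    rw [← Complex.normSq_eq_norm_sq, Complex.normSq_apply]; ring
  have hyn2 : ‖y‖ ^ 2 ≤ (1.01 * l) ^ 2 := by rw [hyn]; nlinarith
  have hyn1 : ‖y‖ ≤ 1.01 * l := abs_le_of_sq_le_sq' hyn2 (by positivity) |>.2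
  have hyb : y ∈ ball (σ : ℂ) 1 := (mem_ball_re_iff hσ).2 (by rw [hyr]; nlinarith)
  have hzl : l ≤ ‖z‖ := by
    have : |z.re| = l := by
      rw [← abs_of_pos hl]
      apply (sq_eq_sq_iff_abs_eq_abs _ _).1
      rw [← hzr, mul_pow, hσ, one_mul]
    rw [← this]
    exact Complex.abs_re_le_norm z
  have hz1 : ‖z‖ < 1 := by
    have : ‖z‖ ^ 2 < 1 := by linarith
    exact (sq_lt_one_iff₀ (norm_nonneg _)).1 this
  have hdz : 1 - ‖z - σ‖ ^ 2 = 2 * l - ‖z‖ ^ 2 := by rw [norm_sub_ofReal_sq hσ, hzr]; ring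
  have hdy : 1 - ‖y - σ‖ ^ 2 = 2 * l - ‖y‖ ^ 2 := by rw [norm_sub_ofReal_sq hσ, hyr]; ring
  refine le_mul_of_poissonKernel_le hg (fun ζ _ => hpos ζ) hz hyb fun ζ hζ h0 => ?_
  have hζ1 : ‖ζ - σ‖ = 1 := by rwa [mem_sphere, dist_eq_norm] at hζ
  have hzζ : 0 < ‖ζ - z‖ := norm_pos_iff.2 (sub_ne_zero.2 fun h => by
    rw [h] at hζ; exact (mem_ball.1 hz).ne hζ)
  have hyζ : 0 < ‖ζ - y‖ := norm_pos_iff.2 (sub_ne_zero.2 fun h => by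
    rw [h] at hζ; exact (mem_ball.1 hyb).ne hζ)
  have hratio : ‖ζ - y‖ ≤ 8 * ‖ζ - z‖ := by
    have hy' := norm_sub_le ζ y
    have hz' := norm_sub_norm_le ζ z
    have hz'' := norm_sub_norm_le z ζ
    rw [norm_sub_rev] at hz''
    rcases hsupp ζ hζ h0 with h | h
    · linarith
    · linarith
  have hratio2 : ‖ζ - y‖ ^ 2 ≤ 64 * ‖ζ - z‖ ^ 2 := by
    calc ‖ζ - y‖ ^ 2 ≤ (8 * ‖ζ - z‖) ^ 2 := by gcongr
      _ = _ := by ring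
  rw [poissonKernel_def, poissonKernel_def, sub_sub_sub_cancel_right, sub_sub_sub_cancel_right,
    hζ1, one_pow, hdz, hdy, div_le_iff₀ (by positivity)]
  have e : 64 * ((2 * l - ‖z‖ ^ 2) / l) * ((2 * l - ‖y‖ ^ 2) / ‖ζ - y‖ ^ 2) * ‖ζ - z‖ ^ 2 =
      (2 * l - ‖z‖ ^ 2) * ((2 * l - ‖y‖ ^ 2) / l) * (64 * ‖ζ - z‖ ^ 2 / ‖ζ - y‖ ^ 2) := by
    field_simp
  rw [e]
  have e1 : 1 ≤ (2 * l - ‖y‖ ^ 2) / l := by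
    rw [le_div_iff₀ hl]
    nlinarith
  have e2 : 1 ≤ 64 * ‖ζ - z‖ ^ 2 / ‖ζ - y‖ ^ 2 := by
    rw [le_div_iff₀ (by positivity)]
    linarith
  have e0 : 0 ≤ 2 * l - ‖z‖ ^ 2 := by linarith
  have := mul_le_mul e1 e2 zero_le_one (by linarith)
  nlinarith [mul_le_mul_of_nonneg_left this e0]

/-- A gate: `V` is the union of a left part, a right part, and a pair of discs joined through a
small opening at the origin. -/
structure IsGate (V L R : Set ℂ) (r : ℝ) : Prop where
  pos : 0 < r
  le : r ≤ 1 / 8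
  openV : IsOpen V
  openL : IsOpen L
  openR : IsOpen R
  subV : gateSet r ⊆ V
  Vsub : V ⊆ L ∪ gateSet r ∪ R
  disj : Disjoint L R
  disjL : Disjoint L (ball 1 1)
  disjR : Disjoint R (ball (-1) 1)
  normL : ∀ z ∈ L, 5 / 4 ≤ ‖z‖
  normR : ∀ z ∈ R, 5 / 4 ≤ ‖z‖

/-- The part of `V` to the left of the chord `Re z = l` of the gate. -/
def leftPart (V L : Set ℂ) (r l : ℝ) : Set ℂ := V ∩ (L ∪ {z ∈ gateSet r | z.re < l})

theorem isOpen_gateSet (r : ℝ) : IsOpen (gateSet r) :=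
  (isOpen_ball.union isOpen_ball).union isOpen_ball

theorem norm_lt_of_mem_gateSet {r : ℝ} (hr : r ≤ 1 / 8) {z : ℂ} (hz : z ∈ gateSet r) :
    ‖z‖ < 2 := by
  rcases hz with (h | h) | h
  · rw [mem_ball, dist_eq_norm] at h
    have := norm_sub_le (z - -1) 1
    simp only [sub_neg_eq_add, add_sub_cancel_right, norm_one] at this h
    linarith
  · rw [mem_ball, dist_zero_right] at h
    linarith
  · rw [mem_ball, dist_eq_norm] at h
    have := norm_add_le (z - 1) 1
    simp only [sub_add_cancel, norm_one] at this
    linarith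

section
variable {V L R : Set ℂ} {r l : ℝ} (H : IsGate V L R r)
include H

theorem IsGate.isOpen_leftPart : IsOpen (leftPart V L r l) :=
  H.openV.inter (H.openL.union ((isOpen_gateSet r).inter (Complex.continuous_re.isOpen_preimage _
    isOpen_Iio)))

theorem IsGate.mem_chord_of_mem_frontier (hl : |l| ≤ 1 / 2) {z : ℂ}
    (hz : z ∈ frontier (leftPart V L r l)) (hzV : z ∈ V) : z ∈ gateSet r ∧ z.re = l := by
  have hl' := abs_le.1 hl
  rw [H.isOpen_leftPart.frontier_eq] at hz
  obtain ⟨hzc, hzn⟩ := hz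
  have hcl : ∀ O : Set ℂ, IsOpen O → z ∈ O → ∃ w ∈ O, w ∈ L ∪ {z ∈ gateSet r | z.re < l} :=
    fun O hO hzO => by
      obtain ⟨w, hw1, hw2⟩ := mem_closure_iff.1 hzc O hO hzO
      exact ⟨w, hw1, hw2.2⟩
  have hzR : z ∉ R := fun hzR => by
    obtain ⟨w, hwR, hw⟩ := hcl R H.openR hzR
    rcases hw with hwL | ⟨hwP, hwl⟩
    · exact disjoint_left.1 H.disj hwL hwR
    · rcases hwP with (h | h) | h
      · exact disjoint_left.1 H.disjR hwR h
      · rw [mem_ball, dist_zero_right] at h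
        linarith [H.normR w hwR, H.le]
      · have h1 := mem_ball_one_one_iff.1 h
        nlinarith [H.normR w hwR]
  have hzL : z ∉ L := fun h => hzn ⟨hzV, Or.inl h⟩
  have hzP : z ∈ gateSet r := by
    rcases H.Vsub hzV with (h | h) | h
    · exact absurd h hzL
    · exact h
    · exact absurd h hzR
  have hle : l ≤ z.re := by
    by_contra! h
    exact hzn ⟨hzV, Or.inr ⟨hzP, h⟩⟩
  refine ⟨hzP, le_antisymm ?_ hle⟩
  by_contra! hlt
  have hO : IsOpen {w : ℂ | l < w.re} := Complex.continuous_re.isOpen_preimage _ isOpen_Ioi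
  rcases hzP with (h | h) | h
  · obtain ⟨w, ⟨hw1, hw2⟩, hw⟩ := hcl _ (isOpen_ball.inter hO) ⟨h, hlt⟩
    rcases hw with hwL | hw
    · have h1 := mem_ball_neg_one_one_iff.1 hw1
      have h2 : l < w.re := hw2
      nlinarith [H.normL w hwL]
    · exact lt_asymm hw.2 hw2
  · obtain ⟨w, ⟨hw1, hw2⟩, hw⟩ := hcl _ (isOpen_ball.inter hO) ⟨h, hlt⟩
    rcases hw with hwL | hw
    · rw [mem_ball, dist_zero_right] at hw1
      linarith [H.normL w hwL, H.le]
    · exact lt_asymm hw.2 hw2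
  · obtain ⟨w, ⟨hw1, hw2⟩, hw⟩ := hcl _ (isOpen_ball.inter hO) ⟨h, hlt⟩
    rcases hw with hwL | hw
    · exact disjoint_left.1 H.disjL hwL hw1
    · exact lt_asymm hw.2 hw2

theorem IsGate.isBounded_leftPart {R₀ : ℝ} (hR₀ : ∀ z ∈ L, ‖z‖ < R₀) :
    Bornology.IsBounded (leftPart V L r l) := by
  refine isBounded_iff_forall_norm_le.2 ⟨max R₀ 2, fun z hz => ?_⟩
  rcases hz.2 with h | h
  · exact (hR₀ z h).le.trans (le_max_left _ _)
  · exact (norm_lt_of_mem_gateSet H.le h.1).le.trans (le_max_right _ _)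

theorem IsGate.notMem_closure_leftPart {s : ℂ} (hsR : s ∈ R) (hs : 5 ≤ ‖s‖) :
    s ∉ closure (leftPart V L r l) := by
  intro h
  obtain ⟨w, ⟨hw1, hw2⟩, hw⟩ := mem_closure_iff.1 h _
    (H.openR.inter (continuous_norm.isOpen_preimage _ (isOpen_Ioi (a := (2 : ℝ)))))
    ⟨hsR, by rw [mem_preimage, mem_Ioi]; linarith⟩
  rcases hw.2 with h | h
  · exact disjoint_left.1 H.disj h hw1
  · exact lt_asymm (norm_lt_of_mem_gateSet H.le h.1) hw2

end

section
variable {V L R : Set ℂ} {r l : ℝ} (H : IsGate V L R r)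
include H

theorem IsGate.notMem_gateSet_of_sphere {σ : ℝ} (hσ : σ ^ 2 = 1) {ζ : ℂ}
    (hζ : ζ ∈ sphere (σ : ℂ) 1) (hV : ζ ∈ V) : ‖ζ‖ < r ∨ 5 / 4 ≤ ‖ζ‖ := by
  have h1 : ‖ζ‖ ^ 2 = 2 * (σ * ζ.re) := by
    have := norm_sub_ofReal_sq hσ ζ
    rw [mem_sphere, dist_eq_norm] at hζ
    rw [hζ] at this
    linarith
  have h0 := sq_nonneg ‖ζ‖
  rcases H.Vsub hV with (h | h) | h
  · exact Or.inr (H.normL ζ h)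
  · left
    have hσ' : σ = 1 ∨ σ = -1 := sq_eq_one_iff.1 hσ
    rcases h with (h | h) | h
    · have := mem_ball_neg_one_one_iff.1 h
      rcases hσ' with rfl | rfl <;> linarith
    · rwa [mem_ball, dist_zero_right] at h
    · have := mem_ball_one_one_iff.1 h
      rcases hσ' with rfl | rfl <;> linarith
  · exact Or.inr (H.normR ζ h)

theorem IsGate.le_chord {s : ℂ} {g : ℂ → ℝ} (hg : IsGreen V s g) (hs : 5 ≤ ‖s‖) {σ : ℝ}
    (hσ : σ = 1 ∨ σ = -1) (h1 : 2 * r ≤ l) (h2 : l ≤ 1 / 2) {z y : ℂ} (hz : z ∈ gateSet r)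
    (hzr : σ * z.re = l) (hyr : σ * y.re = l) (hyi : |y.im| ≤ |y.re| / 10) :
    g z ≤ 64 * ((1 - ‖z - σ‖ ^ 2) / l) * g y := by
  have hr := H.pos
  have hσ2 : σ ^ 2 = 1 := by rcases hσ with rfl | rfl <;> norm_num
  have hσn : ‖(σ : ℂ)‖ = 1 := by rcases hσ with rfl | rfl <;> simp
  have hball : ball (σ : ℂ) 1 ⊆ V := by
    refine Subset.trans ?_ H.subV
    rcases hσ with rfl | rfl
    · simp [gateSet]
    · simp [gateSet, union_assoc]
  have hzb : z ∈ ball (σ : ℂ) 1 := by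
    rcases hz with (h | h) | h
    · have := mem_ball_neg_one_one_iff.1 h
      rcases hσ with rfl | rfl
      · nlinarith [sq_nonneg ‖z‖]
      · simpa using h
    · rw [mem_ball, dist_zero_right] at h
      have := abs_le.1 ((Complex.abs_re_le_norm z).trans h.le)
      rcases hσ with rfl | rfl <;> linarith
    · have := mem_ball_one_one_iff.1 h
      rcases hσ with rfl | rfl
      · simpa using h
      · nlinarith [sq_nonneg ‖z‖]
  have hsc : s ∉ closedBall (σ : ℂ) 1 := fun h => by
    rw [mem_closedBall, dist_eq_norm] at h
    linarith [norm_sub_norm_le s σ]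
  refine le_of_chord hσ2 hr h1 h2 ⟨hg.harm.mono fun w hw => ⟨hball hw, fun h => ?_⟩, ?_⟩ hg.nonneg
    (fun ζ hζ h0 => H.notMem_gateSet_of_sphere hσ2 hζ
      (by by_contra h; exact h0 (hg.eq_zero ζ h))) hzb hzr hyr hyi
  · rw [mem_singleton_iff] at h
    exact hsc (h ▸ ball_subset_closedBall hw)
  · rw [closure_ball _ one_ne_zero]
    exact hg.cont.mono fun w hw h => hsc (by rw [mem_singleton_iff] at h; exact h ▸ hw)

theorem IsGate.le_chord' {s : ℂ} {g : ℂ → ℝ} (hg : IsGreen V s g) (hs : 5 ≤ ‖s‖)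
    (h1 : 2 * r ≤ |l|) (h2 : |l| ≤ 1 / 2) {z y : ℂ} (hz : z ∈ gateSet r)
    (hzr : z.re = l) (hyr : y.re = l) (hyi : |y.im| ≤ |y.re| / 10) :
    g z ≤ 128 * g y := by
  have hr := H.pos
  obtain ⟨σ, hσ, hσl⟩ : ∃ σ : ℝ, (σ = 1 ∨ σ = -1) ∧ σ * l = |l| := by
    rcases abs_cases l with h | h
    · exact ⟨1, Or.inl rfl, by linarith [h.1]⟩
    · exact ⟨-1, Or.inr rfl, by linarith [h.1]⟩
  have hσ2 : σ ^ 2 = 1 := by rcases hσ with rfl | rfl <;> norm_num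
  have h3 := H.le_chord hg hs hσ h1 h2 hz (hzr ▸ hσl) (hyr ▸ hσl) hyi
  refine h3.trans (mul_le_mul_of_nonneg_right ?_ (hg.nonneg y))
  have : (1 - ‖z - σ‖ ^ 2) / |l| ≤ 2 := by
    rw [div_le_iff₀ (by linarith), norm_sub_ofReal_sq hσ2, hzr, hσl]
    nlinarith [sq_nonneg ‖z‖]
  linarith

theorem IsGate.le_of_le_chord {f : ℂ → ℝ} {R₀ : ℝ}
    (hR₀ : ∀ z ∈ L, ‖z‖ < R₀) (hl : |l| ≤ 1 / 2)
    (hfc : ContinuousOn f (closure (leftPart V L r l)))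
    (hfh : HarmonicOnNhd f (leftPart V L r l)) {M : ℝ}
    (hM : ∀ z ∈ closure (leftPart V L r l), z ∉ V → f z ≤ M)
    (hc : ∀ z ∈ gateSet r, z.re = l → f z ≤ M) :
    ∀ z ∈ leftPart V L r l, f z ≤ M := fun z hz => by
  refine le_of_harmonicOnNhd_of_frontier_le H.isOpen_leftPart (H.isBounded_leftPart hR₀) hfh hfc
    (fun w hw => ?_) hz
  by_cases hV : w ∈ V
  · obtain ⟨h1, h2⟩ := H.mem_chord_of_mem_frontier hl hw hV
    exact hc w h1 h2
  · exact hM w (frontier_subset_closure hw) hV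

theorem IsGreen.continuousOn_leftPart {s : ℂ} {g : ℂ → ℝ} (hg : IsGreen V s g) (hsR : s ∈ R)
    (hs : 5 ≤ ‖s‖) : ContinuousOn g (closure (leftPart V L r l)) :=
  hg.cont.mono fun w hw h => H.notMem_closure_leftPart hsR hs (by
    rw [mem_singleton_iff] at h; exact h ▸ hw)

theorem IsGreen.harmonicOnNhd_leftPart {s : ℂ} {g : ℂ → ℝ} (hg : IsGreen V s g) (hsR : s ∈ R)
    (hs : 5 ≤ ‖s‖) : HarmonicOnNhd g (leftPart V L r l) :=
  hg.harm.mono fun w hw => ⟨hw.1, fun h => H.notMem_closure_leftPart (l := l) hsR hs (by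
    rw [mem_singleton_iff] at h; exact h ▸ subset_closure hw)⟩

theorem IsGate.le_of_mem_leftPart {s : ℂ} {g : ℂ → ℝ} (hg : IsGreen V s g) (hsR : s ∈ R)
    (hs : 5 ≤ ‖s‖) {R₀ : ℝ} (hR₀ : ∀ z ∈ L, ‖z‖ < R₀) (h1 : 2 * r ≤ |l|) (h2 : |l| ≤ 1 / 2)
    {y : ℂ} (hyr : y.re = l) (hyi : |y.im| ≤ |y.re| / 10) {z : ℂ}
    (hz : z ∈ leftPart V L r l) : g z ≤ 128 * g y :=
  H.le_of_le_chord hR₀ h2 (hg.continuousOn_leftPart H hsR hs)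
    (hg.harmonicOnNhd_leftPart H hsR hs)
    (fun w _ hw => by rw [hg.eq_zero w hw]; linarith [hg.nonneg y])
    (fun w hw hwl => H.le_chord' hg hs h1 h2 hw hwl hyr hyi) z hz

omit H in
theorem gateSet_mem_of_re {z : ℂ} (h0 : z.re ≠ 0) (h : |z.re| ≤ 1 / 2)
    (hi : |z.im| ≤ |z.re| / 10) : z ∈ gateSet r := by
  have hn : ‖z‖ ^ 2 = z.re ^ 2 + z.im ^ 2 := by
    rw [← Complex.normSq_eq_norm_sq, Complex.normSq_apply]; ring
  have h1 : z.im ^ 2 ≤ z.re ^ 2 / 100 := by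
    rw [← sq_abs z.im, ← sq_abs z.re]
    calc |z.im| ^ 2 ≤ (|z.re| / 10) ^ 2 := by gcongr
      _ = _ := by ring
  rcases lt_or_gt_of_ne h0 with h2 | h2
  · rw [abs_of_neg h2] at h
    exact Or.inl (Or.inl (mem_ball_neg_one_one_iff.2 (by nlinarith)))
  · rw [abs_of_pos h2] at h
    exact Or.inr (mem_ball_one_one_iff.2 (by nlinarith))

/-- The Green function loses a large factor when passing through a small gate. -/
theorem IsGate.gain {s : ℂ} {g : ℂ → ℝ} (hg : IsGreen V s g) (hsR : s ∈ R)
    (hs : 5 ≤ ‖s‖) {R₀ : ℝ} (hR2 : 2 ≤ R₀) (hR₀ : ∀ z ∈ L, ‖z‖ < R₀) {x y : ℂ}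
    (hx : x.re ∈ Icc (-0.42 : ℝ) (-0.38)) (hxi : |x.im| ≤ |x.re| / 10)
    (hy : y.re ∈ Icc (0.38 : ℝ) 0.42) (hyi : |y.im| ≤ |y.re| / 10) :
    g x * Real.log (R₀ ^ 2 / (4 * r)) ≤ 128 * Real.log (7 * R₀ ^ 2) * g y := by
  have hr := H.pos
  have hr8 := H.le
  have hR0 : 0 < R₀ := by linarith
  set M := 128 * g y with hM
  have hM0 : 0 ≤ M := by have := hg.nonneg y; positivity
  set K := Real.log (R₀ ^ 2 / (4 * r)) with hK
  have hK0 : 0 < K := Real.log_pos (by rw [lt_div_iff₀ (by positivity)]; nlinarith)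
  have hy0 : |y.re| = y.re := abs_of_pos (by linarith [hy.1])
  have hxneg : x.re < 0 := by linarith [hx.2]
  set D := leftPart V L r (-(2 * r)) with hD
  have hDre : ∀ z ∈ closure D, 2 * r ≤ ‖z‖ := by
    have hcl : IsClosed {z : ℂ | 2 * r ≤ ‖z‖} := isClosed_le continuous_const continuous_norm
    refine fun z hz => closure_minimal (fun w hw => ?_) hcl hz
    rcases hw.2 with h | h
    · exact (by linarith : 2 * r ≤ 5 / 4).trans (H.normL w h)
    · have h1 : w.re < -(2 * r) := h.2
      have h2 := (neg_le_abs w.re).trans (Complex.abs_re_le_norm w)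
      show 2 * r ≤ ‖w‖
      linarith
  have hDR : ∀ z ∈ closure D, ‖z‖ ≤ R₀ := by
    have hcl : IsClosed {z : ℂ | ‖z‖ ≤ R₀} := isClosed_le continuous_norm continuous_const
    refine fun z hz => closure_minimal (fun w hw => ?_) hcl hz
    rcases hw.2 with h | h
    · exact (hR₀ w h).le
    · exact (norm_lt_of_mem_gateSet hr8 h.1).le.trans hR2
  have hsub : ∀ z ∈ gateSet r, z.re < y.re → z ∈ leftPart V L r y.re := fun z hz h =>
    ⟨H.subV hz, Or.inr ⟨hz, h⟩⟩
  have hgM : ∀ z ∈ gateSet r, z.re < y.re → g z ≤ M := fun z hz h =>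
    H.le_of_mem_leftPart hg hsR hs hR₀ (by rw [hy0]; linarith [hy.1])
      (by rw [hy0]; linarith [hy.2]) rfl hyi (hsub z hz h)
  have hxD : x ∈ D := by
    have hxP : x ∈ gateSet r := gateSet_mem_of_re hxneg.ne
      (by rw [abs_of_neg hxneg]; linarith [hx.1]) hxi
    exact ⟨H.subV hxP, Or.inr ⟨hxP, by linarith [hx.2]⟩⟩
  have key := H.le_of_le_chord (l := -(2 * r)) (f := fun z => K * g z + 2 * M * Real.log ‖z‖)
    (M := 2 * M * Real.log R₀) hR₀ (by rw [abs_neg, abs_of_pos (by linarith)]; linarith)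
    ?_ ?_ ?_ ?_ x hxD
  · have hxn : R₀ ^ 2 / ‖x‖ ^ 2 ≤ 7 * R₀ ^ 2 := by
      have h1 : 0.38 ≤ ‖x‖ := by
        have := (neg_le_abs x.re).trans (Complex.abs_re_le_norm x)
        linarith [hx.2]
      have h2 : (0.38 : ℝ) ^ 2 ≤ ‖x‖ ^ 2 := by gcongr
      rw [div_le_iff₀ (by linarith)]
      nlinarith [sq_nonneg R₀]
    have hxp : 0 < ‖x‖ := norm_pos_iff.2 fun h => by rw [h] at hxneg; simp at hxneg
    have h3 := Real.log_le_log (by positivity) hxn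
    rw [Real.log_div (by positivity) (by positivity), Real.log_pow, Real.log_pow] at h3
    push_cast at h3
    have := mul_le_mul_of_nonneg_left h3 hM0
    rw [hM] at this key
    linarith
  · refine (continuousOn_const.mul (hg.continuousOn_leftPart H hsR hs)).add
      (continuousOn_const.mul (ContinuousOn.log continuous_norm.continuousOn fun z hz => ?_))
    have := hDre z hz
    exact (lt_of_lt_of_le (by linarith) this).ne'
  · refine HarmonicOnNhd.add ((hg.harmonicOnNhd_leftPart H hsR hs).const_smul (c := K))
      (HarmonicOnNhd.const_smul (c := 2 * M) fun z hz => ?_)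
    exact AnalyticAt.harmonicAt_log_norm analyticAt_id fun h => by
      have := hDre z (subset_closure hz)
      rw [show z = 0 from h, norm_zero] at this
      linarith
  · intro z hz hzV
    have h1 : Real.log ‖z‖ ≤ Real.log R₀ := Real.log_le_log
      (lt_of_lt_of_le (by linarith) (hDre z hz)) (hDR z hz)
    simp only [hg.eq_zero z hzV, mul_zero, zero_add]
    exact mul_le_mul_of_nonneg_left h1 (by positivity)
  · intro z hz hzl
    have h1 : ‖z‖ ^ 2 ≤ 4 * r := by
      rcases hz with (h | h) | h
      · have := mem_ball_neg_one_one_iff.1 h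
        linarith
      · rw [mem_ball, dist_zero_right] at h
        nlinarith [norm_nonneg z]
      · have := mem_ball_one_one_iff.1 h
        nlinarith [sq_nonneg ‖z‖]
    have hz0 : 0 < ‖z‖ := norm_pos_iff.2 fun h => by rw [h] at hzl; simp at hzl; linarith
    have h2 := Real.log_le_log (by positivity) h1
    rw [Real.log_pow] at h2
    push_cast at h2
    have h3 : K = 2 * Real.log R₀ - Real.log (4 * r) := by
      rw [hK, Real.log_div (by positivity) (by positivity), Real.log_pow]
      push_cast; ring
    have h4 : g z ≤ M := hgM z hz (by linarith [hy.1])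
    have h5 : K * g z ≤ K * M := mul_le_mul_of_nonneg_left h4 hK0.le
    have h6 : M * (2 * Real.log ‖z‖) ≤ M * Real.log (4 * r) := mul_le_mul_of_nonneg_left h2 hM0
    nlinarith

end

/-- The tube used to compare values of a positive harmonic function through a gate. -/
theorem exists_harnack_tube : ∃ h : ℝ, 0 < h ∧ ∀ (r : ℝ) (g : ℂ → ℝ), 0 < r → r ≤ 1 / 8 →
    HarmonicOnNhd g (gateSet r) → (∀ z, 0 ≤ g z) → ∀ x y : ℂ, |x.re| ≤ 2 * r →
    |x.im| ≤ |x.re| / 10 → |y.re| ≤ 2 * r → |y.im| ≤ |y.re| / 10 → h * g x ≤ g y := by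
  set O : Set ℂ := ball ((-3 : ℝ) : ℂ) 3 ∪ ball 0 1 ∪ ball ((3 : ℝ) : ℂ) 3 with hO
  set K : Set ℂ := {z : ℂ | |z.re| ≤ 2 ∧ |z.im| ≤ |z.re| / 10} with hK
  have hKO : K ⊆ O := by
    rintro z ⟨h1, h2⟩
    have h3 : z.im ^ 2 ≤ z.re ^ 2 / 100 := by
      rw [← sq_abs z.im, ← sq_abs z.re]
      calc |z.im| ^ 2 ≤ (|z.re| / 10) ^ 2 := by gcongr
        _ = _ := by ring
    have hb : ∀ a : ℝ, ‖z - (a : ℂ)‖ ^ 2 = (z.re - a) ^ 2 + z.im ^ 2 := fun a => by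
      rw [← Complex.normSq_eq_norm_sq, Complex.normSq_apply]; simp; ring
    rcases lt_trichotomy z.re 0 with h | h | h
    · left; left
      rw [abs_of_neg h] at h1
      rw [mem_ball, dist_eq_norm, ← sq_lt_sq₀ (norm_nonneg _) (by norm_num), hb]
      nlinarith
    · left; right
      rw [h] at h3
      have : z = 0 := Complex.ext h (by simp; nlinarith [sq_nonneg z.im])
      simp [this]
    · right
      rw [abs_of_pos h] at h1
      rw [mem_ball, dist_eq_norm, ← sq_lt_sq₀ (norm_nonneg _) (by norm_num), hb]
      nlinarith
  have hKcl : IsClosed K := (isClosed_le (continuous_abs.comp Complex.continuous_re)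
    continuous_const).inter (isClosed_le (continuous_abs.comp Complex.continuous_im)
      ((continuous_abs.comp Complex.continuous_re).div_const 10))
  have hKb : Bornology.IsBounded K := isBounded_iff_forall_norm_le.2 ⟨3, fun z hz => by
    have := Complex.norm_le_abs_re_add_abs_im z
    linarith [hz.1, hz.2]⟩
  have hKstar : StarConvex ℝ (0 : ℂ) K := by
    rw [starConvex_zero_iff]
    intro z hz a ha0 ha1
    simp only [hK, Set.mem_ofPred_eq, Complex.smul_re, Complex.smul_im, smul_eq_mul, abs_mul,
      abs_of_nonneg ha0] at hz ⊢
    exact ⟨by nlinarith [abs_nonneg z.re, hz.1], by nlinarith [hz.2]⟩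
  have hKconn : IsPreconnected K :=
    (hKstar.isPathConnected (by simp [hK])).isConnected.isPreconnected
  obtain ⟨h, hh, hprop⟩ := exists_harnack_const ((isOpen_ball.union isOpen_ball).union isOpen_ball)
    (isCompact_of_isClosed_isBounded hKcl hKb) hKconn hKO
  refine ⟨h, hh, fun r g hr hr8 hg hpos x y hx hxi hy hyi => ?_⟩
  have hr' : (r : ℂ) ≠ 0 := Complex.ofReal_ne_zero.2 hr.ne'
  have hmap : ∀ w ∈ O, (r : ℂ) * w ∈ gateSet r := fun w hw => by
    have hn : ‖(r : ℂ) * w‖ ^ 2 = r * (r * ‖w‖ ^ 2) := by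
      rw [norm_mul, Complex.norm_real, Real.norm_of_nonneg hr.le]; ring
    have hre : ((r : ℂ) * w).re = r * w.re := by simp
    have hsq : ∀ a : ℝ, ‖w - (a : ℂ)‖ ^ 2 = ‖w‖ ^ 2 - 2 * a * w.re + a ^ 2 := fun a => by
      rw [← Complex.normSq_eq_norm_sq, ← Complex.normSq_eq_norm_sq, Complex.normSq_apply,
        Complex.normSq_apply]; simp; ring
    rcases hw with (hw | hw) | hw
    · rw [mem_ball, dist_eq_norm, ← sq_lt_sq₀ (norm_nonneg _) (by norm_num), hsq] at hw
      refine Or.inl (Or.inl (mem_ball_neg_one_one_iff.2 ?_))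
      rw [hn, hre]
      nlinarith [mul_le_mul_of_nonneg_right hr8 (sq_nonneg ‖w‖), sq_nonneg ‖w‖]
    · rw [mem_ball, dist_zero_right] at hw
      refine Or.inl (Or.inr ?_)
      rw [mem_ball, dist_zero_right, norm_mul, Complex.norm_real, Real.norm_of_nonneg hr.le]
      nlinarith
    · rw [mem_ball, dist_eq_norm, ← sq_lt_sq₀ (norm_nonneg _) (by norm_num), hsq] at hw
      refine Or.inr (mem_ball_one_one_iff.2 ?_)
      rw [hn, hre]
      nlinarith [mul_le_mul_of_nonneg_right hr8 (sq_nonneg ‖w‖), sq_nonneg ‖w‖]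
  have hres := hprop (fun w => g ((r : ℂ) * w))
    (fun w hw => HarmonicAt.comp_analyticAt (hg _ (hmap w hw))
      (analyticAt_const.mul analyticAt_id)) (fun w _ => hpos _)
  have hin : ∀ x : ℂ, |x.re| ≤ 2 * r → |x.im| ≤ |x.re| / 10 → x / r ∈ K := fun x hx hxi => by
    simp only [hK, Set.mem_ofPred_eq, Complex.div_ofReal_re, Complex.div_ofReal_im, abs_div,
      abs_of_pos hr]
    refine ⟨by rw [div_le_iff₀ hr]; exact hx, ?_⟩
    rw [div_right_comm]
    gcongr
  have := hres _ (hin x hx hxi) _ (hin y hy hyi)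
  simpa only [mul_div_cancel₀ _ hr'] using this

theorem exists_gate_const : ∃ c : ℝ, 0 < c ∧ ∀ {V L R : Set ℂ} {r : ℝ}, IsGate V L R r →
    ∀ {s : ℂ} {g : ℂ → ℝ}, IsGreen V s g → s ∈ R → 5 ≤ ‖s‖ → ∀ {R₀ : ℝ}, (∀ z ∈ L, ‖z‖ < R₀) →
    ∀ {x y : ℂ}, x.re ∈ Icc (-0.42 : ℝ) (-0.38) → |x.im| ≤ |x.re| / 10 →
    |y.re| ≤ 0.42 → |y.im| ≤ |y.re| / 10 → x.re ≤ y.re → c * g x ≤ g y := by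
  obtain ⟨h, hh, hprop⟩ := exists_harnack_tube
  refine ⟨min (h / 128) (1 / 128), by positivity, ?_⟩
  intro V L R r H s g hg hsR hs R₀ hR₀ x y hx hxi hy hyi hxy
  have hr := H.pos
  have hr8 := H.le
  have hxneg : x.re < 0 := by linarith [hx.2]
  have hxP : x ∈ gateSet r := gateSet_mem_of_re hxneg.ne
    (by rw [abs_of_neg hxneg]; linarith [hx.1]) hxi
  have main : ∀ z : ℂ, 2 * r ≤ |z.re| → |z.re| ≤ 0.42 → |z.im| ≤ |z.re| / 10 → x.re ≤ z.re →
      g x ≤ 128 * g z := fun z h1 h2 h3 h4 => by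
    rcases h4.lt_or_eq with h5 | h5
    · exact H.le_of_mem_leftPart hg hsR hs hR₀ h1 (h2.trans (by norm_num)) rfl h3
        ⟨H.subV hxP, Or.inr ⟨hxP, h5⟩⟩
    · exact H.le_chord' hg hs h1 (h2.trans (by norm_num)) hxP h5 rfl h3
  have hx0 := hg.nonneg x
  rcases le_total (2 * r) |y.re| with h1 | h1
  · have := main y h1 hy hyi hxy
    have h2 : min (h / 128) (1 / 128) * g x ≤ 1 / 128 * g x :=
      mul_le_mul_of_nonneg_right (min_le_right _ _) hx0
    linarith
  · set z : ℂ := ((-(2 * r) : ℝ) : ℂ) with hz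
    have hzre : |z.re| = 2 * r := by rw [hz, Complex.ofReal_re, abs_neg, abs_of_pos (by linarith)]
    have hzi : |z.im| ≤ |z.re| / 10 := by rw [hz, Complex.ofReal_im, abs_zero]; positivity
    have h2 := main z hzre.ge (by rw [hzre]; linarith) hzi
      (by rw [hz, Complex.ofReal_re]; linarith [hx.2])
    have hsub : HarmonicOnNhd g (gateSet r) := hg.harm.mono fun w hw => ⟨H.subV hw, fun h => by
      have := norm_lt_of_mem_gateSet hr8 hw
      rw [show w = s from h] at this
      linarith⟩
    have h3 := hprop r g hr hr8 hsub hg.nonneg z y hzre.le hzi h1 hyi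
    have h4 : min (h / 128) (1 / 128) * g x ≤ h / 128 * g x :=
      mul_le_mul_of_nonneg_right (min_le_left _ _) hx0
    have h5 := mul_le_mul_of_nonneg_left h2 hh.le
    linarith

theorem IsGreen.comp_affine {V : Set ℂ} {s e ϑ : ℂ} {g : ℂ → ℝ} (hϑ : ϑ ≠ 0)
    (hg : IsGreen V (e + ϑ * s) g) :
    IsGreen {w | e + ϑ * w ∈ V} s (fun w => g (e + ϑ * w)) where
  nonneg z := hg.nonneg _
  eq_zero z hz := hg.eq_zero _ hz
  cont := hg.cont.comp (by fun_prop) fun w hw h => hw (by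
    simpa [hϑ] using h)
  harm w hw := HarmonicAt.comp_analyticAt (hg.harm _ ⟨hw.1, fun h => hw.2 (by
    simpa [hϑ] using h)⟩) (by fun_prop)

theorem one_sub_norm_discMap_sq {a w : ℂ} (ha : ‖a‖ ≤ 1) (hw : ‖w‖ < 1) :
    1 - ‖discMap a w‖ ^ 2 =
      (1 - ‖a‖ ^ 2) * ((1 - ‖w‖ ^ 2) / ‖1 - (starRingEnd ℂ) a * w‖ ^ 2) := by
  have h0 := norm_pos_iff.2 (one_sub_conj_mul_ne_zero ha hw)
  have h1 := normSq_one_sub_conj_mul a w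
  rw [discMap, norm_div, div_pow]
  generalize ‖1 - (starRingEnd ℂ) a * w‖ = D at h0 h1 ⊢
  field_simp
  linarith

section
variable {V : Set ℂ} {ψ : ℂ → ℂ} (hV : IsOpen V) (hVc : IsPreconnected V)
  (hψ : DifferentiableOn ℂ ψ V) (hbij : BijOn ψ V (ball 0 1))
include hV hVc hψ hbij

theorem isCompact_inter_preimage_closedBall {ρ : ℝ} (hρ : ρ < 1) :
    IsCompact (V ∩ ψ ⁻¹' closedBall 0 ρ) := by
  have hinv : LeftInvOn (Function.invFunOn ψ V) ψ V := hbij.injOn.leftInvOn_invFunOn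
  have hd := differentiableOn_of_leftInvOn hV hVc hψ hbij.injOn hinv
  rw [hbij.image_eq] at hd
  have hsub : closedBall (0 : ℂ) ρ ⊆ ball 0 1 := closedBall_subset_ball hρ
  have := (isCompact_closedBall (0 : ℂ) ρ).image_of_continuousOn (hd.continuousOn.mono hsub)
  convert this using 1
  ext z
  constructor
  · rintro ⟨h1, h2⟩
    exact ⟨ψ z, h2, hinv h1⟩
  · rintro ⟨ζ, h1, rfl⟩
    have h2 := hbij.surjOn.rightInvOn_invFunOn (hsub h1)
    have h3 := hbij.surjOn.mapsTo_invFunOn (hsub h1)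
    exact ⟨h3, by rw [mem_preimage, h2]; exact h1⟩

open Classical in
theorem exists_isGreen {s : ℂ} (hs : s ∈ V) : IsGreen V s
    (fun z => if z ∈ V then -Real.log ‖discMap (ψ s) (ψ z)‖ else 0) := by
  have hlt : ∀ z ∈ V, ‖ψ z‖ < 1 := fun z hz => mem_ball_zero_iff.1 (hbij.mapsTo hz)
  have ha := hlt s hs
  have hle : ∀ z ∈ V, ‖discMap (ψ s) (ψ z)‖ < 1 := fun z hz => norm_discMap_lt_one ha (hlt z hz)
  have hne : ∀ z ∈ V, z ≠ s → discMap (ψ s) (ψ z) ≠ 0 := fun z hz h h0 =>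
    h (hbij.injOn hz hs ((discMap_eq_zero_iff ha (hlt z hz)).1 h0))
  have han : ∀ z ∈ V, AnalyticAt ℂ (fun z => discMap (ψ s) (ψ z)) z := fun z hz => by
    have : DifferentiableOn ℂ (fun z => discMap (ψ s) (ψ z)) V := fun w hw =>
      ((hasDerivAt_discMap ha.le (hlt w hw)).differentiableAt.comp w
        (hψ.differentiableAt (hV.mem_nhds hw))).differentiableWithinAt
    exact this.analyticAt (hV.mem_nhds hz)
  have hnn : ∀ z, 0 ≤ if z ∈ V then -Real.log ‖discMap (ψ s) (ψ z)‖ else 0 := fun z => by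
    split_ifs with h
    · exact neg_nonneg.2 (Real.log_nonpos (norm_nonneg _) (hle z h).le)
    · exact le_rfl
  have hharm : HarmonicOnNhd
      (fun z => if z ∈ V then -Real.log ‖discMap (ψ s) (ψ z)‖ else 0) (V \ {s}) := fun z hz => by
    have h1 : (fun z => -Real.log ‖discMap (ψ s) (ψ z)‖) =ᶠ[𝓝 z]
        (fun z => if z ∈ V then -Real.log ‖discMap (ψ s) (ψ z)‖ else 0) := by
      filter_upwards [hV.mem_nhds hz.1] with w hw
      rw [if_pos hw]
    rw [← harmonicAt_congr_nhds h1]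
    exact (AnalyticAt.harmonicAt_log_norm (han z hz.1) (hne z hz.1 hz.2)).neg
  refine ⟨hnn, fun z hz => if_neg hz, fun w hw => ?_, hharm⟩
  by_cases hwV : w ∈ V
  · exact ((hharm.continuousOn).continuousAt
      ((hV.sdiff isClosed_singleton).mem_nhds ⟨hwV, hw⟩)).continuousWithinAt
  · refine ContinuousAt.continuousWithinAt ?_
    rw [ContinuousAt, if_neg hwV, Metric.tendsto_nhds]
    intro ε hε
    set ρ := Real.exp (-ε)
    have hρ : ρ < 1 := Real.exp_lt_one_iff.2 (by linarith)
    have hρ0 : 0 < ρ := Real.exp_pos _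
    set c := (1 - ρ ^ 2) * (1 - ‖ψ s‖) ^ 2 with hc
    have hc0 : 0 < c := mul_pos (by nlinarith) (pow_pos (by linarith) 2)
    have hK := isCompact_inter_preimage_closedBall hV hVc hψ hbij (ρ := √(1 - c)) (by
      rw [Real.sqrt_lt' one_pos]; linarith)
    filter_upwards [hK.isClosed.isOpen_compl.mem_nhds (fun h => hwV h.1)] with z hz
    rw [Real.dist_eq, sub_zero, abs_of_nonneg (hnn z)]
    split_ifs with hzV
    · by_contra! hcon
      refine hz ⟨hzV, ?_⟩
      have h0 : 0 < ‖discMap (ψ s) (ψ z)‖ := by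
        refine norm_pos_iff.2 fun h => ?_
        rw [h] at hcon
        simp at hcon
        linarith
      have h1 : ‖discMap (ψ s) (ψ z)‖ ≤ ρ := by
        rw [← Real.log_le_iff_le_exp h0]
        linarith
      have h2 := one_sub_norm_discMap_sq ha.le (hlt z hzV)
      have h3 : ‖discMap (ψ s) (ψ z)‖ ^ 2 ≤ ρ ^ 2 := by gcongr
      have h4 : 1 - ‖ψ s‖ ≤ ‖1 - (starRingEnd ℂ) (ψ s) * ψ z‖ := by
        have h5 := norm_sub_norm_le (1 : ℂ) ((starRingEnd ℂ) (ψ s) * ψ z)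
        rw [norm_one, norm_mul, RCLike.norm_conj] at h5
        nlinarith [norm_nonneg (ψ s), hlt z hzV]
      have h6 : (1 - ‖ψ s‖) ^ 2 ≤ ‖1 - (starRingEnd ℂ) (ψ s) * ψ z‖ ^ 2 :=
        pow_le_pow_left₀ (by linarith) h4 2
      have h7 : 0 ≤ 1 - ‖ψ z‖ ^ 2 := by nlinarith [norm_nonneg (ψ z), hlt z hzV]
      have h8 : (1 - ‖ψ z‖ ^ 2) / ‖1 - (starRingEnd ℂ) (ψ s) * ψ z‖ ^ 2 ≤
          (1 - ‖ψ z‖ ^ 2) / (1 - ‖ψ s‖) ^ 2 :=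
        div_le_div_of_nonneg_left h7 (pow_pos (by linarith) 2) h6
      have h9 : 1 - ρ ^ 2 ≤ (1 - ‖ψ z‖ ^ 2) / (1 - ‖ψ s‖) ^ 2 := by
        have h10 : 0 ≤ (1 - ‖ψ z‖ ^ 2) / ‖1 - (starRingEnd ℂ) (ψ s) * ψ z‖ ^ 2 := by positivity
        nlinarith [mul_nonneg (sq_nonneg ‖ψ s‖) h10]
      rw [le_div_iff₀ (pow_pos (by linarith) 2)] at h9
      rw [mem_preimage, mem_closedBall_zero_iff]
      exact Real.le_sqrt_of_sq_le (by linarith)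
    · exact hε

theorem exists_halfPlane_map {s : ℕ → ℂ} (hs : ∀ N, s N ∈ V)
    (hesc : ∀ K ⊆ V, IsCompact K → ∀ᶠ N in atTop, s N ∉ K) :
    ∃ (F : ℂ → ℂ) (G : ℕ → ℂ → ℝ), DifferentiableOn ℂ F V ∧ BijOn F V {ζ | 0 < ζ.re} ∧
      (∀ N, IsGreen V (s N) (G N)) ∧ ∀ x ∈ V, ∀ y ∈ V, ∀ C : ℝ,
        (∀ᶠ N in atTop, G N x ≤ C * G N y) → (F x).re ≤ C * (F y).re := by
  classical
  have hlt : ∀ z ∈ V, ‖ψ z‖ < 1 := fun z hz => mem_ball_zero_iff.1 (hbij.mapsTo hz)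
  obtain ⟨ξ, hξ, k, hk, hlim⟩ := (isCompact_closedBall (0 : ℂ) 1).tendsto_subseq
    (x := fun N => ψ (s N)) fun N => mem_closedBall_zero_iff.2 (hlt _ (hs N)).le
  rw [mem_closedBall_zero_iff] at hξ
  have hξ1 : ‖ξ‖ = 1 := by
    refine le_antisymm hξ ?_
    by_contra! h
    obtain ⟨ρ, h1, h2⟩ := exists_between h
    have h3 := hk.tendsto_atTop.eventually (hesc _ inter_subset_left
      (isCompact_inter_preimage_closedBall hV hVc hψ hbij h2))
    have h4 := hlim.norm.eventually (gt_mem_nhds h1)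
    obtain ⟨N, h5, h6⟩ := (h3.and h4).exists
    exact h5 ⟨hs _, mem_closedBall_zero_iff.2 (le_of_lt h6)⟩
  have hξc : (starRingEnd ℂ) ξ * ξ = 1 := by
    rw [mul_comm, Complex.mul_conj, Complex.normSq_eq_norm_sq, hξ1]; simp
  have hξc0 : (starRingEnd ℂ) ξ ≠ 0 := left_ne_zero_of_mul_eq_one hξc
  have hne : ∀ z ∈ V, 1 - (starRingEnd ℂ) ξ * ψ z ≠ 0 := fun z hz =>
    one_sub_conj_mul_ne_zero hξ (hlt z hz)
  set F : ℂ → ℂ := fun z => (1 + (starRingEnd ℂ) ξ * ψ z) / (1 - (starRingEnd ℂ) ξ * ψ z) with hF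
  have hFre : ∀ z, (F z).re = (1 - ‖ψ z‖ ^ 2) / ‖1 - (starRingEnd ℂ) ξ * ψ z‖ ^ 2 := fun z => by
    have h1 : ‖ψ z‖ ^ 2 = ‖(starRingEnd ℂ) ξ * ψ z‖ ^ 2 := by
      rw [norm_mul, RCLike.norm_conj, hξ1, one_mul]
    simp only [hF, h1]
    generalize (starRingEnd ℂ) ξ * ψ z = b
    rw [Complex.div_re, ← Complex.normSq_eq_norm_sq, ← Complex.normSq_eq_norm_sq, ← add_div]
    congr 1
    simp [Complex.normSq_apply]
    ring
  refine ⟨F, fun N z => if z ∈ V then -Real.log ‖discMap (ψ (s N)) (ψ z)‖ else 0, ?_, ⟨?_, ?_, ?_⟩,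
    fun N => exists_isGreen hV hVc hψ hbij (hs N), ?_⟩
  · exact ((hψ.const_mul _).const_add _).div ((hψ.const_mul _).const_sub _) hne
  · intro z hz
    show 0 < (F z).re
    rw [hFre]
    have h1 := norm_pos_iff.2 (hne z hz)
    have h2 : 0 < 1 - ‖ψ z‖ ^ 2 := by nlinarith [norm_nonneg (ψ z), hlt z hz]
    positivity
  · intro x hx y hy hxy
    simp only [hF] at hxy
    rw [div_eq_div_iff (hne x hx) (hne y hy)] at hxy
    refine hbij.injOn hx hy (mul_left_cancel₀ hξc0 ?_)
    linear_combination hxy / 2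
  · intro ζ hζ
    have hζ' : 0 < ζ.re := hζ
    have hζ1 : ζ + 1 ≠ 0 := fun h => by
      have := congrArg Complex.re h
      simp at this
      linarith
    have hn : ‖(ζ - 1) / (ζ + 1)‖ < 1 := by
      rw [norm_div, div_lt_one (norm_pos_iff.2 hζ1), ← sq_lt_sq₀ (norm_nonneg _) (norm_nonneg _),
        ← Complex.normSq_eq_norm_sq, ← Complex.normSq_eq_norm_sq, Complex.normSq_apply,
        Complex.normSq_apply]
      simp
      nlinarith
    obtain ⟨z, hz, hzψ⟩ := hbij.surjOn (show ξ * ((ζ - 1) / (ζ + 1)) ∈ ball (0 : ℂ) 1 by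
      rw [mem_ball_zero_iff, norm_mul, hξ1, one_mul]; exact hn)
    refine ⟨z, hz, ?_⟩
    simp only [hF]
    rw [hzψ, ← mul_assoc, hξc, one_mul]
    have : (1 : ℂ) - (ζ - 1) / (ζ + 1) ≠ 0 := by
      rw [sub_ne_zero]
      intro h
      rw [← h] at hn
      simp at hn
    rw [div_eq_iff this]
    field_simp
    ring
  · intro x hx y hy C hev
    set q : ℕ → ℂ → ℝ := fun N z =>
      (1 - ‖ψ z‖ ^ 2) / ‖1 - (starRingEnd ℂ) (ψ (s (k N))) * ψ z‖ ^ 2 with hq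
    have hqlim : ∀ z ∈ V, Tendsto (fun N => q N z) atTop (𝓝 (F z).re) := fun z hz => by
      rw [hFre]
      refine tendsto_const_nhds.div ?_ (pow_ne_zero 2 (norm_ne_zero_iff.2 (hne z hz)))
      exact ((tendsto_const_nhds.sub (((Complex.continuous_conj.tendsto ξ).comp hlim).mul
        tendsto_const_nhds)).norm).pow 2
    have hd0 : Tendsto (fun N => 1 - ‖ψ (s (k N))‖ ^ 2) atTop (𝓝 0) := by
      have := (hlim.norm.pow 2).const_sub 1
      rw [hξ1] at this
      simpa using this
    have hX : ∀ z ∈ V, Tendsto (fun N => 1 - (1 - ‖ψ (s (k N))‖ ^ 2) * q N z) atTop (𝓝 1) :=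
      fun z hz => by
        have := (hd0.mul (hqlim z hz)).const_sub 1
        simpa using this
    have hC0 : Tendsto (fun N => |C| * (q N y * ((1 - (1 - ‖ψ (s (k N))‖ ^ 2) * q N y)⁻¹ - 1)))
        atTop (𝓝 0) := by
      have := ((hqlim y hy).mul (((hX y hy).inv₀ one_ne_zero).sub_const 1)).const_mul |C|
      simpa using this
    have hfin : Tendsto (fun N => C * q N y +
        |C| * (q N y * ((1 - (1 - ‖ψ (s (k N))‖ ^ 2) * q N y)⁻¹ - 1))) atTop
        (𝓝 (C * (F y).re)) := by
      have := ((hqlim y hy).const_mul C).add hC0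
      simpa using this
    refine le_of_tendsto_of_tendsto (hqlim x hx) hfin ?_
    have hpos : ∀ z ∈ V, ∀ᶠ N in atTop, 0 < 1 - (1 - ‖ψ (s (k N))‖ ^ 2) * q N z := fun z hz =>
      (hX z hz).eventually (lt_mem_nhds one_pos)
    filter_upwards [hk.tendsto_atTop.eventually hev, hpos x hx, hpos y hy] with N hN hxp hyp
    rw [if_pos hx, if_pos hy] at hN
    set D := 1 - ‖ψ (s (k N))‖ ^ 2 with hD
    have hDp : 0 < D := by nlinarith [norm_nonneg (ψ (s (k N))), hlt _ (hs (k N))]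
    have hG : ∀ z ∈ V, -Real.log ‖discMap (ψ (s (k N))) (ψ z)‖ =
        -(Real.log (1 - D * q N z) / 2) := fun z hz => by
      have := one_sub_norm_discMap_sq (hlt _ (hs (k N))).le (hlt z hz)
      rw [show 1 - D * q N z = ‖discMap (ψ (s (k N))) (ψ z)‖ ^ 2 by rw [hq]; linarith,
        Real.log_pow]
      push_cast
      ring
    rw [hG x hx, hG y hy] at hN
    have h1 := Real.log_le_sub_one_of_pos hxp
    have h2 := Real.log_le_sub_one_of_pos (inv_pos.2 hyp)
    rw [Real.log_inv] at h2
    have h2' := Real.log_le_sub_one_of_pos hyp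
    have e : (1 - D * q N y)⁻¹ - 1 = D * q N y * (1 - D * q N y)⁻¹ := by
      field_simp
      ring
    set I := (1 - D * q N y)⁻¹ with hI
    rw [e] at h2
    have h3 : C * -Real.log (1 - D * q N y) ≤ C * (D * q N y) +
        |C| * (D * q N y * (I - 1)) := by
      rcases le_total 0 C with hC | hC
      · rw [abs_of_nonneg hC]
        nlinarith [mul_le_mul_of_nonneg_left h2 hC]
      · rw [abs_of_nonpos hC]
        have hqy : 0 ≤ D * q N y := by
          have : 0 ≤ 1 - ‖ψ y‖ ^ 2 := by nlinarith [norm_nonneg (ψ y), hlt y hy]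
          rw [hq]; positivity
        have h4 : 0 ≤ I - 1 := by rw [e]; positivity
        have h5 := mul_le_mul_of_nonpos_left h2' hC
        have h6 : 0 ≤ -C * (D * q N y * (I - 1)) := by
          have : 0 ≤ -C := by linarith
          positivity
        linarith
    have h7 : D * q N x ≤ D * (C * q N y + |C| * (q N y * (I - 1))) := by linarith
    exact le_of_mul_le_mul_left h7 hDp

end

theorem tendsto_atTop_of_chain {u : ℝ → ℝ} {p q h : ℕ → ℝ} {c : ℝ} (hc : 0 < c)
    (hpq : ∀ n, p n ≤ q n) (hqp : ∀ n, q n ≤ p (n + 1)) (hp : Tendsto p atTop atTop)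
    (hgain : ∀ n, u (p n) ≤ h n / 2 * u (q n))
    (hroom : ∀ n, ∀ t ∈ Icc (q n) (p (n + 1)), h n * u (q n) ≤ u t)
    (hgate : ∀ n, ∀ t ∈ Icc (p n) (q n), c * u (p n) ≤ u t) (h0 : 0 < u (p 0)) :
    Tendsto u atTop atTop := by
  have hroom' : ∀ n, ∀ t ∈ Icc (q n) (p (n + 1)), 2 * u (p n) ≤ u t := fun n t ht => by
    linarith [hgain n, hroom n t ht]
  have hpow : ∀ n, 2 ^ n * u (p 0) ≤ u (p n) := fun n => by
    induction n with
    | zero => simp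
    | succ n ih =>
      have := hroom' n _ (right_mem_Icc.2 (hqp n))
      rw [pow_succ]
      linarith
  have hpm : Monotone p := monotone_nat_of_le_succ fun n => (hpq n).trans (hqp n)
  have hall : ∀ n t, p n ≤ t → min c 2 * u (p 0) * 2 ^ n ≤ u t := fun n t ht => by
    obtain ⟨m, hm⟩ := (hp.eventually_gt_atTop t).exists
    have hex : ∃ m, t < p (m + 1) := ⟨m, hm.trans_le (hpm (Nat.le_succ m))⟩
    classical
    set k := Nat.find hex with hk
    have h1 : t < p (k + 1) := Nat.find_spec hex
    have hnk : n ≤ k := by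
      by_contra! hlt
      exact absurd (h1.trans_le (hpm hlt)) ht.not_gt
    have h2 : p k ≤ t := by
      rcases Nat.eq_zero_or_pos k with h | h
      · rw [h]
        exact (hpm (Nat.zero_le n)).trans ht
      · have := Nat.find_min hex (Nat.sub_lt h one_pos)
        rw [← hk, show k - 1 + 1 = k by omega] at this
        exact not_lt.1 this
    have h3 : (2 : ℝ) ^ n * u (p 0) ≤ u (p k) := le_trans
      (mul_le_mul_of_nonneg_right (pow_le_pow_right₀ one_le_two hnk) h0.le) (hpow k)
    have h4 : 0 < (2 : ℝ) ^ n * u (p 0) := by positivity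
    have h5 : min c 2 * u (p 0) * 2 ^ n = min c 2 * (2 ^ n * u (p 0)) := by ring
    rw [h5]
    rcases le_total t (q k) with h | h
    · refine le_trans ?_ (hgate k t ⟨h2, h⟩)
      exact mul_le_mul (min_le_left _ _) h3 h4.le hc.le
    · refine le_trans ?_ (hroom' k t ⟨h, h1.le⟩)
      exact mul_le_mul (min_le_right _ _) h3 h4.le zero_le_two
  refine tendsto_atTop.2 fun b => ?_
  have hlim : Tendsto (fun n : ℕ => min c 2 * u (p 0) * 2 ^ n) atTop atTop :=
    (tendsto_pow_atTop_atTop_of_one_lt one_lt_two).const_mul_atTop (by positivity)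
  obtain ⟨n, hn⟩ := (hlim.eventually_ge_atTop b).exists
  filter_upwards [eventually_ge_atTop (p n)] with t ht
  exact hn.trans (hall n t ht)

/-- The derivative of a map into the right half-plane is controlled by its real part. -/
theorem norm_deriv_le_of_mapsTo_halfPlane {f : ℂ → ℂ} {z : ℂ} {R : ℝ} (hR : 0 < R)
    (hf : DifferentiableOn ℂ f (ball z R)) (hpos : ∀ w ∈ ball z R, 0 < (f w).re) :
    ‖deriv f z‖ ≤ 2 * (f z).re / R := by
  have hz := mem_ball_self hR (x := z)
  set a := f z with ha
  have ha0 : 0 < a.re := hpos z hz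
  have hne : ∀ w ∈ ball z R, f w + (starRingEnd ℂ) a ≠ 0 := fun w hw h => by
    have := congrArg Complex.re h
    simp at this
    linarith [hpos w hw]
  set g : ℂ → ℂ := fun w => (f w - a) / (f w + (starRingEnd ℂ) a) with hg
  have hgd : DifferentiableOn ℂ g (ball z R) := (hf.sub_const _).div (hf.add_const _) hne
  have hgz : g z = 0 := by simp [hg, ← ha]
  have hmaps : MapsTo g (ball z R) (ball (g z) 1) := fun w hw => by
    rw [hgz, mem_ball_zero_iff, hg, norm_div, div_lt_one (norm_pos_iff.2 (hne w hw)),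
      ← sq_lt_sq₀ (norm_nonneg _) (norm_nonneg _), ← Complex.normSq_eq_norm_sq,
      ← Complex.normSq_eq_norm_sq, Complex.normSq_apply, Complex.normSq_apply]
    simp only [Complex.sub_re, Complex.sub_im, Complex.add_re, Complex.add_im, Complex.conj_re,
      Complex.conj_im]
    nlinarith [mul_pos (hpos w hw) ha0]
  have h1 := Complex.norm_deriv_le_div_of_mapsTo_ball hgd (hmaps.mono_right ball_subset_closedBall) hR
  have hfd : HasDerivAt f (deriv f z) z :=
    (hf.differentiableAt (isOpen_ball.mem_nhds hz)).hasDerivAt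
  have h2 : HasDerivAt g (deriv f z / (2 * a.re)) z := by
    refine ((hfd.sub_const a).div (hfd.add_const ((starRingEnd ℂ) a)) (hne z hz)).congr_deriv ?_
    have h3 : f z + (starRingEnd ℂ) a = ((2 * a.re : ℝ) : ℂ) := Complex.add_conj a
    have h4 : ((2 * a.re : ℝ) : ℂ) ≠ 0 := Complex.ofReal_ne_zero.2 (by positivity)
    rw [h3, ← ha, sub_self, zero_mul, sub_zero]
    push_cast at h4 ⊢
    field_simp
  rw [h2.deriv, norm_div, show ‖(2 * (a.re : ℂ))‖ = 2 * a.re by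
    rw [norm_mul, Complex.norm_real, Real.norm_of_nonneg ha0.le]; simp,
    div_le_div_iff₀ (by positivity) hR] at h1
  rw [le_div_iff₀ hR]
  linarith

theorem isPreconnected_halfPlane_sdiff {ρ : ℝ} (hρ : 0 < ρ) :
    IsPreconnected {ζ : ℂ | 0 < ζ.re ∧ ρ < ‖ζ‖} := by
  have hconv : Convex ℝ {w : ℂ | Real.log ρ < w.re ∧ -(Real.pi / 2) < w.im ∧
      w.im < Real.pi / 2} :=
    (convex_halfSpace_re_gt _).inter ((convex_halfSpace_im_gt _).inter (convex_halfSpace_im_lt _))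
  have : {ζ : ℂ | 0 < ζ.re ∧ ρ < ‖ζ‖} = Complex.exp '' {w : ℂ | Real.log ρ < w.re ∧
      -(Real.pi / 2) < w.im ∧ w.im < Real.pi / 2} := by
    ext ζ
    constructor
    · rintro ⟨h1, h2⟩
      have h0 : ζ ≠ 0 := fun h => by simp [h] at h1
      have h3 := abs_lt.1 (Complex.abs_arg_lt_pi_div_two_iff.2 (Or.inl h1))
      exact ⟨Complex.log ζ, ⟨by rw [Complex.log_re]; exact Real.log_lt_log hρ h2,
        by rw [Complex.log_im]; exact h3.1, by rw [Complex.log_im]; exact h3.2⟩,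
        Complex.exp_log h0⟩
    · rintro ⟨w, ⟨h1, h2, h3⟩, rfl⟩
      refine ⟨?_, ?_⟩
      · rw [Complex.exp_re]
        exact mul_pos (Real.exp_pos _) (Real.cos_pos_of_mem_Ioo ⟨h2, h3⟩)
      · rw [Complex.norm_exp, ← Real.log_lt_iff_lt_exp hρ]
        exact h1
  rw [this]
  exact hconv.isPreconnected.image _ Complex.continuous_exp.continuousOn

theorem IsGate.isBounded_image_leftPart {V L R : Set ℂ} {r l : ℝ} (H : IsGate V L R r)
    (hVc : IsPreconnected V) (hl : 2 * r ≤ l) (hl2 : l ≤ 1 / 2) {f : ℂ → ℂ}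
    (hf : DifferentiableOn ℂ f V)
    (hbij : BijOn f V {ζ | 0 < ζ.re}) {U : ℝ}
    (hU : ∀ z ∈ gateSet r, z.re = l → (f z).re ≤ 64 * ((1 - ‖z - 1‖ ^ 2) / l) * U)
    (hfar : ∀ M : ℝ, ∃ z ∈ V, z ∉ leftPart V L r l ∧ (z ∈ gateSet r → z.re ≠ l) ∧ M < ‖f z‖) :
    ∃ M : ℝ, ∀ z ∈ leftPart V L r l, ‖f z‖ ≤ M := by
  have hr := H.pos
  have hl0 : 0 < l := by linarith
  have hmem : ∀ z ∈ gateSet r, z.re = l → z ∈ ball (1 : ℂ) 1 := fun z hz hzl => by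
    rcases hz with (h | h) | h
    · have := mem_ball_neg_one_one_iff.1 h
      nlinarith [sq_nonneg ‖z‖]
    · rw [mem_ball, dist_zero_right] at h
      have := abs_le.1 ((Complex.abs_re_le_norm z).trans h.le)
      linarith
    · exact h
  have hb1V : ball (1 : ℂ) 1 ⊆ V := subset_union_right.trans H.subV
  set S : Set ℂ := ball (1 : ℂ) 1 ∩ {z | z.re = l} with hS
  have hSconv : Convex ℝ S := (convex_ball _ _).inter (convex_hyperplane
    (f := fun z : ℂ => z.re) ⟨fun _ _ => rfl, fun _ _ => by simp⟩ l)
  have hderiv : ∀ z ∈ S, ‖deriv f z‖ ≤ 256 / l * |U| := by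
    rintro z ⟨hz, hzl⟩
    have hz1 : ‖z - 1‖ < 1 := by rwa [mem_ball, dist_eq_norm] at hz
    have hsub : ball z (1 - ‖z - 1‖) ⊆ V := (ball_subset_ball' (by
      rw [dist_eq_norm]; linarith)).trans hb1V
    have h1 := norm_deriv_le_of_mapsTo_halfPlane (by linarith) (hf.mono hsub)
      (fun w hw => hbij.mapsTo (hsub hw))
    refine h1.trans ?_
    rw [div_le_iff₀ (by linarith)]
    have h2 := hU z (Or.inr hz) hzl
    have h3 : 64 * ((1 - ‖z - 1‖ ^ 2) / l) * U ≤ 64 * ((1 - ‖z - 1‖ ^ 2) / l) * |U| :=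
      mul_le_mul_of_nonneg_left (le_abs_self U) (by
        have : 0 ≤ 1 - ‖z - 1‖ ^ 2 := by nlinarith [norm_nonneg (z - 1)]
        positivity)
    have h4 : 64 * ((1 - ‖z - 1‖ ^ 2) / l) * |U| =
        (1 + ‖z - 1‖) * ((64 / l * |U|) * (1 - ‖z - 1‖)) := by ring
    have h5 : 0 ≤ (64 / l * |U|) * (1 - ‖z - 1‖) := mul_nonneg (by positivity) (by linarith)
    have h6 : (1 + ‖z - 1‖) * ((64 / l * |U|) * (1 - ‖z - 1‖)) ≤
        2 * ((64 / l * |U|) * (1 - ‖z - 1‖)) := mul_le_mul_of_nonneg_right (by linarith) h5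
    have h7 : 256 / l * |U| * (1 - ‖z - 1‖) = 4 * ((64 / l * |U|) * (1 - ‖z - 1‖)) := by ring
    rw [h7]
    linarith
  obtain ⟨M₀, hM₀, hM₀'⟩ : ∃ M₀ : ℝ, 0 < M₀ ∧ ∀ z ∈ S, ‖f z‖ ≤ M₀ := by
    rcases S.eq_empty_or_nonempty with h | ⟨x, hx⟩
    · exact ⟨1, one_pos, by simp [h]⟩
    · refine ⟨‖f x‖ + 256 / l * |U| * 2 + 1, by positivity, fun z hz => ?_⟩
      have h1 := hSconv.norm_image_sub_le_of_norm_deriv_le (f := f) (fun w hw =>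
        hf.differentiableAt (H.openV.mem_nhds (hb1V hw.1))) hderiv hx hz
      have h2 : ‖z - x‖ ≤ 2 := by
        have hz1 := hz.1
        have hx1 := hx.1
        rw [mem_ball] at hz1 hx1
        rw [← dist_eq_norm]
        linarith [dist_triangle_right z x 1]
      have h3 : 256 / l * |U| * ‖z - x‖ ≤ 256 / l * |U| * 2 := by gcongr
      linarith [norm_le_norm_add_norm_sub' (f z) (f x)]
  refine ⟨M₀, fun z hz => ?_⟩
  by_contra! hcon
  have hinv := hbij.invOn_invFunOn
  set g := Function.invFunOn f V
  have hgc : ContinuousOn g {ζ | 0 < ζ.re} := by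
    have := differentiableOn_of_leftInvOn H.openV hVc hf hbij.injOn hinv.1
    rw [hbij.image_eq] at this
    exact this.continuousOn
  have hB : IsPreconnected (g '' {ζ : ℂ | 0 < ζ.re ∧ M₀ < ‖ζ‖}) :=
    (isPreconnected_halfPlane_sdiff hM₀).image g (hgc.mono fun ζ h => h.1)
  have hmemB : ∀ w ∈ V, M₀ < ‖f w‖ → w ∈ g '' {ζ : ℂ | 0 < ζ.re ∧ M₀ < ‖ζ‖} := fun w hw h =>
    ⟨f w, ⟨hbij.mapsTo hw, h⟩, hinv.1 hw⟩
  have hncl : ∀ w ∈ V, w ∉ leftPart V L r l → (w ∈ gateSet r → w.re ≠ l) →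
      w ∉ closure (leftPart V L r l) := fun w hw h1 h2 h3 => by
    have := H.mem_chord_of_mem_frontier (l := l) (by rw [abs_of_pos hl0]; exact hl2)
      (z := w) (by rw [H.isOpen_leftPart.frontier_eq]; exact ⟨h3, h1⟩) hw
    exact h2 this.1 this.2
  obtain ⟨w, hwV, hw1, hw2, hw3⟩ := hfar M₀
  obtain ⟨x, hx, hx1, hx2⟩ := hB (leftPart V L r l) (closure (leftPart V L r l))ᶜ
    H.isOpen_leftPart isClosed_closure.isOpen_compl (by
      rintro _ ⟨ζ, ⟨h1, h2⟩, rfl⟩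
      have h3 : g ζ ∈ V := hbij.surjOn.mapsTo_invFunOn h1
      by_cases h4 : g ζ ∈ leftPart V L r l
      · exact Or.inl h4
      · refine Or.inr (hncl _ h3 h4 fun h5 h6 => ?_)
        have := hM₀' (g ζ) ⟨hmem _ h5 h6, h6⟩
        rw [hinv.2 h1] at this
        linarith) ⟨z, hmemB z hz.1 hcon, hz⟩ ⟨w, hmemB w hwV hw3, hncl w hwV hw1 hw2⟩
  exact hx2 (subset_closure hx1)

theorem exists_map_of_gates {V : Set ℂ} (hV : IsOpen V) (hVc : IsPreconnected V) {ψ : ℂ → ℂ}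
    (hψ : DifferentiableOn ℂ ψ V) (hbij : BijOn ψ V (ball 0 1)) {γ : ℝ → ℂ} {p q : ℕ → ℝ}
    {e ϑ : ℕ → ℂ} {w : ℕ → ℝ → ℂ} {L R : ℕ → Set ℂ} {r h R₀ : ℕ → ℝ}
    (hγV : ∀ t, p 0 ≤ t → γ t ∈ V) (τ : ℕ → ℝ) (hτ : ∀ n, p n ≤ τ n ∧ e n = γ (τ n))
    (hesc : ∀ K ⊆ V, IsCompact K → ∀ᶠ N in atTop, e N ∉ K)
    (hpq : ∀ n, p n ≤ q n) (hqp : ∀ n, q n ≤ p (n + 1)) (hp : Tendsto p atTop atTop)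
    (hϑ : ∀ n, ϑ n ≠ 0) (hw : ∀ n t, γ t = e n + ϑ n * w n t)
    (hgate : ∀ n, IsGate {z | e n + ϑ n * z ∈ V} {z | e n + ϑ n * z ∈ L n}
      {z | e n + ϑ n * z ∈ R n} (r n))
    (hR₀ : ∀ n, 2 ≤ R₀ n) (hLR : ∀ n z, e n + ϑ n * z ∈ L n → ‖z‖ < R₀ n)
    (heR : ∀ n N, n < N → e N ∈ R n ∧ 5 ≤ ‖(e N - e n) / ϑ n‖)
    (hwre : ∀ n, ∀ t ∈ Icc (p n) (q n), |(w n t).re| ≤ 0.42 ∧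
      |(w n t).im| ≤ |(w n t).re| / 10 ∧ (w n (p n)).re ≤ (w n t).re)
    (hwp : ∀ n, (w n (p n)).re ∈ Icc (-0.42) (-0.38))
    (hwq : ∀ n, (w n (q n)).re ∈ Icc 0.38 0.42)
    (hh : ∀ n, 0 < h n)
    (hroom : ∀ n N, n + 1 < N → ∀ g, IsGreen V (e N) g → ∀ t ∈ Icc (q n) (p (n + 1)),
      h n * g (γ (q n)) ≤ g (γ t))
    (hsmall : ∀ n, 256 * Real.log (7 * R₀ n ^ 2) ≤ h n * Real.log (R₀ n ^ 2 / (4 * r n))) :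
    ∃ F : ℂ → ℂ, DifferentiableOn ℂ F V ∧ BijOn F V {ζ | 0 < ζ.re} ∧
      Tendsto (fun t => (F (γ t)).re) atTop atTop ∧
      ∀ n, ∃ M : ℝ, ∀ z ∈ V ∩ L n, ‖F z‖ ≤ M := by
  obtain ⟨c, hc, hgc⟩ := exists_gate_const
  have hpm : Monotone p := monotone_nat_of_le_succ fun n => (hpq n).trans (hqp n)
  have hmem : ∀ n t, p n ≤ t → γ t ∈ V := fun n t ht =>
    hγV t ((hpm (Nat.zero_le n)).trans ht)
  have heV : ∀ n, e n ∈ V := fun n => (hτ n).2 ▸ hmem n _ (hτ n).1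
  obtain ⟨F, G, hF, hFb, hG, hlim⟩ := exists_halfPlane_map hV hVc hψ hbij heV hesc
  have hGaff : ∀ n N, IsGreen {z | e n + ϑ n * z ∈ V} ((e N - e n) / ϑ n)
      (fun z => G N (e n + ϑ n * z)) := fun n N =>
    IsGreen.comp_affine (hϑ n) (by
      rw [mul_div_cancel₀ _ (hϑ n), add_sub_cancel]
      exact hG N)
  have heR' : ∀ n N, n < N → (e N - e n) / ϑ n ∈ {z | e n + ϑ n * z ∈ R n} := fun n N hN => by
    have := (heR n N hN).1
    rwa [mem_ofPred_eq, mul_div_cancel₀ _ (hϑ n), add_sub_cancel]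
  have hposu : ∀ t, p 0 ≤ t → 0 < (F (γ t)).re := fun t ht => hFb.mapsTo (hγV t ht)
  have hgain : ∀ n, (F (γ (p n))).re ≤ h n / 2 * (F (γ (q n))).re := fun n => by
    refine hlim _ (hmem n _ le_rfl) _ (hmem n _ (hpq n)) _ ?_
    filter_upwards [eventually_gt_atTop n] with N hN
    have h1 := (hgate n).gain (hGaff n N) (heR' n N hN) (heR n N hN).2 (hR₀ n)
      (fun z hz => hLR n z hz) (hwp n) (hwre n _ (left_mem_Icc.2 (hpq n))).2.1 (hwq n)
      (hwre n _ (right_mem_Icc.2 (hpq n))).2.1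
    rw [← hw, ← hw] at h1
    have h2 : 0 < Real.log (R₀ n ^ 2 / (4 * r n)) := Real.log_pos (by
      have h3 := (hgate n).pos
      have h4 := (hgate n).le
      rw [one_lt_div (by positivity)]
      nlinarith [hR₀ n])
    have h5 := mul_le_mul_of_nonneg_right (hsmall n) ((hG N).nonneg (γ (q n)))
    refine le_of_mul_le_mul_right (h1.trans ?_) h2
    linarith
  have hroom' : ∀ n, ∀ t ∈ Icc (q n) (p (n + 1)),
      h n * (F (γ (q n))).re ≤ (F (γ t)).re := fun n t ht => by
    have h1 := hlim _ (hmem n _ (hpq n)) _ (hmem n t ((hpq n).trans ht.1)) (h n)⁻¹ (by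
      filter_upwards [eventually_gt_atTop (n + 1)] with N hN
      have := hroom n N hN _ (hG N) t ht
      rwa [inv_mul_eq_div, le_div_iff₀' (hh n)])
    rwa [inv_mul_eq_div, le_div_iff₀' (hh n)] at h1
  have hgate' : ∀ n, ∀ t ∈ Icc (p n) (q n), c * (F (γ (p n))).re ≤ (F (γ t)).re := fun n t ht => by
    have h1 := hlim _ (hmem n _ le_rfl) _ (hmem n t ht.1) c⁻¹ (by
      filter_upwards [eventually_gt_atTop n] with N hN
      have := hgc (hgate n) (hGaff n N) (heR' n N hN) (heR n N hN).2 (fun z hz => hLR n z hz)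
        (hwp n) (hwre n _ (left_mem_Icc.2 (hpq n))).2.1 (hwre n t ht).1 (hwre n t ht).2.1
        (hwre n t ht).2.2
      rw [← hw, ← hw] at this
      rwa [inv_mul_eq_div, le_div_iff₀' hc])
    rwa [inv_mul_eq_div, le_div_iff₀' hc] at h1
  have htend : Tendsto (fun t => (F (γ t)).re) atTop atTop :=
    tendsto_atTop_of_chain hc hpq hqp hp hgain hroom' hgate' (hposu _ le_rfl)
  refine ⟨F, hF, hFb, htend, fun n => ?_⟩
  have hr := (hgate n).pos
  have hr8 := (hgate n).le
  have hl := hwq n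
  have haff : Differentiable ℂ fun z => e n + ϑ n * z := by fun_prop
  have hsurj : ∀ x, e n + ϑ n * ((x - e n) / ϑ n) = x := fun x => by
    rw [mul_div_cancel₀ _ (hϑ n), add_sub_cancel]
  have hset : {z | e n + ϑ n * z ∈ V} = (fun x => (x - e n) / ϑ n) '' V := by
    ext z
    constructor
    · exact fun hz => ⟨_, hz, by simp [mul_div_cancel_left₀ _ (hϑ n)]⟩
    · rintro ⟨x, hx, rfl⟩
      rwa [mem_ofPred_eq, hsurj]
  have hbij' : BijOn (fun z => F (e n + ϑ n * z)) {z | e n + ϑ n * z ∈ V} {ζ | 0 < ζ.re} := by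
    refine ⟨fun z hz => hFb.mapsTo hz, fun z hz z' hz' h => ?_, fun ζ hζ => ?_⟩
    · exact mul_left_cancel₀ (hϑ n) (add_left_cancel (hFb.injOn hz hz' h))
    · obtain ⟨x, hx, rfl⟩ := hFb.surjOn hζ
      exact ⟨(x - e n) / ϑ n, by rwa [mem_ofPred_eq, hsurj], by simp only [hsurj]⟩
  obtain ⟨M, hM⟩ := (hgate n).isBounded_image_leftPart (l := (w n (q n)).re)
    (by rw [hset]; exact hVc.image _ (by fun_prop)) (by linarith [hl.1]) (by linarith [hl.2])
    (hF.comp haff.differentiableOn fun z hz => hz) hbij' (U := (F (γ (q n))).re)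
    (fun z hz hzl => by
      refine hlim _ ((hgate n).subV hz) _ (hmem n _ (hpq n)) _ ?_
      filter_upwards [eventually_gt_atTop n] with N hN
      have := (hgate n).le_chord (hGaff n N) (heR n N hN).2 (Or.inl rfl) (l := (w n (q n)).re)
        (by linarith [hl.1]) (by linarith [hl.2]) hz (by rw [one_mul, hzl])
        (y := w n (q n)) (by rw [one_mul]) (hwre n _ (right_mem_Icc.2 (hpq n))).2.1
      rw [← hw] at this
      simpa using this)
    (fun M => by
      have h1 : Tendsto (fun N => (F (e N)).re) atTop atTop := by
        simp only [fun N => (hτ N).2]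
        exact htend.comp (tendsto_atTop_mono (fun N => (hτ N).1) hp)
      obtain ⟨N, hN, hnN⟩ := ((h1.eventually_gt_atTop M).and (eventually_gt_atTop n)).exists
      have h2 : (e N - e n) / ϑ n ∉ gateSet (r n) := fun h => by
        linarith [norm_lt_of_mem_gateSet hr8 h, (heR n N hnN).2]
      refine ⟨(e N - e n) / ϑ n, by rw [mem_ofPred_eq, hsurj]; exact heV N, ?_,
        fun h => absurd h h2, ?_⟩
      · rintro ⟨-, h | h⟩
        · exact disjoint_left.1 (hgate n).disj h (heR' n N hnN)
        · exact h2 h.1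
      · simp only [Function.comp, hsurj]
        exact hN.trans_le ((le_abs_self _).trans (Complex.abs_re_le_norm _)))
  refine ⟨M, fun z hz => ?_⟩
  have := hM ((z - e n) / ϑ n) ⟨by rw [mem_ofPred_eq, hsurj]; exact hz.1, Or.inl (by
    rw [mem_ofPred_eq, hsurj]; exact hz.2)⟩
  simpa only [Function.comp, hsurj] using this

end

theorem IsCompact.continuousOn_invFunOn_image {X Y : Type*} [TopologicalSpace X]
    [TopologicalSpace Y] [T2Space Y] [Nonempty X] {f : X → Y} {K : Set X} (hK : IsCompact K)
    (hf : ContinuousOn f K) (hinj : InjOn f K) :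
    ContinuousOn (Function.invFunOn f K) (f '' K) := by
  refine continuousOn_iff_isClosed.2 fun C hC =>
    ⟨f '' (K ∩ C), ((hK.inter_right hC).image_of_continuousOn
      (hf.mono inter_subset_left)).isClosed, ?_⟩
  ext y
  constructor
  · rintro ⟨hy, x, hx, rfl⟩
    rw [mem_preimage, hinj.leftInvOn_invFunOn hx] at hy
    exact ⟨⟨x, ⟨hx, hy⟩, rfl⟩, x, hx, rfl⟩
  · rintro ⟨⟨x, ⟨hx, hxC⟩, rfl⟩, -⟩
    exact ⟨by rwa [mem_preimage, hinj.leftInvOn_invFunOn hx], x, hx, rfl⟩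

theorem exists_continuousOn_extension_of_locallyFinite {U : Set ℂ} {Y : ℕ → Set ℂ}
    (hY : ∀ n, IsClosed (Y n))
    (hfin : ∀ z ∈ U, ∃ O, IsOpen O ∧ z ∈ O ∧ {n | (Y n ∩ O).Nonempty}.Finite) {f : ℂ → ℝ}
    (hf : ∀ n, ContinuousOn f (Y n)) :
    ∃ τ : ℂ → ℝ, ContinuousOn τ U ∧ ∀ n, ∀ z ∈ U, z ∈ Y n → τ z = f z := by
  have hloc : LocallyFinite fun n => ((↑) : U → ℂ) ⁻¹' Y n := fun z => by
    obtain ⟨O, hO, hzO, hO'⟩ := hfin z z.2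
    refine ⟨((↑) : U → ℂ) ⁻¹' O, (hO.preimage continuous_subtype_val).mem_nhds hzO,
      hO'.subset ?_⟩
    rintro n ⟨x, hx, hx'⟩
    exact ⟨x, hx, hx'⟩
  have hcl : ∀ n, IsClosed (((↑) : U → ℂ) ⁻¹' Y n) := fun n =>
    (hY n).preimage continuous_subtype_val
  have hcont : ContinuousOn (fun z : U => f z) (⋃ n, ((↑) : U → ℂ) ⁻¹' Y n) :=
    hloc.continuousOn_iUnion hcl fun n => (hf n).comp continuous_subtype_val.continuousOn
      fun z hz => hz
  obtain ⟨g, hg⟩ := ContinuousMap.exists_restrict_eq (hloc.isClosed_iUnion hcl)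
    ⟨_, continuousOn_iff_continuous_domRestrict.1 hcont⟩
  classical
  have hext : ∀ (z : ℂ) (hz : z ∈ U), Function.extend ((↑) : U → ℂ) g 0 z = g ⟨z, hz⟩ :=
    fun z hz => Subtype.val_injective.extend_apply g 0 ⟨z, hz⟩
  refine ⟨Function.extend ((↑) : U → ℂ) g 0, ?_, fun n z hz hzn => ?_⟩
  · rw [continuousOn_iff_continuous_domRestrict]
    convert g.continuous using 1
    ext z
    exact hext z z.2
  · rw [hext z hz]
    exact DFunLike.congr_fun hg ⟨⟨z, hz⟩, mem_iUnion.2 ⟨n, hzn⟩⟩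

theorem isOpen_segment_subset {A U : Set ℂ} (hA : IsOpen A) (hU : IsOpen U) {f : ℂ → ℂ}
    (hf : ContinuousOn f A) : IsOpen {z | z ∈ A ∧ segment ℝ z (f z) ⊆ U} := by
  rw [isOpen_iff_mem_nhds]
  rintro z ⟨hz, hseg⟩
  have hfz := hf.continuousAt (hA.mem_nhds hz)
  have hev : ∀ᶠ x in 𝓝 z, ∀ s ∈ Icc (0 : ℝ) 1, AffineMap.lineMap x (f x) s ∈ U := by
    refine isCompact_Icc.eventually_forall_of_forall_eventually fun s hs => ?_
    have hc : ContinuousAt (fun p : ℂ × ℝ => AffineMap.lineMap p.1 (f p.1) p.2) (z, s) := by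
      simp only [AffineMap.lineMap_apply_module]
      have h1 : ContinuousAt (fun p : ℂ × ℝ => f p.1) (z, s) :=
        ContinuousAt.comp (f := Prod.fst) (x := (z, s)) hfz continuousAt_fst
      fun_prop
    refine hc.eventually (hU.mem_nhds (hseg ?_))
    rw [segment_eq_image_lineMap]
    exact ⟨s, hs, rfl⟩
  filter_upwards [hev, hA.mem_nhds hz] with x hx hxA
  refine ⟨hxA, ?_⟩
  rw [segment_eq_image_lineMap]
  rintro _ ⟨s, hs, rfl⟩
  exact hx s hs

/-- A point at which a segment seen from `a` subtends a straight angle contains `a`. -/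
theorem div_mem_slitPlane_of_notMem_segment {a x y : ℂ} (h : a ∉ segment ℝ x y) :
    (x - a) / (y - a) ∈ Complex.slitPlane := by
  have hy : y - a ≠ 0 := fun h0 => h (by
    rw [← sub_eq_zero.1 h0]; exact right_mem_segment ℝ x y)
  rw [Complex.mem_slitPlane_iff_not_le_zero]
  intro h0
  obtain ⟨c, hc⟩ : ∃ c : ℝ, (x - a) / (y - a) = -(c : ℂ) :=
    ⟨-((x - a) / (y - a)).re, by
      have := (Complex.nonpos_iff.1 h0).2
      apply Complex.ext <;> simp [this]⟩
  have hc0 : 0 ≤ c := by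
    have := (Complex.nonpos_iff.1 h0).1
    rw [hc] at this
    simpa using this
  rw [div_eq_iff hy] at hc
  have h1 : (0 : ℝ) < 1 + c := by linarith
  have h2 : (1 + c : ℂ) ≠ 0 := by exact_mod_cast h1.ne'
  refine h ⟨1 / (1 + c), c / (1 + c), by positivity, by positivity, by field_simp, ?_⟩
  simp only [Complex.real_smul]
  push_cast
  field_simp
  linear_combination hc

theorem exists_log_of_segment_subset {γ : ℝ → ℂ} (hγ : Continuous γ) {U₀ U₁ : Set ℂ}
    {τ : ℂ → ℝ} (hτ : ContinuousOn τ U₁) (hseg : ∀ z ∈ U₁, segment ℝ z (γ (τ z)) ⊆ U₀)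
    (hγU : ∀ t, γ t ∈ U₀) {a : ℂ} (ha : a ∉ U₀) :
    ∃ L : ℂ → ℂ, ContinuousOn L U₁ ∧ ∀ z ∈ U₁, Complex.exp (L z) = z - a := by
  have hne : ∀ t, γ t - a ≠ 0 := fun t h => ha (sub_eq_zero.1 h ▸ hγU t)
  have hsc : IsSimplyConnected (univ : Set ℝ) := by
    have := (convex_univ (𝕜 := ℝ) (E := ℝ)).contractibleSpace univ_nonempty
    exact (inferInstance : SimplyConnectedSpace (univ : Set ℝ))
  obtain ⟨l, hl, hle⟩ := Complex.exists_continuousOn_eqOn_exp_comp hsc isOpen_univ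
    (g := fun t => γ t - a) (by fun_prop) (by rintro ⟨t, -, ht⟩; exact hne t ht)
  have hslit : ∀ z ∈ U₁, (z - a) / (γ (τ z) - a) ∈ Complex.slitPlane := fun z hz =>
    div_mem_slitPlane_of_notMem_segment fun h => ha (hseg z hz h)
  refine ⟨fun z => l (τ z) + Complex.log ((z - a) / (γ (τ z) - a)), ?_, fun z hz => ?_⟩
  · refine ContinuousOn.add (hl.comp hτ fun _ _ => mem_univ _) (ContinuousOn.clog ?_ hslit)
    exact (by fun_prop : ContinuousOn (fun z : ℂ => z - a) U₁).div
      ((hγ.comp_continuousOn hτ).sub continuousOn_const) fun z _ => hne _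
  · have h1 : Complex.exp (l (τ z)) = γ (τ z) - a := hle (mem_univ (τ z))
    rw [Complex.exp_add, h1, Complex.exp_log (Complex.slitPlane_ne_zero (hslit z hz)),
      mul_div_cancel₀ _ (hne _)]

/-- The parameter at which the part of the curve between two consecutive gates begins. -/
def gateStart (τ θ : ℕ → ℝ) : ℕ → ℝ
  | 0 => 0
  | n + 1 => τ n + 1.8 * θ n

/-- The parameter of the previous gate. -/
def gatePrev (τ : ℕ → ℝ) : ℕ → ℝ
  | 0 => -1
  | n + 1 => τ n

/-- The affine coordinate in which the `n`-th gate is centred at `0` and the curve is almost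
horizontal. -/
noncomputable def gateCoord (γ : ℝ → ℂ) (τ : ℕ → ℝ) (ϑ : ℕ → ℂ) (n : ℕ) (z : ℂ) : ℂ :=
  (z - γ (τ n)) / ϑ n

theorem continuous_gateCoord (γ : ℝ → ℂ) (τ : ℕ → ℝ) (ϑ : ℕ → ℂ) (n : ℕ) :
    Continuous (gateCoord γ τ ϑ n) := by
  unfold gateCoord
  fun_prop

/-- A curve `γ` with gates of size `ϑ n` at the parameters `τ n`: near `τ n` the curve is almost
straight, and the remaining part of the curve stays away from the gate. The number `η n` is the
width of a strip around the curve between the gates `n - 1` and `n`. -/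
structure IsGateChain (γ : ℝ → ℂ) (τ θ : ℕ → ℝ) (ϑ : ℕ → ℂ) (η : ℕ → ℝ) : Prop where
  cont : Continuous γ
  inj : InjOn γ (Ici 0)
  const : ∀ t ≤ 0, γ t = γ 0
  one_le : 1 ≤ τ 0
  succ : ∀ n, τ n + 1 ≤ τ (n + 1)
  pos : ∀ n, 0 < θ n
  le : ∀ n, θ n ≤ 1 / 10
  ne : ∀ n, ϑ n ≠ 0
  near : ∀ n t t', |t - τ n| ≤ 6 * θ n → |t' - τ n| ≤ 6 * θ n →
    ‖(γ t - γ t') / ϑ n - ((t - t') / θ n : ℝ)‖ ≤ 0.05 * |(t - t') / θ n|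
  far : ∀ n t, 0 ≤ t → 6 * θ n ≤ |t - τ n| → 5 ≤ ‖(γ t - γ (τ n)) / ϑ n‖
  width_pos : ∀ n, 0 < η n
  width : ∀ n, ∀ t ∈ Icc (gateStart τ θ n) (τ n - 1.8 * θ n), ∀ s, 0 ≤ s →
    s ∉ Ioo (gatePrev τ n) (τ n) → 8 * η n ≤ ‖γ t - γ s‖

/-- The rectangle continuing the gate `n` to the left. -/
def leftDoor (γ : ℝ → ℂ) (τ : ℕ → ℝ) (ϑ : ℕ → ℂ) (n : ℕ) : Set ℂ :=
  gateCoord γ τ ϑ n ⁻¹' {w | (-2.3 < w.re ∧ w.re < -1.7) ∧ (-0.2 < w.im ∧ w.im < 0.2)}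

/-- The rectangle continuing the gate `n` to the right. -/
def rightDoor (γ : ℝ → ℂ) (τ : ℕ → ℝ) (ϑ : ℕ → ℂ) (n : ℕ) : Set ℂ :=
  gateCoord γ τ ϑ n ⁻¹' {w | (1.7 < w.re ∧ w.re < 2.3) ∧ (-0.2 < w.im ∧ w.im < 0.2)}

/-- The strip around the curve between the gates `n - 1` and `n`. -/
def gateTube (γ : ℝ → ℂ) (τ θ : ℕ → ℝ) (η : ℕ → ℝ) (n : ℕ) : Set ℂ :=
  thickening (η n) (γ '' Icc (gateStart τ θ n) (τ n - 1.8 * θ n))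

/-- The strip between the gates `n - 1` and `n` together with the adjacent doors. -/
def gateRoom (γ : ℝ → ℂ) (τ θ : ℕ → ℝ) (ϑ : ℕ → ℂ) (η : ℕ → ℝ) (n : ℕ) : Set ℂ :=
  gateTube γ τ θ η n ∪ leftDoor γ τ ϑ n ∪ {z | ∃ k, n = k + 1 ∧ z ∈ rightDoor γ τ ϑ k}

/-- The `n`-th gate, with an opening of radius `r`. -/
def chainGate (γ : ℝ → ℂ) (τ : ℕ → ℝ) (ϑ : ℕ → ℂ) (n : ℕ) (r : ℝ) : Set ℂ :=
  gateCoord γ τ ϑ n ⁻¹' gateSet r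

namespace IsGateChain

variable {γ : ℝ → ℂ} {τ θ : ℕ → ℝ} {ϑ : ℕ → ℂ} {η : ℕ → ℝ} (H : IsGateChain γ τ θ ϑ η)

section
include H

theorem add_mul_gateCoord (n : ℕ) (z : ℂ) : γ (τ n) + ϑ n * gateCoord γ τ ϑ n z = z := by
  rw [gateCoord, mul_div_cancel₀ _ (H.ne n), add_sub_cancel]

theorem gateCoord_add_mul (n : ℕ) (w : ℂ) : gateCoord γ τ ϑ n (γ (τ n) + ϑ n * w) = w := by
  rw [gateCoord, add_sub_cancel_left, mul_div_cancel_left₀ _ (H.ne n)]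

theorem norm_gateCoord_mul (n : ℕ) (z : ℂ) :
    ‖gateCoord γ τ ϑ n z‖ * ‖ϑ n‖ = ‖z - γ (τ n)‖ := by
  rw [gateCoord, norm_div, div_mul_cancel₀ _ (norm_ne_zero_iff.2 (H.ne n))]

theorem norm_pos (n : ℕ) : 0 < ‖ϑ n‖ := norm_pos_iff.2 (H.ne n)

theorem strictMono : StrictMono τ := strictMono_nat_of_lt_succ fun n => by linarith [H.succ n]

theorem add_one_le {m n : ℕ} (h : m < n) : τ m + 1 ≤ τ n :=
  (H.succ m).trans (H.strictMono.monotone h)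

theorem one_le' (n : ℕ) : 1 ≤ τ n := H.one_le.trans (H.strictMono.monotone (Nat.zero_le n))

theorem natCast_le (n : ℕ) : (n : ℝ) ≤ τ n := by
  induction n with
  | zero => simpa using zero_le_one.trans H.one_le
  | succ n ih => push_cast; linarith [H.succ n]

theorem tendsto : Tendsto τ atTop atTop :=
  tendsto_atTop_mono H.natCast_le tendsto_natCast_atTop_atTop

theorem far_of_ne {m n : ℕ} (h : m ≠ n) :
    5 * ‖ϑ m‖ ≤ ‖γ (τ n) - γ (τ m)‖ := by
  have h1 := H.far m (τ n) (by linarith [H.one_le' n]) (by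
    have h2 := H.le m
    rcases lt_or_gt_of_ne h with h | h
    · have := H.add_one_le h
      exact le_trans (by linarith) (le_abs_self _)
    · have := H.add_one_le h
      exact le_trans (by linarith) (neg_le_abs _))
  rwa [norm_div, le_div_iff₀ (H.norm_pos m)] at h1

theorem le_norm_gateCoord_of_ne {m n : ℕ} (h : m ≠ n) {z : ℂ}
    (hz : ‖gateCoord γ τ ϑ n z‖ ≤ 2.4) : 2.6 ≤ ‖gateCoord γ τ ϑ m z‖ := by
  have h1 := H.far_of_ne h
  have h2 := H.far_of_ne h.symm
  have h3 := mul_le_mul_of_nonneg_right hz (H.norm_pos n).le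
  rw [H.norm_gateCoord_mul] at h3
  rw [norm_sub_rev] at h2
  refine le_of_mul_le_mul_right ?_ (H.norm_pos m)
  rw [H.norm_gateCoord_mul]
  have h4 := norm_sub_le_norm_sub_add_norm_sub (γ (τ n)) z (γ (τ m))
  rw [norm_sub_rev (γ (τ n)) z] at h4
  linarith

theorem norm_gateCoord_curve_sub_le {n : ℕ} {t : ℝ} (ht : |t - τ n| ≤ 6 * θ n) :
    ‖gateCoord γ τ ϑ n (γ t) - ((t - τ n) / θ n : ℝ)‖ ≤ 0.05 * |(t - τ n) / θ n| :=
  H.near n t (τ n) ht (by simpa using (H.pos n).le)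

theorem re_gateCoord_mem {n : ℕ} {t : ℝ} (ht : |t - τ n| ≤ 6 * θ n) :
    |(gateCoord γ τ ϑ n (γ t)).re - (t - τ n) / θ n| ≤ 0.05 * |(t - τ n) / θ n| := by
  have := (Complex.abs_re_le_norm _).trans (H.norm_gateCoord_curve_sub_le ht)
  rwa [Complex.sub_re, Complex.ofReal_re] at this

theorem abs_im_gateCoord_le {n : ℕ} {t : ℝ} (ht : |t - τ n| ≤ 6 * θ n) :
    |(gateCoord γ τ ϑ n (γ t)).im| ≤ 0.053 * |(gateCoord γ τ ϑ n (γ t)).re| := by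
  have h1 := (Complex.abs_im_le_norm _).trans (H.norm_gateCoord_curve_sub_le ht)
  rw [Complex.sub_im, Complex.ofReal_im, sub_zero] at h1
  have h2 := H.re_gateCoord_mem ht
  have h3 := abs_sub_abs_le_abs_sub ((t - τ n) / θ n) (gateCoord γ τ ϑ n (γ t)).re
  rw [abs_sub_comm] at h3
  linarith [abs_nonneg (gateCoord γ τ ϑ n (γ t)).re]

theorem strictMonoOn_re (n : ℕ) :
    StrictMonoOn (fun t => (gateCoord γ τ ϑ n (γ t)).re) {t | |t - τ n| ≤ 6 * θ n} := by
  intro t ht t' ht' htt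
  have h1 := (Complex.abs_re_le_norm _).trans (H.near n t' t ht' ht)
  have h2 : 0 < (t' - t) / θ n := div_pos (sub_pos.2 htt) (H.pos n)
  have h3 : (γ t' - γ t) / ϑ n = gateCoord γ τ ϑ n (γ t') - gateCoord γ τ ϑ n (γ t) := by
    rw [gateCoord, gateCoord, ← sub_div, sub_sub_sub_cancel_right]
  rw [h3, Complex.sub_re, Complex.sub_re, Complex.ofReal_re, abs_of_pos h2] at h1
  have := (abs_le.1 h1).1
  simp only
  linarith

theorem abs_sub_lt_of_norm_lt {n : ℕ} {t : ℝ} (ht : 0 ≤ t)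
    (h : ‖gateCoord γ τ ϑ n (γ t)‖ < 5) : |t - τ n| < 6 * θ n := by
  by_contra! h'
  exact absurd (H.far n t ht h') (not_le.2 h)

/-- A point much closer to a curve point beyond the gate than that point is to the gate is itself
beyond the gate. -/
theorem of_close {n : ℕ} {t σ : ℝ} (hσ : σ = 1 ∨ σ = -1) (ht0 : 0 ≤ t)
    (ht : 1.8 * θ n ≤ σ * (t - τ n)) {z : ℂ} (hz : 8 * ‖z - γ t‖ ≤ ‖γ t - γ (τ n)‖) :
    1.49 ≤ ‖gateCoord γ τ ϑ n z‖ ∧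
      (0 < σ * (gateCoord γ τ ϑ n z).re ∨ 4.3 ≤ ‖gateCoord γ τ ϑ n z‖) := by
  have hσa : |σ| = 1 := by rcases hσ with rfl | rfl <;> simp
  have hθ := H.pos n
  have h1 : gateCoord γ τ ϑ n z - gateCoord γ τ ϑ n (γ t) = (z - γ t) / ϑ n := by
    rw [gateCoord, gateCoord, ← sub_div, sub_sub_sub_cancel_right]
  have h2 : 8 * ‖gateCoord γ τ ϑ n z - gateCoord γ τ ϑ n (γ t)‖ ≤ ‖gateCoord γ τ ϑ n (γ t)‖ := by
    rw [h1, gateCoord, norm_div, norm_div, ← mul_div_assoc]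
    exact div_le_div_of_nonneg_right hz (norm_nonneg _)
  have h3 := norm_sub_norm_le (gateCoord γ τ ϑ n (γ t)) (gateCoord γ τ ϑ n z)
  rw [norm_sub_rev] at h3
  rcases le_total (6 * θ n) |t - τ n| with h | h
  · have := H.far n t ht0 h
    rw [← gateCoord] at this
    exact ⟨by linarith, Or.inr (by linarith)⟩
  · have h4 := H.norm_gateCoord_curve_sub_le h
    have h5 := H.re_gateCoord_mem h
    set u := (t - τ n) / θ n with hu
    have h6 : 1.8 ≤ σ * u := by
      rw [hu, ← mul_div_assoc, le_div_iff₀ hθ]; exact ht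
    have h7 : |u| = σ * u := by
      rw [← abs_of_nonneg (by linarith : (0 : ℝ) ≤ σ * u), abs_mul, hσa, one_mul]
    have h8 : ‖gateCoord γ τ ϑ n (γ t)‖ ≤ 1.05 * (σ * u) := by
      have := norm_le_norm_add_norm_sub' (gateCoord γ τ ϑ n (γ t)) (u : ℂ)
      rw [Complex.norm_real, Real.norm_eq_abs] at this
      linarith
    have h9 : 0.95 * (σ * u) ≤ σ * (gateCoord γ τ ϑ n (γ t)).re := by
      have h10 : σ * u - σ * (gateCoord γ τ ϑ n (γ t)).re ≤
          |(gateCoord γ τ ϑ n (γ t)).re - u| := by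
        rw [← mul_sub, abs_sub_comm]
        refine (le_abs_self _).trans ?_
        rw [abs_mul, hσa, one_mul]
      linarith
    have h11 : σ * (gateCoord γ τ ϑ n (γ t)).re - σ * (gateCoord γ τ ϑ n z).re ≤
        ‖gateCoord γ τ ϑ n z - gateCoord γ τ ϑ n (γ t)‖ := by
      rw [← mul_sub, norm_sub_rev, ← Complex.sub_re]
      refine (le_abs_self _).trans ?_
      rw [abs_mul, hσa, one_mul]
      exact Complex.abs_re_le_norm _
    have h12 : σ * (gateCoord γ τ ϑ n (γ t)).re ≤ ‖gateCoord γ τ ϑ n (γ t)‖ := by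
      refine (le_abs_self _).trans ?_
      rw [abs_mul, hσa, one_mul]
      exact Complex.abs_re_le_norm _
    exact ⟨by linarith, Or.inl (by linarith)⟩

end

end IsGateChain

namespace IsGateChain

variable {γ : ℝ → ℂ} {τ θ : ℕ → ℝ} {ϑ : ℕ → ℂ} {η : ℕ → ℝ} (H : IsGateChain γ τ θ ϑ η)

section
include H

theorem gateStart_nonneg (n : ℕ) : 0 ≤ gateStart τ θ n := by
  cases n with
  | zero => exact le_rfl
  | succ n => simp only [gateStart]; linarith [H.one_le' n, H.pos n]

theorem gatePrev_lt_gateStart (n : ℕ) : gatePrev τ n < gateStart τ θ n := by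
  cases n with
  | zero => simp [gatePrev, gateStart]
  | succ n => simp only [gateStart, gatePrev]; linarith [H.pos n]

theorem le_gatePrev {m n : ℕ} (h : m < n) : τ m ≤ gatePrev τ n := by
  cases n with
  | zero => omega
  | succ n => exact H.strictMono.monotone (Nat.le_of_lt_succ h)

theorem gatePrev_add_one_le (n : ℕ) : gatePrev τ n + 1 ≤ τ n := by
  cases n with
  | zero => simp only [gatePrev]; linarith [H.one_le' 0]
  | succ n => exact H.succ n

theorem notMem_Ioo (m n : ℕ) : τ m ∉ Ioo (gatePrev τ n) (τ n) := fun h => by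
  rcases lt_or_ge m n with h' | h'
  · exact absurd h.1 (H.le_gatePrev h').not_gt
  · exact absurd h.2 (H.strictMono.monotone h').not_gt

theorem exists_of_mem_gateTube {n : ℕ} {z : ℂ} (hz : z ∈ gateTube γ τ θ η n) :
    ∃ t ∈ Icc (gateStart τ θ n) (τ n - 1.8 * θ n), ‖z - γ t‖ < η n ∧
      ∀ s, 0 ≤ s → s ∉ Ioo (gatePrev τ n) (τ n) → 8 * ‖z - γ t‖ < ‖γ t - γ s‖ := by
  obtain ⟨_, ⟨t, ht, rfl⟩, hzt⟩ := mem_thickening_iff.1 hz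
  rw [dist_eq_norm] at hzt
  exact ⟨t, ht, hzt, fun s hs hs' => by linarith [H.width n t ht s hs hs']⟩

theorem tube_close {n : ℕ} {z : ℂ} (hz : z ∈ gateTube γ τ θ η n) :
    ∃ t ∈ Icc (gateStart τ θ n) (τ n - 1.8 * θ n), 0 ≤ t ∧
      ∀ m, 8 * ‖z - γ t‖ ≤ ‖γ t - γ (τ m)‖ := by
  obtain ⟨t, ht, -, h⟩ := H.exists_of_mem_gateTube hz
  exact ⟨t, ht, (H.gateStart_nonneg n).trans ht.1, fun m =>
    (h _ (by linarith [H.one_le' m]) (H.notMem_Ioo m n)).le⟩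

theorem tube_left {n : ℕ} {z : ℂ} (hz : z ∈ gateTube γ τ θ η n) :
    1.49 ≤ ‖gateCoord γ τ ϑ n z‖ ∧
      ((gateCoord γ τ ϑ n z).re < 0 ∨ 4.3 ≤ ‖gateCoord γ τ ϑ n z‖) := by
  obtain ⟨t, ht, ht0, h⟩ := H.tube_close hz
  have := H.of_close (n := n) (Or.inr rfl) ht0 (by linarith [ht.2]) (h n)
  exact ⟨this.1, this.2.imp_left fun h => by linarith⟩

theorem tube_right {n : ℕ} {z : ℂ} (hz : z ∈ gateTube γ τ θ η (n + 1)) :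
    1.49 ≤ ‖gateCoord γ τ ϑ n z‖ ∧
      (0 < (gateCoord γ τ ϑ n z).re ∨ 4.3 ≤ ‖gateCoord γ τ ϑ n z‖) := by
  obtain ⟨t, ht, ht0, h⟩ := H.tube_close hz
  have h1 := ht.1
  simp only [gateStart] at h1
  have := H.of_close (n := n) (Or.inl rfl) ht0 (by linarith) (h n)
  exact ⟨this.1, this.2.imp_left fun h => by linarith⟩

theorem tube_far {m n : ℕ} (h1 : m ≠ n) (h2 : n ≠ m + 1) {z : ℂ}
    (hz : z ∈ gateTube γ τ θ η n) : 4.3 ≤ ‖gateCoord γ τ ϑ m z‖ := by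
  obtain ⟨t, ht, ht0, h⟩ := H.tube_close hz
  have hfar : 6 * θ m ≤ |t - τ m| := by
    have hθ := H.le m
    rcases lt_or_gt_of_ne h1 with h1 | h1
    · obtain ⟨k, rfl⟩ : ∃ k, n = k + 1 := ⟨n - 1, by omega⟩
      have h3 := H.add_one_le (show m < k by omega)
      have h4 := ht.1
      simp only [gateStart] at h4
      exact le_trans (by linarith [H.pos k]) (le_abs_self _)
    · have h3 := H.add_one_le h1
      exact le_trans (by linarith [H.pos n, ht.2]) (neg_le_abs _)
  have h3 := H.far m t ht0 hfar
  have h4 : ‖gateCoord γ τ ϑ m z - gateCoord γ τ ϑ m (γ t)‖ * 8 ≤ ‖gateCoord γ τ ϑ m (γ t)‖ := by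
    have h5 : gateCoord γ τ ϑ m z - gateCoord γ τ ϑ m (γ t) = (z - γ t) / ϑ m := by
      rw [gateCoord, gateCoord, ← sub_div, sub_sub_sub_cancel_right]
    rw [h5, gateCoord, norm_div, norm_div, div_mul_eq_mul_div]
    exact div_le_div_of_nonneg_right (by linarith [h m]) (norm_nonneg _)
  have h6 := norm_sub_norm_le (gateCoord γ τ ϑ m (γ t)) (gateCoord γ τ ϑ m z)
  rw [norm_sub_rev] at h6
  rw [← gateCoord] at h3
  linarith

omit H in
theorem norm_lt_of_mem_leftDoor {n : ℕ} {z : ℂ} (hz : z ∈ leftDoor γ τ ϑ n) :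
    ‖gateCoord γ τ ϑ n z‖ < 2.4 ∧ 1.7 < ‖gateCoord γ τ ϑ n z‖ := by
  obtain ⟨⟨h1, h2⟩, h3, h4⟩ := hz
  refine ⟨?_, ?_⟩
  · rw [← sq_lt_sq₀ (norm_nonneg _) (by norm_num), Complex.sq_norm, Complex.normSq_apply]
    nlinarith
  · exact lt_of_lt_of_le (by linarith) ((neg_le_abs _).trans (Complex.abs_re_le_norm _))

omit H in
theorem norm_lt_of_mem_rightDoor {n : ℕ} {z : ℂ} (hz : z ∈ rightDoor γ τ ϑ n) :
    ‖gateCoord γ τ ϑ n z‖ < 2.4 ∧ 1.7 < ‖gateCoord γ τ ϑ n z‖ := by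
  obtain ⟨⟨h1, h2⟩, h3, h4⟩ := hz
  refine ⟨?_, ?_⟩
  · rw [← sq_lt_sq₀ (norm_nonneg _) (by norm_num), Complex.sq_norm, Complex.normSq_apply]
    nlinarith
  · exact lt_of_lt_of_le h1 ((le_abs_self _).trans (Complex.abs_re_le_norm _))

theorem room_left {n : ℕ} {z : ℂ} (hz : z ∈ gateRoom γ τ θ ϑ η n) :
    1.49 ≤ ‖gateCoord γ τ ϑ n z‖ ∧
      ((gateCoord γ τ ϑ n z).re < 0 ∨ 2.6 ≤ ‖gateCoord γ τ ϑ n z‖) := by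
  rcases hz with (hz | hz) | ⟨k, rfl, hz⟩
  · have := H.tube_left hz
    exact ⟨this.1, this.2.imp_right fun h => by linarith⟩
  · exact ⟨by linarith [(norm_lt_of_mem_leftDoor hz).2], Or.inl (by linarith [hz.1.2])⟩
  · have := H.le_norm_gateCoord_of_ne (m := k + 1) (by omega) (norm_lt_of_mem_rightDoor hz).1.le
    exact ⟨by linarith, Or.inr this⟩

theorem room_right {n : ℕ} {z : ℂ} (hz : z ∈ gateRoom γ τ θ ϑ η (n + 1)) :
    1.49 ≤ ‖gateCoord γ τ ϑ n z‖ ∧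
      (0 < (gateCoord γ τ ϑ n z).re ∨ 2.6 ≤ ‖gateCoord γ τ ϑ n z‖) := by
  rcases hz with (hz | hz) | ⟨k, hk, hz⟩
  · have := H.tube_right hz
    exact ⟨this.1, this.2.imp_right fun h => by linarith⟩
  · have := H.le_norm_gateCoord_of_ne (m := n) (by omega) (norm_lt_of_mem_leftDoor hz).1.le
    exact ⟨by linarith, Or.inr this⟩
  · obtain rfl : n = k := by omega
    exact ⟨by linarith [(norm_lt_of_mem_rightDoor hz).2], Or.inl (by linarith [hz.1.1])⟩

theorem room_far {m n : ℕ} (h1 : m ≠ n) (h2 : n ≠ m + 1) {z : ℂ}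
    (hz : z ∈ gateRoom γ τ θ ϑ η n) : 2.6 ≤ ‖gateCoord γ τ ϑ m z‖ := by
  rcases hz with (hz | hz) | ⟨k, hk, hz⟩
  · linarith [H.tube_far h1 h2 hz]
  · exact H.le_norm_gateCoord_of_ne h1 (norm_lt_of_mem_leftDoor hz).1.le
  · exact H.le_norm_gateCoord_of_ne (by omega) (norm_lt_of_mem_rightDoor hz).1.le

theorem le_norm_of_mem_room (m : ℕ) {n : ℕ} {z : ℂ} (hz : z ∈ gateRoom γ τ θ ϑ η n) :
    1.49 ≤ ‖gateCoord γ τ ϑ m z‖ := by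
  by_cases h1 : m = n
  · exact (H.room_left (h1 ▸ hz)).1
  · by_cases h2 : n = m + 1
    · exact (H.room_right (h2 ▸ hz)).1
    · linarith [H.room_far h1 h2 hz]

theorem disjoint_room {i j : ℕ} (hij : i < j) :
    Disjoint (gateRoom γ τ θ ϑ η i) (gateRoom γ τ θ ϑ η j) := by
  rw [disjoint_left]
  intro z hi hj
  have hi' := hi
  rcases hi with (hi | hi) | ⟨k, rfl, hi⟩
  · rcases hj with (hj | hj) | ⟨k, rfl, hj⟩
    · obtain ⟨t, ht, -, h⟩ := H.exists_of_mem_gateTube hi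
      obtain ⟨s, hs, -, h'⟩ := H.exists_of_mem_gateTube hj
      have ht0 := (H.gateStart_nonneg i).trans ht.1
      have hs0 := (H.gateStart_nonneg j).trans hs.1
      have h1 := H.le_gatePrev hij
      have h2 := H.gatePrev_lt_gateStart j
      have h3 := h s hs0 fun h4 => by linarith [h4.2, hs.1]
      have h4 := h' t ht0 fun h5 => by linarith [h5.1, ht.2, H.pos i]
      have h5 := norm_sub_le_norm_sub_add_norm_sub (γ t) z (γ s)
      rw [norm_sub_rev (γ t) z] at h5
      rw [norm_sub_rev (γ s)] at h4
      linarith [norm_nonneg (z - γ t), norm_nonneg (z - γ s)]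
    · linarith [H.room_far (m := j) (by omega) (by omega) hi', (norm_lt_of_mem_leftDoor hj).1]
    · by_cases h : i = k
      · rcases (H.room_left (h ▸ hi')).2 with h1 | h1
        · linarith [hj.1.1]
        · linarith [(norm_lt_of_mem_rightDoor hj).1]
      · linarith [H.room_far (m := k) (by omega) (by omega) hi', (norm_lt_of_mem_rightDoor hj).1]
  · by_cases h : j = i + 1
    · rcases (H.room_right (h ▸ hj)).2 with h1 | h1
      · linarith [hi.1.2]
      · linarith [(norm_lt_of_mem_leftDoor hi).1]
    · linarith [H.room_far (m := i) (by omega) h hj, (norm_lt_of_mem_leftDoor hi).1]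
  · linarith [H.room_far (m := k) (by omega) (by omega) hj, (norm_lt_of_mem_rightDoor hi).1]

theorem mem_Ioo_of_mem_room {n : ℕ} {t : ℝ} (ht : 0 ≤ t) (h : γ t ∈ gateRoom γ τ θ ϑ η n) :
    t ∈ Ioo (gatePrev τ n) (τ n) := by
  rcases h with (h | h) | ⟨k, rfl, h⟩
  · obtain ⟨s, hs, -, h'⟩ := H.exists_of_mem_gateTube h
    by_contra hcon
    have := h' t ht hcon
    rw [norm_sub_rev] at this
    linarith [norm_nonneg (γ s - γ t)]
  · have h1 := H.abs_sub_lt_of_norm_lt ht (by linarith [(norm_lt_of_mem_leftDoor h).1])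
    have h2 := abs_le.1 (H.re_gateCoord_mem h1.le)
    have h3 := H.le n
    have h4 := H.gatePrev_add_one_le n
    refine ⟨by linarith [(abs_lt.1 h1).1], ?_⟩
    by_contra! hcon
    have h5 : 0 ≤ (t - τ n) / θ n := div_nonneg (by linarith) (H.pos n).le
    rw [abs_of_nonneg h5] at h2
    linarith [h.1.2]
  · have h1 := H.abs_sub_lt_of_norm_lt ht (by linarith [(norm_lt_of_mem_rightDoor h).1])
    have h2 := abs_le.1 (H.re_gateCoord_mem h1.le)
    have h3 := H.le k
    have h4 := H.succ k
    refine ⟨?_, by linarith [(abs_lt.1 h1).2]⟩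
    simp only [gatePrev]
    by_contra! hcon
    have h5 : (t - τ k) / θ k ≤ 0 := div_nonpos_of_nonpos_of_nonneg (by linarith) (H.pos k).le
    rw [abs_of_nonpos h5] at h2
    linarith [h.1.1]

theorem gate_far {m n : ℕ} (h : m ≠ n) {r : ℝ} (hr : r ≤ 1 / 8) {z : ℂ}
    (hz : z ∈ chainGate γ τ ϑ n r) : 2.6 ≤ ‖gateCoord γ τ ϑ m z‖ :=
  H.le_norm_gateCoord_of_ne h (by linarith [norm_lt_of_mem_gateSet hr hz])

omit H in
theorem isOpen_gateRoom (n : ℕ) : IsOpen (gateRoom γ τ θ ϑ η n) := by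
  have hre : ∀ a b : ℝ, IsOpen {w : ℂ | (a < w.re ∧ w.re < b) ∧ (-0.2 < w.im ∧ w.im < 0.2)} :=
    fun a b => ((isOpen_lt continuous_const Complex.continuous_re).inter
      (isOpen_lt Complex.continuous_re continuous_const)).inter
      ((isOpen_lt continuous_const Complex.continuous_im).inter
      (isOpen_lt Complex.continuous_im continuous_const))
  refine (isOpen_thickening.union
    ((hre _ _).preimage (continuous_gateCoord γ τ ϑ n))).union ?_
  have : {z | ∃ k, n = k + 1 ∧ z ∈ rightDoor γ τ ϑ k} =
      ⋃ k, ⋃ (_ : n = k + 1), rightDoor γ τ ϑ k := by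
    ext z; simp
  rw [this]
  exact isOpen_iUnion fun k => isOpen_iUnion fun _ =>
    (hre _ _).preimage (continuous_gateCoord γ τ ϑ k)

omit H in
theorem isOpen_chainGate (n : ℕ) (r : ℝ) : IsOpen (chainGate γ τ ϑ n r) :=
  (isOpen_gateSet r).preimage (continuous_gateCoord γ τ ϑ n)

/-- Close to the gate the curve runs inside the gate. -/
theorem curve_mem_chainGate {n : ℕ} {r : ℝ} (hr : 0 < r) {t : ℝ}
    (ht : |t - τ n| ≤ 1.8 * θ n) : γ t ∈ chainGate γ τ ϑ n r := by
  have hθ := H.pos n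
  have h6 : |t - τ n| ≤ 6 * θ n := by linarith
  have h1 := H.re_gateCoord_mem h6
  have h2 := H.abs_im_gateCoord_le h6
  have h3 : |(t - τ n) / θ n| ≤ 1.8 := by
    rw [abs_div, abs_of_pos hθ, div_le_iff₀ hθ]; exact ht
  have h4 : |(gateCoord γ τ ϑ n (γ t)).re| ≤ 1.9 := by
    have := abs_sub_abs_le_abs_sub (gateCoord γ τ ϑ n (γ t)).re ((t - τ n) / θ n)
    linarith
  change gateCoord γ τ ϑ n (γ t) ∈ gateSet r
  set w := gateCoord γ τ ϑ n (γ t)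
  have h5 : ‖w‖ ^ 2 ≤ 1.01 * |w.re| ^ 2 := by
    rw [Complex.sq_norm, Complex.normSq_apply, ← abs_mul_abs_self w.im, ← abs_mul_abs_self w.re]
    have := mul_self_le_mul_self (abs_nonneg _) h2
    nlinarith [sq_nonneg |w.re|]
  rcases lt_trichotomy w.re 0 with h | h | h
  · refine Or.inl (Or.inl (mem_ball_neg_one_one_iff.2 ?_))
    rw [abs_of_neg h] at h4 h5
    nlinarith
  · refine Or.inl (Or.inr ?_)
    rw [h, abs_zero] at h5
    have : ‖w‖ ^ 2 ≤ 0 := by linarith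
    rw [mem_ball_zero_iff, pow_eq_zero_iff (two_ne_zero) |>.1 (le_antisymm this (sq_nonneg _))]
    exact hr
  · refine Or.inr (mem_ball_one_one_iff.2 ?_)
    rw [abs_of_pos h] at h4 h5
    nlinarith

theorem exists_gateStart_le {t : ℝ} (ht : 0 ≤ t) :
    ∃ n, gateStart τ θ n ≤ t ∧ t < gateStart τ θ (n + 1) := by
  have hex : ∃ n, t < gateStart τ θ (n + 1) := by
    obtain ⟨n, hn⟩ := (H.tendsto.eventually_gt_atTop t).exists
    exact ⟨n, by simp only [gateStart]; linarith [H.pos n]⟩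
  classical
  refine ⟨Nat.find hex, ?_, Nat.find_spec hex⟩
  rcases h : Nat.find hex with _ | k
  · exact ht
  · exact not_lt.1 (Nat.find_min hex (m := k) (by omega))

/-- The rooms and the gates cover the curve. -/
theorem curve_mem {n : ℕ} {r : ℝ} (hr : 0 < r) {t : ℝ} (h1 : gateStart τ θ n ≤ t)
    (h2 : t ≤ gateStart τ θ (n + 1)) :
    γ t ∈ gateRoom γ τ θ ϑ η n ∨ γ t ∈ chainGate γ τ ϑ n r := by
  simp only [gateStart] at h2
  rcases le_total t (τ n - 1.8 * θ n) with h | h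
  · exact Or.inl (Or.inl (Or.inl (self_subset_thickening (H.width_pos n) _ ⟨t, ⟨h1, h⟩, rfl⟩)))
  · exact Or.inr (H.curve_mem_chainGate hr (abs_le.2 ⟨by linarith, by linarith⟩))

end

end IsGateChain

/-- The part of the rooms and gates before the `n`-th gate. -/
def chainLeft (γ : ℝ → ℂ) (τ θ : ℕ → ℝ) (ϑ : ℕ → ℂ) (η : ℕ → ℝ) (n : ℕ) : Set ℂ :=
  {z | (∃ k ≤ n, z ∈ gateRoom γ τ θ ϑ η k) ∨ ∃ k < n, z ∈ chainGate γ τ ϑ k (1 / 8)}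

/-- The part of the rooms and gates after the `n`-th gate. -/
def chainRight (γ : ℝ → ℂ) (τ θ : ℕ → ℝ) (ϑ : ℕ → ℂ) (η : ℕ → ℝ) (n : ℕ) : Set ℂ :=
  {z | (∃ k > n, z ∈ gateRoom γ τ θ ϑ η k) ∨ ∃ k > n, z ∈ chainGate γ τ ϑ k (1 / 8)}

/-- The union of all rooms and gates, the `n`-th gate having an opening of radius `r n`. -/
def chainUnion (γ : ℝ → ℂ) (τ θ : ℕ → ℝ) (ϑ : ℕ → ℂ) (η : ℕ → ℝ) (r : ℕ → ℝ) : Set ℂ :=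
  {z | ∃ k, z ∈ gateRoom γ τ θ ϑ η k ∨ z ∈ chainGate γ τ ϑ k (r k)}

/-- The `n + 1`-st room together with the adjacent halves of its two gates. -/
def chainSuite (γ : ℝ → ℂ) (τ θ : ℕ → ℝ) (ϑ : ℕ → ℂ) (η : ℕ → ℝ) (n : ℕ) : Set ℂ :=
  gateRoom γ τ θ ϑ η (n + 1) ∪ gateCoord γ τ ϑ n ⁻¹' ball 1 1 ∪
    gateCoord γ τ ϑ (n + 1) ⁻¹' ball (-1) 1

theorem gateSet_mono {r s : ℝ} (h : r ≤ s) : gateSet r ⊆ gateSet s :=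
  union_subset_union_left _ (union_subset_union_right _ (ball_subset_ball h))

theorem isPreconnected_gateSet {r : ℝ} (hr : 0 < r) : IsPreconnected (gateSet r) := by
  have hmem : ∀ s : ℝ, 0 < s → s < r → s < 1 → (-s : ℂ) ∈ ball (-1 : ℂ) 1 ∧ (s : ℂ) ∈ ball 1 1 ∧
      (s : ℂ) ∈ ball 0 r ∧ (-s : ℂ) ∈ ball 0 r := fun s hs hsr hs1 => by
    have h1 : (s : ℂ) ∈ ball 1 1 := by
      rw [mem_ball, dist_eq_norm, ← Complex.ofReal_one, ← Complex.ofReal_sub, Complex.norm_real,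
        Real.norm_eq_abs, abs_lt]
      constructor <;> linarith
    refine ⟨?_, h1, ?_, ?_⟩
    · rw [mem_ball, dist_eq_norm] at h1 ⊢
      rwa [sub_neg_eq_add, neg_add_eq_sub, norm_sub_rev]
    · rw [mem_ball_zero_iff, Complex.norm_real, Real.norm_of_nonneg hs.le]; exact hsr
    · rw [mem_ball_zero_iff, norm_neg, Complex.norm_real, Real.norm_of_nonneg hs.le]; exact hsr
  have h := hmem (min r 1 / 2) (by positivity) (by linarith [min_le_left r 1])
    (by linarith [min_le_right r 1])
  refine IsPreconnected.union _ (Or.inr h.2.2.1) h.2.1 ?_ (convex_ball _ _).isPreconnected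
  exact IsPreconnected.union _ h.1 h.2.2.2 (convex_ball _ _).isPreconnected
    (convex_ball _ _).isPreconnected

/-- Vertical segments from a point of the gate to a nearly horizontal curve stay inside the gate
and its doors. -/
theorem segment_subset_gateSet {r : ℝ} (hr : 0 < r) (hr8 : r ≤ 1 / 8) {w y : ℂ}
    (hw : w ∈ gateSet r) (hre : y.re = w.re) (him : |y.im| ≤ 0.053 * |y.re|) {v : ℂ}
    (hv : v ∈ segment ℝ w y) : v ∈ gateSet r ∨
      ((-2.3 < v.re ∧ v.re < -1.7) ∧ (-0.2 < v.im ∧ v.im < 0.2)) ∨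
      ((1.7 < v.re ∧ v.re < 2.3) ∧ (-0.2 < v.im ∧ v.im < 0.2)) := by
  obtain ⟨a, b, ha, hb, hab, rfl⟩ := hv
  set v := a • w + b • y with hv
  have hvre : v.re = w.re := by
    simp only [hv, Complex.add_re, Complex.smul_re, hre, smul_eq_mul]
    rw [← add_mul, hab, one_mul]
  have hvim : |v.im| ≤ max |w.im| |y.im| := by
    have h1 : v.im = a * w.im + b * y.im := by simp [hv]
    rw [h1]
    calc |a * w.im + b * y.im| ≤ |a * w.im| + |b * y.im| := abs_add_le _ _
      _ = a * |w.im| + b * |y.im| := by rw [abs_mul, abs_mul, abs_of_nonneg ha, abs_of_nonneg hb]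
      _ ≤ a * max |w.im| |y.im| + b * max |w.im| |y.im| := by
        gcongr
        · exact le_max_left _ _
        · exact le_max_right _ _
      _ = max |w.im| |y.im| := by rw [← add_mul, hab, one_mul]
  rcases le_total |y.im| |w.im| with h | h
  · rw [max_eq_left h] at hvim
    left
    have h1 : ‖v‖ ^ 2 ≤ ‖w‖ ^ 2 := by
      rw [Complex.sq_norm, Complex.sq_norm, Complex.normSq_apply, Complex.normSq_apply, hvre,
        ← abs_mul_abs_self v.im, ← abs_mul_abs_self w.im]
      nlinarith [abs_nonneg v.im]
    rcases hw with (hw | hw) | hw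
    · rw [mem_ball_neg_one_one_iff] at hw
      exact Or.inl (Or.inl (mem_ball_neg_one_one_iff.2 (by rw [hvre]; linarith)))
    · rw [mem_ball_zero_iff] at hw
      exact Or.inl (Or.inr (mem_ball_zero_iff.2
        ((abs_le_of_sq_le_sq' h1 (norm_nonneg _)).2.trans_lt hw)))
    · rw [mem_ball_one_one_iff] at hw
      exact Or.inr (mem_ball_one_one_iff.2 (by rw [hvre]; linarith))
  · rw [max_eq_right h] at hvim
    have h1 : |v.im| ≤ 0.053 * |v.re| := by rw [hvre, ← hre]; exact hvim.trans him
    have h2 : |v.re| < 2 := by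
      rw [hvre]
      exact (Complex.abs_re_le_norm w).trans_lt (norm_lt_of_mem_gateSet hr8 hw)
    have h3 : ‖v‖ ^ 2 ≤ 1.003 * |v.re| ^ 2 := by
      rw [Complex.sq_norm, Complex.normSq_apply, ← abs_mul_abs_self v.im, ← abs_mul_abs_self v.re]
      have := mul_self_le_mul_self (abs_nonneg _) h1
      nlinarith [sq_nonneg |v.re|]
    have h4 := abs_le.1 h1
    rcases lt_trichotomy v.re 0 with h0 | h0 | h0
    · rw [abs_of_neg h0] at h1 h2 h3 h4
      rcases le_total (-1.9) v.re with h5 | h5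
      · exact Or.inl (Or.inl (Or.inl (mem_ball_neg_one_one_iff.2 (by nlinarith))))
      · exact Or.inr (Or.inl ⟨⟨by linarith, by linarith⟩, by linarith, by linarith⟩)
    · refine Or.inl (Or.inl (Or.inr ?_))
      rw [h0, abs_zero] at h3
      have : ‖v‖ ^ 2 ≤ 0 := by linarith
      rw [mem_ball_zero_iff, pow_eq_zero_iff (two_ne_zero) |>.1 (le_antisymm this (sq_nonneg _))]
      exact hr
    · rw [abs_of_pos h0] at h1 h2 h3 h4
      rcases le_total v.re 1.9 with h5 | h5
      · exact Or.inl (Or.inr (mem_ball_one_one_iff.2 (by nlinarith)))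
      · exact Or.inr (Or.inr ⟨⟨by linarith, by linarith⟩, by linarith, by linarith⟩)

namespace IsGateChain

variable {γ : ℝ → ℂ} {τ θ : ℕ → ℝ} {ϑ : ℕ → ℂ} {η : ℕ → ℝ} {r : ℕ → ℝ}
  (H : IsGateChain γ τ θ ϑ η)

theorem isOpen_chainUnion (r : ℕ → ℝ) : IsOpen (chainUnion γ τ θ ϑ η r) := by
  have : chainUnion γ τ θ ϑ η r = ⋃ k, (gateRoom γ τ θ ϑ η k ∪ chainGate γ τ ϑ k (r k)) := by
    ext z; simp [chainUnion]
  rw [this]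
  exact isOpen_iUnion fun k => (isOpen_gateRoom k).union (isOpen_chainGate k _)

theorem isOpen_chainSuite (n : ℕ) : IsOpen (chainSuite γ τ θ ϑ η n) :=
  ((isOpen_gateRoom _).union (isOpen_ball.preimage (continuous_gateCoord γ τ ϑ n))).union
    (isOpen_ball.preimage (continuous_gateCoord γ τ ϑ (n + 1)))

theorem isOpen_chainLeft (n : ℕ) : IsOpen (chainLeft γ τ θ ϑ η n) := by
  have : chainLeft γ τ θ ϑ η n = (⋃ k ∈ {k | k ≤ n}, gateRoom γ τ θ ϑ η k) ∪
      ⋃ k ∈ {k | k < n}, chainGate γ τ ϑ k (1 / 8) := by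
    ext z; simp [chainLeft]
  rw [this]
  exact (isOpen_biUnion fun k _ => isOpen_gateRoom k).union
    (isOpen_biUnion fun k _ => isOpen_chainGate k _)

theorem isOpen_chainRight (n : ℕ) : IsOpen (chainRight γ τ θ ϑ η n) := by
  have : chainRight γ τ θ ϑ η n = (⋃ k ∈ {k | k > n}, gateRoom γ τ θ ϑ η k) ∪
      ⋃ k ∈ {k | k > n}, chainGate γ τ ϑ k (1 / 8) := by
    ext z; simp [chainRight]
  rw [this]
  exact (isOpen_biUnion fun k _ => isOpen_gateRoom k).union
    (isOpen_biUnion fun k _ => isOpen_chainGate k _)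

theorem chainUnion_mono {s : ℕ → ℝ} (h : ∀ n, r n ≤ s n) :
    chainUnion γ τ θ ϑ η r ⊆ chainUnion γ τ θ ϑ η s := by
  rintro z ⟨k, hz⟩
  exact ⟨k, hz.imp_right fun hz => gateSet_mono (h k) hz⟩

theorem chainSuite_subset (r : ℕ → ℝ) (n : ℕ) :
    chainSuite γ τ θ ϑ η n ⊆ chainUnion γ τ θ ϑ η r := by
  rintro z ((hz | hz) | hz)
  · exact ⟨n + 1, Or.inl hz⟩
  · exact ⟨n, Or.inr (Or.inr hz)⟩
  · exact ⟨n + 1, Or.inr (Or.inl (Or.inl hz))⟩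

section
include H

theorem disjoint_chainLeft_chainRight (n : ℕ) :
    Disjoint (chainLeft γ τ θ ϑ η n) (chainRight γ τ θ ϑ η n) := by
  rw [disjoint_left]
  rintro z (⟨i, hi, hz⟩ | ⟨i, hi, hz⟩) (⟨j, hj, hz'⟩ | ⟨j, hj, hz'⟩)
  · exact disjoint_left.1 (H.disjoint_room (show i < j by omega)) hz hz'
  · linarith [H.room_far (m := j) (by omega) (by omega) hz, norm_lt_of_mem_gateSet le_rfl hz']
  · linarith [H.room_far (m := i) (by omega) (by omega) hz', norm_lt_of_mem_gateSet le_rfl hz]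
  · linarith [H.gate_far (m := i) (by omega) le_rfl hz', norm_lt_of_mem_gateSet le_rfl hz]

theorem isGate (hr : ∀ n, 0 < r n) (hr8 : ∀ n, r n ≤ 1 / 8) {V : Set ℂ} (hV : IsOpen V)
    (hVU : V ⊆ chainUnion γ τ θ ϑ η r) (n : ℕ) (hn : chainGate γ τ ϑ n (r n) ⊆ V) :
    IsGate {w | γ (τ n) + ϑ n * w ∈ V} {w | γ (τ n) + ϑ n * w ∈ chainLeft γ τ θ ϑ η n}
      {w | γ (τ n) + ϑ n * w ∈ chainRight γ τ θ ϑ η n} (r n) := by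
  have hc : Continuous fun w => γ (τ n) + ϑ n * w := by fun_prop
  have hb : ∀ {w σ : ℂ}, ‖σ‖ = 1 → w ∈ ball σ 1 → ‖w‖ < 2 := fun {w σ} hσ hw => by
    rw [mem_ball, dist_eq_norm] at hw
    linarith [norm_le_norm_add_norm_sub' w σ]
  refine ⟨hr n, hr8 n, hV.preimage hc, (isOpen_chainLeft n).preimage hc,
    (isOpen_chainRight n).preimage hc, fun w hw => hn ?_, fun w hw => ?_, ?_, ?_, ?_,
    fun w hw => ?_, fun w hw => ?_⟩
  · change gateCoord γ τ ϑ n (γ (τ n) + ϑ n * w) ∈ gateSet (r n)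
    rwa [H.gateCoord_add_mul]
  · obtain ⟨k, hk | hk⟩ := hVU hw
    · rcases le_or_gt k n with h | h
      · exact Or.inl (Or.inl (Or.inl ⟨k, h, hk⟩))
      · exact Or.inr (Or.inl ⟨k, h, hk⟩)
    · rcases lt_trichotomy k n with h | rfl | h
      · exact Or.inl (Or.inl (Or.inr ⟨k, h, gateSet_mono (hr8 k) hk⟩))
      · change gateCoord γ τ ϑ k (γ (τ k) + ϑ k * w) ∈ gateSet (r k) at hk
        rw [H.gateCoord_add_mul] at hk
        exact Or.inl (Or.inr hk)
      · exact Or.inr (Or.inr ⟨k, h, gateSet_mono (hr8 k) hk⟩)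
  · exact (H.disjoint_chainLeft_chainRight n).preimage _
  · rw [disjoint_left]
    intro w hw hw1
    have h2 := hb (by simp) hw1
    rw [← H.gateCoord_add_mul n w] at h2 hw1
    rcases hw with ⟨k, hk, hw⟩ | ⟨k, hk, hw⟩
    · rcases hk.eq_or_lt with rfl | hk
      · rcases (H.room_left hw).2 with h | h
        · rw [mem_ball_one_one_iff] at hw1
          nlinarith [sq_nonneg ‖gateCoord γ τ ϑ k (γ (τ k) + ϑ k * w)‖]
        · linarith
      · linarith [H.room_far (m := n) (by omega) (by omega) hw]
    · linarith [H.gate_far (m := n) (by omega) le_rfl hw]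
  · rw [disjoint_left]
    intro w hw hw1
    have h2 := hb (by simp) hw1
    rw [← H.gateCoord_add_mul n w] at h2 hw1
    rcases hw with ⟨k, hk, hw⟩ | ⟨k, hk, hw⟩
    · by_cases h : k = n + 1
      · subst h
        rcases (H.room_right hw).2 with h | h
        · rw [mem_ball_neg_one_one_iff] at hw1
          nlinarith [sq_nonneg ‖gateCoord γ τ ϑ n (γ (τ n) + ϑ n * w)‖]
        · linarith
      · linarith [H.room_far (m := n) (by omega) h hw]
    · linarith [H.gate_far (m := n) (by omega) le_rfl hw]
  · rw [← H.gateCoord_add_mul n w]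
    rcases hw with ⟨k, hk, hw⟩ | ⟨k, hk, hw⟩
    · linarith [H.le_norm_of_mem_room n hw]
    · linarith [H.gate_far (m := n) (by omega) le_rfl hw]
  · rw [← H.gateCoord_add_mul n w]
    rcases hw with ⟨k, hk, hw⟩ | ⟨k, hk, hw⟩
    · linarith [H.le_norm_of_mem_room n hw]
    · linarith [H.gate_far (m := n) (by omega) le_rfl hw]

theorem isBounded_chainLeft (n : ℕ) : Bornology.IsBounded (chainLeft γ τ θ ϑ η n) := by
  have hco : ∀ (k : ℕ) (s : Set ℂ), (∀ z ∈ s, ‖gateCoord γ τ ϑ k z‖ < 2.4) →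
      Bornology.IsBounded s := fun k s hs => by
    refine (isBounded_ball (x := γ (τ k)) (r := 2.4 * ‖ϑ k‖)).subset fun z hz => ?_
    rw [mem_ball, dist_eq_norm, ← H.norm_gateCoord_mul]
    exact mul_lt_mul_of_pos_right (hs z hz) (H.norm_pos k)
  have hroom : ∀ k, Bornology.IsBounded (gateRoom γ τ θ ϑ η k) := fun k => by
    refine (Bornology.IsBounded.union ?_ (hco k _ fun z hz => (norm_lt_of_mem_leftDoor hz).1)).union
      ?_
    · exact (isCompact_Icc.image H.cont).isBounded.thickening
    · exact hco (k - 1) _ fun z ⟨i, hi, hz⟩ => by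
        obtain rfl : i = k - 1 := by omega
        exact (norm_lt_of_mem_rightDoor hz).1
  have : chainLeft γ τ θ ϑ η n = (⋃ k ∈ Iic n, gateRoom γ τ θ ϑ η k) ∪
      ⋃ k ∈ Iio n, chainGate γ τ ϑ k (1 / 8) := by
    ext z; simp [chainLeft]
  rw [this]
  refine Bornology.IsBounded.union ?_ ?_
  · exact (Bornology.isBounded_biUnion (finite_Iic n)).2 fun k _ => hroom k
  · exact (Bornology.isBounded_biUnion (finite_Iio n)).2 fun k _ => hco k _ fun z hz =>
      (norm_lt_of_mem_gateSet le_rfl hz).trans (by norm_num)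

omit H in
theorem gateCoord_center (n : ℕ) : gateCoord γ τ ϑ n (γ (τ n)) = 0 := by
  simp [gateCoord]

theorem center_notMem_room (m n : ℕ) : γ (τ m) ∉ gateRoom γ τ θ ϑ η n := fun h => by
  have := H.le_norm_of_mem_room m h
  rw [gateCoord_center, norm_zero] at this
  linarith

theorem le_norm_gateCoord_center {m n : ℕ} (h : m ≠ n) :
    5 ≤ ‖gateCoord γ τ ϑ m (γ (τ n))‖ := by
  rw [gateCoord, norm_div, le_div_iff₀ (H.norm_pos m)]
  exact H.far_of_ne h

theorem center_notMem_suite (m n : ℕ) : γ (τ m) ∉ chainSuite γ τ θ ϑ η n := by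
  have hball : ∀ (k : ℕ) (σ : ℂ), ‖σ‖ = 1 → gateCoord γ τ ϑ k (γ (τ m)) ∉ ball σ 1 := by
    intro k σ hσ h
    rw [mem_ball, dist_eq_norm] at h
    by_cases hk : k = m
    · subst hk
      rw [gateCoord_center, zero_sub, norm_neg] at h
      linarith
    · linarith [H.le_norm_gateCoord_center hk,
        norm_le_norm_add_norm_sub' (gateCoord γ τ ϑ k (γ (τ m))) σ]
  rintro ((h | h) | h)
  · exact H.center_notMem_room _ _ h
  · exact hball _ _ (by simp) h
  · exact hball _ _ (by simp) h

theorem eq_of_center_mem_gate {m n : ℕ} {s : ℝ} (hs : s ≤ 1 / 8)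
    (h : γ (τ m) ∈ chainGate γ τ ϑ n s) : m = n := by
  by_contra hne
  linarith [H.le_norm_gateCoord_center (Ne.symm hne), norm_lt_of_mem_gateSet hs h]

theorem disjoint_chainUnion_ball (hr8 : ∀ n, r n ≤ 1 / 8) :
    Disjoint (chainUnion γ τ θ ϑ η r)
      (ball (γ (τ 0) + ϑ 0 * (Complex.I / 2)) (0.05 * ‖ϑ 0‖)) := by
  rw [disjoint_left]
  rintro z hz hzb
  have h1 : ‖gateCoord γ τ ϑ 0 z - Complex.I / 2‖ < 0.05 := by
    have h2 : gateCoord γ τ ϑ 0 z - Complex.I / 2 =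
        (z - (γ (τ 0) + ϑ 0 * (Complex.I / 2))) / ϑ 0 := by
      rw [gateCoord, ← sub_sub, sub_div (z - γ (τ 0)), mul_div_cancel_left₀ _ (H.ne 0)]
    rw [h2, norm_div, div_lt_iff₀ (H.norm_pos 0), ← dist_eq_norm]
    exact hzb
  have h3 : ‖(Complex.I / 2 : ℂ)‖ = 1 / 2 := by simp
  have h4 := norm_le_norm_add_norm_sub' (gateCoord γ τ ϑ 0 z) (Complex.I / 2)
  have hre := (Complex.abs_re_le_norm _).trans_lt h1
  have him := (Complex.abs_im_le_norm _).trans_lt h1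
  simp at hre him
  obtain ⟨k, hk | hk⟩ := hz
  · linarith [H.le_norm_of_mem_room 0 hk]
  · rcases Nat.eq_zero_or_pos k with rfl | hk0
    · have h5 := Complex.sq_norm (gateCoord γ τ ϑ 0 z)
      rw [Complex.normSq_apply] at h5
      rw [abs_lt] at hre him
      rcases hk with (hk | hk) | hk
      · have := mem_ball_neg_one_one_iff.1 hk
        nlinarith
      · have hk' := mem_ball_zero_iff.1 hk
        have := hr8 0
        nlinarith [norm_nonneg (gateCoord γ τ ϑ 0 z)]
      · have := mem_ball_one_one_iff.1 hk
        nlinarith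
    · linarith [H.gate_far (m := 0) (by omega) (hr8 k) hk]

end

end IsGateChain

namespace IsGateChain

variable {γ : ℝ → ℂ} {τ θ : ℕ → ℝ} {ϑ : ℕ → ℂ} {η : ℕ → ℝ} (H : IsGateChain γ τ θ ϑ η)

section
include H

theorem strictMonoOn_re_Icc (n : ℕ) : StrictMonoOn (fun t => (gateCoord γ τ ϑ n (γ t)).re)
    (Icc (τ n - 6 * θ n) (τ n + 6 * θ n)) :=
  (H.strictMonoOn_re n).mono fun t ht =>
    show |t - τ n| ≤ 6 * θ n from abs_le.2 ⟨by linarith [ht.1], by linarith [ht.2]⟩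

theorem continuous_re_gateCoord (n : ℕ) : Continuous fun t => (gateCoord γ τ ϑ n (γ t)).re :=
  Complex.continuous_re.comp ((continuous_gateCoord γ τ ϑ n).comp H.cont)

theorem Icc_subset_image_re (n : ℕ) : Icc (-5 : ℝ) 5 ⊆
    (fun t => (gateCoord γ τ ϑ n (γ t)).re) '' Icc (τ n - 6 * θ n) (τ n + 6 * θ n) := by
  have hθ := H.pos n
  refine Subset.trans ?_
    (intermediate_value_Icc (by linarith) (H.continuous_re_gateCoord n).continuousOn)
  have h1 := H.re_gateCoord_mem (n := n) (t := τ n - 6 * θ n)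
    (by rw [sub_sub_cancel_left, abs_neg, abs_of_pos (by linarith)])
  have h2 := H.re_gateCoord_mem (n := n) (t := τ n + 6 * θ n)
    (by rw [add_sub_cancel_left, abs_of_pos (by linarith)])
  rw [sub_sub_cancel_left, neg_div, mul_div_cancel_right₀ _ hθ.ne', abs_neg,
    abs_of_pos (by norm_num : (0 : ℝ) < 6), abs_le] at h1
  rw [add_sub_cancel_left, mul_div_cancel_right₀ _ hθ.ne',
    abs_of_pos (by norm_num : (0 : ℝ) < 6), abs_le] at h2
  exact Icc_subset_Icc (by linarith [h1.2]) (by linarith [h2.1])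

/-- A continuous choice of a parameter for each point near the curve; inside the gates it is given
by the vertical projection. -/
theorem exists_parameter : ∃ κ : ℂ → ℝ, ContinuousOn κ (chainUnion γ τ θ ϑ η fun _ => 1 / 8) ∧
    (∀ t, 0 ≤ t → κ (γ t) = t) ∧ ∀ n, ∀ z ∈ chainGate γ τ ϑ n (1 / 8), |κ z - τ n| ≤ 6 * θ n ∧
      (gateCoord γ τ ϑ n (γ (κ z))).re = (gateCoord γ τ ϑ n z).re := by
  classical
  set Q : ℕ → Set ℂ := fun n => {z | ‖gateCoord γ τ ϑ n z‖ ≤ 2.05} with hQ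
  set I : ℕ → Set ℝ := fun n => Icc (τ n - 6 * θ n) (τ n + 6 * θ n) with hI
  set ρ : ℕ → ℝ → ℝ := fun n t => (gateCoord γ τ ϑ n (γ t)).re with hρ
  set A : ℕ → Set ℝ := fun n => Icc (max 0 (gatePrev τ n)) (τ n) with hA
  have huniq : ∀ {m n z}, z ∈ Q m → z ∈ Q n → m = n := fun {m n z} hm hn => by
    by_contra h
    have := H.le_norm_gateCoord_of_ne h (z := z) (le_trans hn (by norm_num))
    have hm' : ‖gateCoord γ τ ϑ m z‖ ≤ 2.05 := hm
    linarith
  have hQre : ∀ {n z}, z ∈ Q n → (gateCoord γ τ ϑ n z).re ∈ ρ n '' I n := fun {n z} hz => by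
    have := abs_le.1 ((Complex.abs_re_le_norm _).trans hz)
    exact H.Icc_subset_image_re n ⟨by linarith [this.1], by linarith [this.2]⟩
  set f : ℂ → ℝ := fun z => if h : ∃ n, z ∈ Q n then
    Function.invFunOn (ρ h.choose) (I h.choose) (gateCoord γ τ ϑ h.choose z).re
    else Function.invFunOn γ (Ici 0) z with hf
  have hfQ : ∀ {n z}, z ∈ Q n →
      f z = Function.invFunOn (ρ n) (I n) (gateCoord γ τ ϑ n z).re := fun {n z} hz => by
    have h : ∃ n, z ∈ Q n := ⟨n, hz⟩
    have h' : h.choose = n := huniq h.choose_spec hz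
    simp only [hf, dif_pos h]
    rw [h']
  have hfγ : ∀ t, 0 ≤ t → f (γ t) = t := fun t ht => by
    by_cases h : ∃ n, γ t ∈ Q n
    · obtain ⟨n, hn⟩ := h
      rw [hfQ hn]
      have h1 : |t - τ n| < 6 * θ n := H.abs_sub_lt_of_norm_lt ht (lt_of_le_of_lt hn (by norm_num))
      rw [abs_lt] at h1
      exact (H.strictMonoOn_re_Icc n).injOn.leftInvOn_invFunOn ⟨by linarith, by linarith⟩
    · simp only [hf, dif_neg h]
      exact H.inj.leftInvOn_invFunOn ht
  have hclQ : ∀ n, IsClosed (Q n) := fun n =>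
    isClosed_le (continuous_gateCoord γ τ ϑ n).norm continuous_const
  have hcpA : ∀ n, IsCompact (γ '' A n) := fun n => isCompact_Icc.image H.cont
  have hfc : ∀ n, ContinuousOn f (γ '' A n ∪ Q n) := fun n => by
    refine ContinuousOn.union_of_isClosed ?_ ?_ (hcpA n).isClosed (hclQ n)
    · have hsub : A n ⊆ Ici 0 := fun t ht => (le_max_left _ _).trans ht.1
      refine (IsCompact.continuousOn_invFunOn_image isCompact_Icc H.cont.continuousOn
        (H.inj.mono hsub)).congr ?_
      rintro _ ⟨t, ht, rfl⟩
      rw [hfγ t (hsub ht)]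
      exact ((H.inj.mono hsub).leftInvOn_invFunOn ht).symm
    · refine ContinuousOn.congr ?_ fun z hz => hfQ hz
      exact (IsCompact.continuousOn_invFunOn_image isCompact_Icc
        (H.continuous_re_gateCoord n).continuousOn (H.strictMonoOn_re_Icc n).injOn).comp
        (Complex.continuous_re.comp (continuous_gateCoord γ τ ϑ n)).continuousOn fun z hz => hQre hz
  obtain ⟨κ, hκ, hκf⟩ := exists_continuousOn_extension_of_locallyFinite
    (U := chainUnion γ τ θ ϑ η fun _ => 1 / 8) (fun n => (hcpA n).isClosed.union (hclQ n)) (by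
      rintro z ⟨k, hk | hk⟩
      · refine ⟨_, isOpen_gateRoom k, hk, (finite_Iic k).subset ?_⟩
        rintro n ⟨x, ⟨t, ht, rfl⟩ | hx, hxO⟩
        · have h0 : 0 ≤ t := (le_max_left _ _).trans ht.1
          by_contra hn
          have := H.le_gatePrev (not_le.1 hn)
          linarith [(H.mem_Ioo_of_mem_room h0 hxO).2, (le_max_right 0 (gatePrev τ n)).trans ht.1]
        · by_contra hn
          have hn' : k < n := not_le.1 hn
          have h1 := H.room_far (m := n) (by omega) (by omega) hxO
          have h2 : ‖gateCoord γ τ ϑ n x‖ ≤ 2.05 := hx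
          linarith
      · refine ⟨_, isOpen_chainGate k _, hk, (finite_Iic (k + 1)).subset ?_⟩
        rintro n ⟨x, ⟨t, ht, rfl⟩ | hx, hxO⟩
        · have h0 : 0 ≤ t := (le_max_left _ _).trans ht.1
          by_contra hn
          have h1 := H.le_gatePrev (not_le.1 hn)
          have h2 := H.abs_sub_lt_of_norm_lt h0
            ((norm_lt_of_mem_gateSet le_rfl hxO).trans (by norm_num))
          linarith [(abs_lt.1 h2).2, (le_max_right 0 (gatePrev τ n)).trans ht.1, H.succ k, H.le k]
        · by_contra hn
          have hn' : k + 1 < n := not_le.1 hn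
          have h1 := H.gate_far (m := n) (by omega) le_rfl hxO
          have h2 : ‖gateCoord γ τ ϑ n x‖ ≤ 2.05 := hx
          linarith) hfc
  have hγU : ∀ t, 0 ≤ t → γ t ∈ chainUnion γ τ θ ϑ η fun _ => 1 / 8 := fun t ht => by
    obtain ⟨n, h1, h2⟩ := H.exists_gateStart_le ht
    exact ⟨n, H.curve_mem (by norm_num) h1 h2.le⟩
  refine ⟨κ, hκ, fun t ht => ?_, fun n z hz => ?_⟩
  · have hex : ∃ n, t ∈ A n := by
      have hex : ∃ n, t ≤ τ n := (H.tendsto.eventually_ge_atTop t).exists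
      refine ⟨Nat.find hex, max_le ht ?_, Nat.find_spec hex⟩
      rcases hk : Nat.find hex with _ | k
      · simp only [gatePrev]; linarith
      · exact (not_le.1 (Nat.find_min hex (m := k) (by omega))).le
    obtain ⟨n, hn⟩ := hex
    rw [hκf n _ (hγU t ht) (Or.inl ⟨t, hn, rfl⟩), hfγ t ht]
  · have hzQ : z ∈ Q n := (norm_lt_of_mem_gateSet le_rfl hz).le.trans (by norm_num)
    rw [hκf n z ⟨n, Or.inr hz⟩ (Or.inr hzQ), hfQ hzQ]
    have h1 := Function.invFunOn_mem (hQre hzQ)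
    exact ⟨abs_le.2 ⟨by linarith [h1.1], by linarith [h1.2]⟩, Function.invFunOn_eq (hQre hzQ)⟩

end

end IsGateChain

theorem gateCoord_affine (γ : ℝ → ℂ) (τ : ℕ → ℝ) (ϑ : ℕ → ℂ) (n : ℕ) {a b : ℝ} (hab : a + b = 1)
    (x y : ℂ) : gateCoord γ τ ϑ n (a • x + b • y) =
      a • gateCoord γ τ ϑ n x + b • gateCoord γ τ ϑ n y := by
  have hab' : (a : ℂ) + b = 1 := by exact_mod_cast hab
  simp only [gateCoord, Complex.real_smul, mul_div_assoc']
  rw [← add_div]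
  congr 1
  linear_combination (γ (τ n)) * hab'

namespace IsGateChain

variable {γ : ℝ → ℂ} {τ θ : ℕ → ℝ} {ϑ : ℕ → ℂ} {η : ℕ → ℝ} {r : ℕ → ℝ}
  (H : IsGateChain γ τ θ ϑ η)

section
include H

theorem segment_subset {n : ℕ} (hr : 0 < r n) (hr8 : r n ≤ 1 / 8) {z : ℂ}
    (hz : z ∈ chainGate γ τ ϑ n (r n)) {t : ℝ} (ht : |t - τ n| ≤ 6 * θ n)
    (hre : (gateCoord γ τ ϑ n (γ t)).re = (gateCoord γ τ ϑ n z).re) :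
    segment ℝ z (γ t) ⊆ chainUnion γ τ θ ϑ η r := by
  rintro v ⟨a, b, ha, hb, hab, rfl⟩
  have hv : gateCoord γ τ ϑ n (a • z + b • γ t) ∈
      segment ℝ (gateCoord γ τ ϑ n z) (gateCoord γ τ ϑ n (γ t)) :=
    ⟨a, b, ha, hb, hab, (gateCoord_affine γ τ ϑ n hab z (γ t)).symm⟩
  rcases segment_subset_gateSet hr hr8 hz hre (H.abs_im_gateCoord_le ht) hv with h | h | h
  · exact ⟨n, Or.inr h⟩
  · exact ⟨n, Or.inl (Or.inl (Or.inr h))⟩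
  · exact ⟨n + 1, Or.inl (Or.inr ⟨n, rfl, h⟩)⟩

theorem isPreconnected_chainGate {n : ℕ} {s : ℝ} (hs : 0 < s) :
    IsPreconnected (chainGate γ τ ϑ n s) := by
  have : chainGate γ τ ϑ n s = (fun w => γ (τ n) + ϑ n * w) '' gateSet s := by
    ext z
    refine ⟨fun hz => ⟨_, hz, H.add_mul_gateCoord n z⟩, ?_⟩
    rintro ⟨w, hw, rfl⟩
    rw [chainGate, mem_preimage, H.gateCoord_add_mul]
    exact hw
  rw [this]
  exact (isPreconnected_gateSet hs).image _ (by fun_prop)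

theorem curve_mem_chainUnion (hr : ∀ n, 0 < r n) (t : ℝ) : γ t ∈ chainUnion γ τ θ ϑ η r := by
  have key : ∀ t, 0 ≤ t → γ t ∈ chainUnion γ τ θ ϑ η r := fun t ht => by
    obtain ⟨n, h1, h2⟩ := H.exists_gateStart_le ht
    exact ⟨n, H.curve_mem (hr n) h1 h2.le⟩
  rcases le_total 0 t with ht | ht
  · exact key t ht
  · rw [H.const t ht]
    exact key 0 le_rfl

theorem curve_mem_chainSuite {n : ℕ} {t : ℝ}
    (ht : t ∈ Icc (τ n + 0.4 * θ n) (τ (n + 1) - 0.4 * θ (n + 1))) :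
    γ t ∈ chainSuite γ τ θ ϑ η n := by
  have hθ := H.pos n
  have hθ' := H.pos (n + 1)
  rcases le_total t (τ n + 1.8 * θ n) with h1 | h1
  · refine Or.inl (Or.inr ?_)
    have h6 : |t - τ n| ≤ 6 * θ n := abs_le.2 ⟨by linarith [ht.1], by linarith⟩
    have h2 := H.re_gateCoord_mem h6
    have h3 := H.abs_im_gateCoord_le h6
    have h4 : 0.4 ≤ (t - τ n) / θ n := by rw [le_div_iff₀ hθ]; linarith [ht.1]
    have h5 : (t - τ n) / θ n ≤ 1.8 := by rw [div_le_iff₀ hθ]; linarith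
    rw [abs_of_nonneg (by linarith : 0 ≤ (t - τ n) / θ n), abs_le] at h2
    rw [abs_of_nonneg (by linarith : 0 ≤ (gateCoord γ τ ϑ n (γ t)).re)] at h3
    rw [mem_preimage, mem_ball_one_one_iff, Complex.sq_norm, Complex.normSq_apply,
      ← abs_mul_abs_self (gateCoord γ τ ϑ n (γ t)).im]
    have := mul_self_le_mul_self (abs_nonneg _) h3
    nlinarith
  rcases le_total t (τ (n + 1) - 1.8 * θ (n + 1)) with h2 | h2
  · exact Or.inl (Or.inl (Or.inl (Or.inl (self_subset_thickening (H.width_pos _) _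
      ⟨t, ⟨h1, h2⟩, rfl⟩))))
  · refine Or.inr ?_
    have h6 : |t - τ (n + 1)| ≤ 6 * θ (n + 1) := abs_le.2 ⟨by linarith, by linarith [ht.2]⟩
    have h7 := H.re_gateCoord_mem h6
    have h3 := H.abs_im_gateCoord_le h6
    have h4 : (t - τ (n + 1)) / θ (n + 1) ≤ -0.4 := by rw [div_le_iff₀ hθ']; linarith [ht.2]
    have h5 : -1.8 ≤ (t - τ (n + 1)) / θ (n + 1) := by rw [le_div_iff₀ hθ']; linarith
    rw [abs_of_nonpos (by linarith : (t - τ (n + 1)) / θ (n + 1) ≤ 0), abs_le] at h7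
    rw [abs_of_nonpos (by linarith : (gateCoord γ τ ϑ (n + 1) (γ t)).re ≤ 0)] at h3
    rw [mem_preimage, mem_ball_neg_one_one_iff, Complex.sq_norm, Complex.normSq_apply,
      ← abs_mul_abs_self (gateCoord γ τ ϑ (n + 1) (γ t)).im]
    have := mul_self_le_mul_self (abs_nonneg _) h3
    nlinarith

/-- The domains `U₁` in which the curve and the gates are contained and in which every point can
be connected to the curve by a segment in `chainUnion`, together with a Harnack constant for the
pieces of the curve between the gates that does not depend on the openings of the gates. -/
theorem exists_core : ∃ h : ℕ → ℝ, (∀ n, 0 < h n) ∧ ∀ r : ℕ → ℝ, (∀ n, 0 < r n) →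
    (∀ n, r n ≤ 1 / 8) → ∃ U₁, IsOpen U₁ ∧ IsConnected U₁ ∧ (∀ t, γ t ∈ U₁) ∧
      U₁ ⊆ chainUnion γ τ θ ϑ η r ∧ (∀ n, chainGate γ τ ϑ n (r n) ⊆ U₁) ∧
      (∀ a, a ∉ chainUnion γ τ θ ϑ η r →
        ∃ L : ℂ → ℂ, ContinuousOn L U₁ ∧ ∀ z ∈ U₁, Complex.exp (L z) = z - a) ∧
      ∀ V, U₁ ⊆ V → ∀ n N g, IsGreen V (γ (τ N)) g →
        ∀ s ∈ Icc (τ n + 0.4 * θ n) (τ (n + 1) - 0.4 * θ (n + 1)),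
        ∀ t ∈ Icc (τ n + 0.4 * θ n) (τ (n + 1) - 0.4 * θ (n + 1)), h n * g (γ s) ≤ g (γ t) := by
  obtain ⟨κ, hκ, hκγ, hκg⟩ := H.exists_parameter
  have hκγ' : ∀ t, γ (κ (γ t)) = γ t := fun t => by
    rcases le_total 0 t with ht | ht
    · rw [hκγ t ht]
    · rw [H.const t ht, hκγ 0 le_rfl]
  have hopen : ∀ A : Set ℂ, IsOpen A → (A ⊆ chainUnion γ τ θ ϑ η fun _ => 1 / 8) →
      IsOpen {z | z ∈ A ∧ segment ℝ z (γ (κ z)) ⊆ A} := fun A hA hsub =>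
    isOpen_segment_subset hA hA (H.cont.comp_continuousOn (hκ.mono hsub))
  have hcurve : ∀ {A : Set ℂ} {t}, γ t ∈ A → γ t ∈ {z | z ∈ A ∧ segment ℝ z (γ (κ z)) ⊆ A} :=
    fun {A t} h => ⟨h, by rw [hκγ', segment_same]; exact singleton_subset_iff.2 h⟩
  set J : ℕ → Set ℝ := fun n => Icc (τ n + 0.4 * θ n) (τ (n + 1) - 0.4 * θ (n + 1)) with hJ
  set S : ℕ → Set ℂ := fun n => {z | z ∈ chainSuite γ τ θ ϑ η n ∧
    segment ℝ z (γ (κ z)) ⊆ chainSuite γ τ θ ϑ η n} with hS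
  set O : ℕ → Set ℂ := fun n => connectedComponentIn (S n) (γ (τ n + 0.4 * θ n)) with hO
  have hJ0 : ∀ n, τ n + 0.4 * θ n ∈ J n := fun n =>
    ⟨le_rfl, by linarith [H.le n, H.le (n + 1), H.succ n, H.pos n]⟩
  have hKS : ∀ n, γ '' J n ⊆ S n := fun n => by
    rintro _ ⟨t, ht, rfl⟩
    exact hcurve (H.curve_mem_chainSuite ht)
  have hKc : ∀ n, IsPreconnected (γ '' J n) := fun n =>
    isPreconnected_Icc.image _ H.cont.continuousOn
  have hKO : ∀ n, γ '' J n ⊆ O n := fun n =>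
    (hKc n).subset_connectedComponentIn ⟨_, hJ0 n, rfl⟩ (hKS n)
  have hOo : ∀ n, IsOpen (O n) := fun n =>
    (hopen _ (isOpen_chainSuite n) (chainSuite_subset _ n)).connectedComponentIn
  choose h hh hharn using fun n =>
    exists_harnack_const (hOo n) (isCompact_Icc.image H.cont) (hKc n) (hKO n)
  refine ⟨h, hh, fun r hr hr8 => ?_⟩
  set S₁ : Set ℂ := {z | z ∈ chainUnion γ τ θ ϑ η r ∧
    segment ℝ z (γ (κ z)) ⊆ chainUnion γ τ θ ϑ η r} with hS₁
  have hγS : ∀ t, γ t ∈ S₁ := fun t => hcurve (H.curve_mem_chainUnion hr t)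
  have hγU : ∀ t, γ t ∈ connectedComponentIn S₁ (γ 0) := fun t =>
    (isPreconnected_range H.cont).subset_connectedComponentIn ⟨0, rfl⟩
      (range_subset_iff.2 hγS) ⟨t, rfl⟩
  have heq : ∀ t, connectedComponentIn S₁ (γ 0) = connectedComponentIn S₁ (γ t) := fun t =>
    connectedComponentIn_eq (hγU t)
  have hmono := chainUnion_mono (γ := γ) (τ := τ) (θ := θ) (ϑ := ϑ) (η := η) hr8
  have hsubU : connectedComponentIn S₁ (γ 0) ⊆ S₁ := connectedComponentIn_subset _ _
  refine ⟨connectedComponentIn S₁ (γ 0), ?_, isConnected_connectedComponentIn_iff.2 (hγS 0), hγU,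
    fun z hz => (hsubU hz).1, fun n => ?_, fun a ha => ?_, fun V hV n N g hg s hs t ht => ?_⟩
  · exact (hopen _ (isOpen_chainUnion r) hmono).connectedComponentIn
  · rw [heq (τ n)]
    refine (H.isPreconnected_chainGate (hr n)).subset_connectedComponentIn
      (H.curve_mem_chainGate (hr n) (by rw [sub_self, abs_zero]; linarith [H.pos n])) fun z hz => ⟨⟨n, Or.inr hz⟩, ?_⟩
    have := hκg n z (gateSet_mono (hr8 n) hz)
    exact H.segment_subset (hr n) (hr8 n) hz this.1 this.2
  · exact exists_log_of_segment_subset H.cont (hκ.mono fun z hz => hmono (hsubU hz).1)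
      (fun z hz => (hsubU hz).2) (H.curve_mem_chainUnion hr) ha
  · have hOU : O n ⊆ connectedComponentIn S₁ (γ 0) := by
      rw [heq (τ n + 0.4 * θ n)]
      exact connectedComponentIn_mono _ fun z hz => ⟨chainSuite_subset r n hz.1,
        hz.2.trans (chainSuite_subset r n)⟩
    refine hharn n g (fun z hz => hg.harm z ⟨hV (hOU hz), fun h => ?_⟩) (fun z _ => hg.nonneg z)
      _ ⟨s, hs, rfl⟩ _ ⟨t, ht, rfl⟩
    rw [mem_singleton_iff] at h
    exact H.center_notMem_suite N n (h ▸ (connectedComponentIn_subset _ _ hz).1)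

theorem eventually_center_notMem (hr8 : ∀ n, r n ≤ 1 / 8) {K : Set ℂ} (hK : IsCompact K)
    (hKU : K ⊆ chainUnion γ τ θ ϑ η r) : ∀ᶠ N in atTop, γ (τ N) ∉ K := by
  obtain ⟨T, hT⟩ := hK.elim_finite_subcover
    (fun k => gateRoom γ τ θ ϑ η k ∪ chainGate γ τ ϑ k (r k))
    (fun k => (isOpen_gateRoom k).union (isOpen_chainGate k _))
    fun z hz => mem_iUnion.2 (hKU hz)
  rw [← Nat.cofinite_eq_atTop]
  filter_upwards [T.eventually_cofinite_notMem] with N hN h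
  obtain ⟨k, hk, hmem⟩ := mem_iUnion₂.1 (hT h)
  rcases hmem with hmem | hmem
  · exact H.center_notMem_room N k hmem
  · exact hN (H.eq_of_center_mem_gate (hr8 k) hmem ▸ hk)

/-- A gate chain has a simply connected neighbourhood whose Riemann map to the half-plane sends
the curve to a curve with real part tending to infinity. -/
theorem exists_domain : ∃ V : Set ℂ, ∃ F : ℂ → ℂ, IsOpen V ∧ IsConnected V ∧ (∀ t, γ t ∈ V) ∧
    (V ⊆ chainUnion γ τ θ ϑ η fun _ => 1 / 8) ∧ DifferentiableOn ℂ F V ∧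
    BijOn F V {ζ | 0 < ζ.re} ∧ Tendsto (fun t => (F (γ t)).re) atTop atTop ∧
    ∀ n, ∃ M : ℝ, ∀ z ∈ V ∩ chainLeft γ τ θ ϑ η n, ‖F z‖ ≤ M := by
  obtain ⟨h, hh, hcore⟩ := H.exists_core
  have hR₀ : ∀ n, ∃ R₀ : ℝ, 2 ≤ R₀ ∧ ∀ z ∈ chainLeft γ τ θ ϑ η n,
      ‖gateCoord γ τ ϑ n z‖ < R₀ := fun n => by
    obtain ⟨B, hB⟩ := ((H.isBounded_chainLeft n).subset_ball (γ (τ n)))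
    refine ⟨max 2 (B / ‖ϑ n‖), le_max_left _ _, fun z hz => lt_max_of_lt_right ?_⟩
    have h1 := hB hz
    rw [mem_ball, dist_eq_norm, ← H.norm_gateCoord_mul] at h1
    exact (lt_div_iff₀ (H.norm_pos n)).2 h1
  choose R₀ hR₀2 hR₀ using hR₀
  set r : ℕ → ℝ := fun n => min (1 / 8)
    (R₀ n ^ 2 / (4 * Real.exp (256 * Real.log (7 * R₀ n ^ 2) / h n))) with hrdef
  have hpos : ∀ n, 0 < R₀ n := fun n => by linarith [hR₀2 n]
  have hr : ∀ n, 0 < r n := fun n => lt_min (by norm_num) (by have := hpos n; positivity)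
  have hr8 : ∀ n, r n ≤ 1 / 8 := fun n => min_le_left _ _
  have hsmall : ∀ n, 256 * Real.log (7 * R₀ n ^ 2) ≤
      h n * Real.log (R₀ n ^ 2 / (4 * r n)) := fun n => by
    have h1 := hr n
    have h2 : r n * (4 * Real.exp (256 * Real.log (7 * R₀ n ^ 2) / h n)) ≤ R₀ n ^ 2 :=
      (le_div_iff₀ (by positivity)).1 (min_le_right _ _)
    have h3 : Real.exp (256 * Real.log (7 * R₀ n ^ 2) / h n) ≤ R₀ n ^ 2 / (4 * r n) := by
      rw [le_div_iff₀ (by positivity)]; linarith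
    have h4 := Real.log_le_log (Real.exp_pos _) h3
    rw [Real.log_exp, div_le_iff₀ (hh n)] at h4
    linarith
  obtain ⟨U₁, hU₁, hU₁c, hγU₁, hU₁sub, hgU₁, hlog, hharn⟩ := hcore r hr hr8
  obtain ⟨V, ψ, hV, hVc, hUV, hVU, hψ, hbij⟩ := exists_bijOn_unit_ball_between hU₁ hU₁c
    (mul_pos (by norm_num) (H.norm_pos 0)) (H.disjoint_chainUnion_ball hr8) hU₁sub hlog
  have hγV : ∀ t, γ t ∈ V := fun t => hUV (hγU₁ t)
  have hp6 : ∀ n, ∀ t ∈ Icc (τ n - 0.4 * θ n) (τ n + 0.4 * θ n), |t - τ n| ≤ 6 * θ n :=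
    fun n t ht => abs_le.2 ⟨by linarith [ht.1, H.pos n], by linarith [ht.2, H.pos n]⟩
  have hpm : ∀ n, τ n - 0.4 * θ n ∈ Icc (τ n - 0.4 * θ n) (τ n + 0.4 * θ n) := fun n =>
    ⟨le_rfl, by linarith [H.pos n]⟩
  have hqm : ∀ n, τ n + 0.4 * θ n ∈ Icc (τ n - 0.4 * θ n) (τ n + 0.4 * θ n) := fun n =>
    ⟨by linarith [H.pos n], le_rfl⟩
  have hqp : ∀ n, τ n + 0.4 * θ n ≤ τ (n + 1) - 0.4 * θ (n + 1) := fun n => by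
    linarith [H.le n, H.le (n + 1), H.succ n]
  obtain ⟨F, hF, hFb, hFt, hFM⟩ := exists_map_of_gates hV hVc.isPreconnected hψ hbij (γ := γ)
    (p := fun n => τ n - 0.4 * θ n) (q := fun n => τ n + 0.4 * θ n) (e := fun n => γ (τ n))
    (ϑ := ϑ) (w := fun n t => gateCoord γ τ ϑ n (γ t)) (L := chainLeft γ τ θ ϑ η)
    (R := chainRight γ τ θ ϑ η) (r := r) (h := h) (R₀ := R₀) (fun t _ => hγV t) τ
    (fun n => ⟨by linarith [H.pos n], rfl⟩)
    (fun K hKV hK => H.eventually_center_notMem hr8 hK (hKV.trans hVU))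
    (fun n => (hpm n).2) hqp
    (tendsto_atTop_mono (fun n => by linarith [H.le n]) (tendsto_atTop_add_const_right _ (-1)
      H.tendsto)) H.ne (fun n t => (H.add_mul_gateCoord n _).symm)
    (fun n => H.isGate hr hr8 hV hVU n ((hgU₁ n).trans hUV)) hR₀2
    (fun n z hz => by simpa [H.gateCoord_add_mul] using hR₀ n _ hz)
    (fun n N hN => ⟨Or.inr ⟨N, hN, H.curve_mem_chainGate (by norm_num)
      (by rw [sub_self, abs_zero]; linarith [H.pos N])⟩, H.le_norm_gateCoord_center hN.ne⟩)
    (fun n t ht => by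
      have h6 := hp6 n t ht
      have h1 := H.re_gateCoord_mem h6
      have h2 := H.abs_im_gateCoord_le h6
      have h3 : |(t - τ n) / θ n| ≤ 0.4 := by
        rw [abs_div, abs_of_pos (H.pos n), div_le_iff₀ (H.pos n), abs_le]
        exact ⟨by linarith [ht.1], by linarith [ht.2]⟩
      have h4 := abs_sub_abs_le_abs_sub (gateCoord γ τ ϑ n (γ t)).re ((t - τ n) / θ n)
      refine ⟨by linarith, h2.trans (by linarith [abs_nonneg (gateCoord γ τ ϑ n (γ t)).re]),
        (H.strictMonoOn_re n).monotoneOn (hp6 n _ (hpm n)) h6 ht.1⟩)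
    (fun n => by
      have h1 := H.re_gateCoord_mem (hp6 n _ (hpm n))
      rw [sub_sub_cancel_left, neg_div, mul_div_cancel_right₀ _ (H.pos n).ne', abs_neg,
        abs_of_pos (by norm_num : (0 : ℝ) < 0.4), abs_le] at h1
      exact ⟨by linarith, by linarith⟩)
    (fun n => by
      have h1 := H.re_gateCoord_mem (hp6 n _ (hqm n))
      rw [add_sub_cancel_left, mul_div_cancel_right₀ _ (H.pos n).ne',
        abs_of_pos (by norm_num : (0 : ℝ) < 0.4), abs_le] at h1
      exact ⟨by linarith, by linarith⟩) hh
    (fun n N _ g hg t ht => hharn V hUV n N g hg _ ⟨le_rfl, hqp n⟩ t ht) hsmall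
  exact ⟨V, F, hV, hVc, hγV, hVU.trans (chainUnion_mono hr8), hF, hFb, hFt, hFM⟩

end

end IsGateChain

/-- A proper injective curve has no near self-intersections on disjoint parameter sets, one of
which is compact. -/
theorem exists_pos_le_norm_sub_of_proper {W : Set ℂ} (hW : IsOpen W) {γ : ℝ → ℂ}
    (hγ : Continuous γ) (hinj : InjOn γ (Ici 0)) (hγW : ∀ t, γ t ∈ W)
    (hprop : ∀ C : Set ℂ, IsCompact C → C ⊆ W → ∃ T : ℝ, ∀ t : ℝ, T ≤ t → γ t ∉ C)
    {K S : Set ℝ} (hK : IsCompact K) (hK0 : K ⊆ Ici 0) (hS : IsClosed S) (hS0 : S ⊆ Ici 0)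
    (hKS : Disjoint K S) : ∃ m > 0, ∀ t ∈ K, ∀ s ∈ S, m ≤ ‖γ t - γ s‖ := by
  have hγK := hK.image hγ
  obtain ⟨r, hr, hrW⟩ := hγK.exists_cthickening_subset_open hW (image_subset_iff.2 fun t _ => hγW t)
  obtain ⟨T, hT⟩ := hprop _ (hγK.cthickening) hrW
  have hS' : IsCompact (S ∩ Icc 0 T) := isCompact_Icc.inter_left hS
  have hdisj : Disjoint (γ '' K) (γ '' (S ∩ Icc 0 T)) := by
    rw [disjoint_left]
    rintro _ ⟨t, ht, rfl⟩ ⟨s, hs, hst⟩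
    exact disjoint_left.1 hKS ht (hinj (hS0 hs.1) (hK0 ht) hst ▸ hs.1)
  obtain ⟨ε, hε, hd⟩ := hdisj.exists_thickenings hγK (hS'.image hγ).isClosed
  refine ⟨min r ε, lt_min hr hε, fun t ht s hs => ?_⟩
  by_contra! h
  rw [← dist_eq_norm, dist_comm] at h
  rcases le_or_gt T s with hsT | hsT
  · exact hT s hsT (mem_cthickening_of_dist_le _ _ _ _ ⟨t, ht, rfl⟩ (h.le.trans (min_le_left _ _)))
  · refine disjoint_left.1 hd (mem_thickening_iff.2 ⟨γ t, ⟨t, ht, rfl⟩,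
      h.trans_le (min_le_right _ _)⟩) (self_subset_thickening hε _ ⟨s, ⟨hs, hS0 hs, hsT.le⟩, rfl⟩)

theorem exists_gate_size {W : Set ℂ} (hW : IsOpen W) {γ : ℝ → ℂ}
    (hγ : Continuous γ) (hinj : InjOn γ (Ici 0)) (hγW : ∀ t, γ t ∈ W)
    (hprop : ∀ C : Set ℂ, IsCompact C → C ⊆ W → ∃ T : ℝ, ∀ t : ℝ, T ≤ t → γ t ∉ C)
    {τ : ℝ} (hτ : 0 ≤ τ) {a : ℂ} (ha : a ≠ 0) (hd : HasStrictDerivAt γ a τ) {ε : ℝ} (hε : 0 < ε) :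
    ∃ (θ : ℝ) (ϑ : ℂ), 0 < θ ∧ θ ≤ 1 / 10 ∧ ϑ ≠ 0 ∧ 2.4 * ‖ϑ‖ ≤ ε ∧
      (∀ t t', |t - τ| ≤ 6 * θ → |t' - τ| ≤ 6 * θ →
        ‖(γ t - γ t') / ϑ - ((t - t') / θ : ℝ)‖ ≤ 0.05 * |(t - t') / θ|) ∧
      ∀ t, 0 ≤ t → 6 * θ ≤ |t - τ| → 5 ≤ ‖(γ t - γ τ) / ϑ‖ := by
  have ha0 : 0 < ‖a‖ := norm_pos_iff.2 ha
  obtain ⟨ρ, hρ, hρd⟩ : ∃ ρ > 0, ∀ t t', |t - τ| ≤ ρ → |t' - τ| ≤ ρ →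
      ‖γ t - γ t' - (t - t') * a‖ ≤ 0.05 * ‖a‖ * |t - t'| := by
    have h1 := hd.isLittleO.bound (by positivity : 0 < 0.05 * ‖a‖)
    rw [nhds_prod_eq, (nhds_basis_closedBall.prod_self).eventually_iff] at h1
    obtain ⟨ρ, hρ, h⟩ := h1
    refine ⟨ρ, hρ, fun t t' ht ht' => ?_⟩
    have := h (x := (t, t')) ⟨mem_closedBall.2 ht, mem_closedBall.2 ht'⟩
    simpa [Complex.real_smul] using this
  obtain ⟨m, hm, hmS⟩ := exists_pos_le_norm_sub_of_proper hW hγ hinj hγW hprop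
    (K := {τ}) (S := {s | 0 ≤ s ∧ ρ ≤ |s - τ|}) isCompact_singleton (singleton_subset_iff.2 hτ)
    ((isClosed_le continuous_const continuous_id).inter
      (isClosed_le continuous_const (by fun_prop : Continuous fun s : ℝ => |s - τ|)))
    (fun s hs => hs.1) (disjoint_singleton_left.2 fun h => by
      have := h.2; rw [sub_self, abs_zero] at this; linarith)
  set θ := min (min (1 / 10) (ρ / 6)) (min (m / (5 * ‖a‖)) (ε / (2.4 * ‖a‖))) with hθ
  have hθ0 : 0 < θ := by positivity
  have h1 : θ ≤ 1 / 10 := (min_le_left _ _).trans (min_le_left _ _)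
  have h2 : θ ≤ ρ / 6 := (min_le_left _ _).trans (min_le_right _ _)
  have h3 : θ * (5 * ‖a‖) ≤ m := (le_div_iff₀ (by positivity)).1
    ((min_le_right _ _).trans (min_le_left _ _))
  have h4 : θ * (2.4 * ‖a‖) ≤ ε := (le_div_iff₀ (by positivity)).1
    ((min_le_right _ _).trans (min_le_right _ _))
  have hθc : (θ : ℂ) ≠ 0 := by exact_mod_cast hθ0.ne'
  have hn : ‖(θ : ℂ) * a‖ = θ * ‖a‖ := by
    rw [norm_mul, Complex.norm_real, Real.norm_of_nonneg hθ0.le]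
  have hn0 : 0 < θ * ‖a‖ := by positivity
  refine ⟨θ, θ * a, hθ0, h1, mul_ne_zero hθc ha, by rw [hn]; linarith, fun t t' ht ht' => ?_,
    fun t ht0 ht => ?_⟩
  · have hd := hρd t t' (by linarith) (by linarith)
    have : (γ t - γ t') / (θ * a) - ((t - t') / θ : ℝ) =
        (γ t - γ t' - (t - t') * a) / (θ * a) := by
      push_cast
      field_simp
    rw [this, norm_div, hn, div_le_iff₀ hn0, abs_div, abs_of_pos hθ0]
    refine hd.trans_eq ?_
    field_simp
  · rw [norm_div, hn, le_div_iff₀ hn0]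
    rcases le_total |t - τ| ρ with h | h
    · have hd := hρd t τ h (by simpa using hρ.le)
      have h5 := norm_sub_norm_le ((t - τ : ℂ) * a) (γ t - γ τ)
      rw [norm_sub_rev ((t - τ : ℂ) * a), norm_mul, ← Complex.ofReal_sub, Complex.norm_real, Real.norm_eq_abs] at h5
      push_cast at h5
      have h6 := mul_le_mul_of_nonneg_right ht ha0.le
      nlinarith
    · have := hmS τ rfl t ⟨ht0, h⟩
      rw [norm_sub_rev] at this
      linarith

theorem exists_regular_parameter {γ : ℝ → ℂ} (hinj : InjOn γ (Ici 0))
    (hC1 : ContDiffOn ℝ 1 γ (Ici 0)) (T : ℝ) :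
    ∃ τ, T ≤ τ ∧ 0 ≤ τ ∧ ∃ a : ℂ, a ≠ 0 ∧ HasStrictDerivAt γ a τ := by
  by_contra! hcon
  set U := Ioi (max T 0) with hU
  have hat : ∀ t ∈ U, ContDiffAt ℝ 1 γ t := fun t ht =>
    hC1.contDiffAt (Ici_mem_nhds ((le_max_right _ _).trans_lt ht))
  have hs : ∀ t ∈ U, HasStrictDerivAt γ (deriv γ t) t := fun t ht =>
    (hat t ht).hasStrictDerivAt one_ne_zero
  have h1 : max T 0 + 1 ∈ U := by simp [hU]
  have h2 : max T 0 + 2 ∈ U := by simp [hU]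
  have hconst : γ (max T 0 + 1) = γ (max T 0 + 2) :=
    isOpen_Ioi.is_const_of_deriv_eq_zero (s := U) isPreconnected_Ioi
    (fun t ht => (hs t ht).hasDerivAt.differentiableAt.differentiableWithinAt) (fun t ht => by
      by_contra h0
      exact hcon t ((le_max_left _ _).trans ht.le) ((le_max_right _ _).trans ht.le) _ h0 (hs t ht)) h1 h2
  have h3 := hinj (x₁ := max T 0 + 1) (x₂ := max T 0 + 2)
    ((le_max_right T 0).trans h1.le) ((le_max_right T 0).trans h2.le) hconst
  linarith

theorem exists_isGateChain {W : Set ℂ} (hW : IsOpen W) {γ : ℝ → ℂ}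
    (hγ : Continuous γ) (hconst : ∀ t ≤ 0, γ t = γ 0) (hinj : InjOn γ (Ici 0))
    (hC1 : ContDiffOn ℝ 1 γ (Ici 0)) (hγW : ∀ t, γ t ∈ W)
    (hprop : ∀ C : Set ℂ, IsCompact C → C ⊆ W → ∃ T : ℝ, ∀ t : ℝ, T ≤ t → γ t ∉ C)
    {ε : ℝ → ℝ} (hε : ∀ t, 0 < ε t) :
    ∃ τ θ ϑ η, IsGateChain γ τ θ ϑ η ∧ ∀ n, 2.4 * ‖ϑ n‖ ≤ ε (τ n) ∧ η n ≤ ε (τ n) := by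
  choose reg hreg hreg0 a ha hd using exists_regular_parameter hinj hC1
  choose θ' ϑ' h1 h2 h3 h4 h5 h6 using fun T => exists_gate_size hW hγ hinj hγW hprop
    (hreg0 T) (ha T) (hd T) (hε (reg T))
  set σ : ℕ → ℝ := fun n => Nat.rec 1 (fun _ s => reg s + 1) n with hσ
  set τ : ℕ → ℝ := fun n => reg (σ n) with hτ
  have hτs : ∀ n, τ n + 1 ≤ τ (n + 1) := fun n => hreg (reg (σ n) + 1)
  have hτ1 : 1 ≤ τ 0 := hreg 1
  have hτpos : ∀ n, 1 ≤ τ n := fun n => by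
    induction n with
    | zero => exact hτ1
    | succ n ih => linarith [hτs n]
  set θ : ℕ → ℝ := fun n => θ' (σ n) with hθ
  have hθ0 : ∀ n, 0 < θ n := fun n => h1 _
  have hstart : ∀ n, 0 ≤ gateStart τ θ n ∧ gatePrev τ n < gateStart τ θ n := fun n => by
    cases n with
    | zero => simp [gateStart, gatePrev]
    | succ n =>
      simp only [gateStart, gatePrev]
      exact ⟨by linarith [hτpos n, hθ0 n], by linarith [hθ0 n]⟩
  choose m hm hmS using fun n => exists_pos_le_norm_sub_of_proper hW hγ hinj hγW hprop
    (K := Icc (gateStart τ θ n) (τ n - 1.8 * θ n))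
    (S := Ici 0 \ Ioo (gatePrev τ n) (τ n)) isCompact_Icc
    (fun t ht => (hstart n).1.trans ht.1) (isClosed_Ici.sdiff isOpen_Ioo) sdiff_subset
    (disjoint_left.2 fun t ht ht' => ht'.2
      ⟨(hstart n).2.trans_le ht.1, by linarith [ht.2, hθ0 n]⟩)
  refine ⟨τ, θ, fun n => ϑ' (σ n), fun n => min (m n / 8) (ε (τ n)), ⟨hγ, hinj, hconst, hτ1, hτs,
    hθ0, fun n => h2 _, fun n => h3 _, fun n => h5 _, fun n => h6 _,
    fun n => lt_min (by linarith [hm n]) (hε _), fun n t ht s hs hs' => ?_⟩,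
    fun n => ⟨h4 _, min_le_right _ _⟩⟩
  linarith [hmS n t ht s ⟨hs, hs'⟩, min_le_left (m n / 8) (ε (τ n))]

theorem simplyConnectedSpace_of_bijOn {U V : Set ℂ} {f g : ℂ → ℂ} (hf : ContinuousOn f U)
    (hg : ContinuousOn g V) (hfU : MapsTo f U V) (hgV : MapsTo g V U) (hgf : InvOn g f U V)
    (hU : Convex ℝ U) (hUne : U.Nonempty) : SimplyConnectedSpace V := by
  let e : V ≃ₜ U :=
    { toFun := hgV.restrict g V U
      invFun := hfU.restrict f U V
      left_inv := fun x => Subtype.ext (hgf.2 x.2)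
      right_inv := fun x => Subtype.ext (hgf.1 x.2)
      continuous_toFun := hg.mapsToRestrict hgV
      continuous_invFun := hf.mapsToRestrict hfU }
  have : SimplyConnectedSpace U := isSimplyConnected_of_convex hU hUne
  exact e.toHomotopyEquiv.simplyConnectedSpace

/-- Uniformly over compact parts of the curve, points that are close to the curve in the Euclidean
metric are close in the metric `d`. -/
theorem exists_tolerance {W : Set ℂ} (hW : IsOpen W) {d : ℂ → ℂ → ℝ}
    (hd_symm : ∀ x ∈ W, ∀ y ∈ W, d x y = d y x)
    (hd_triangle : ∀ x ∈ W, ∀ y ∈ W, ∀ z ∈ W, d x z ≤ d x y + d y z)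
    (hd_topology : ∀ x ∈ W, ∀ s : Set ℂ, s ∈ 𝓝[W] x ↔ ∃ ε > 0, {y ∈ W | d x y < ε} ⊆ s)
    {γ : ℝ → ℂ} (hγ : ContinuousOn γ (Ici 0)) (hγW : ∀ t, 0 ≤ t → γ t ∈ W) {δ : ℝ → ℝ}
    (hδpos : ∀ t, 0 ≤ t → 0 < δ t) (hδ : ContinuousOn δ (Ici 0)) (T : ℝ) {s : ℝ} (hs : 0 < s) :
    ∃ ε, 0 < ε ∧ ε ≤ s ∧ ∀ t ∈ Icc 0 T, ∀ z, ‖z - γ t‖ < ε → z ∈ W ∧ d z (γ t) < δ t := by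
  have key : ∀ᶠ e in 𝓝 (0 : ℝ), ∀ t ∈ Icc 0 T, 0 ≤ t → ∀ z, ‖z - γ t‖ < e →
      z ∈ W ∧ d z (γ t) < δ t := by
    refine isCompact_Icc.eventually_forall_of_forall_eventually fun t₀ ht₀ => ?_
    have hW₀ := hγW t₀ ht₀.1
    have hδ₀ := hδpos t₀ ht₀.1
    have hn : {y ∈ W | d (γ t₀) y < δ t₀ / 4} ∈ 𝓝 (γ t₀) := by
      rw [← hW.nhdsWithin_eq hW₀]
      exact (hd_topology _ hW₀ _).2 ⟨_, by positivity, subset_rfl⟩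
    obtain ⟨ρ, hρ, hρs⟩ := Metric.mem_nhds_iff.1 hn
    have h1 : ∀ᶠ t in 𝓝 t₀, 0 ≤ t → γ t ∈ ball (γ t₀) (ρ / 2) :=
      eventually_nhdsWithin_iff.1 ((hγ t₀ ht₀.1).eventually_mem
        (ball_mem_nhds _ (half_pos hρ)))
    have h2 : ∀ᶠ t in 𝓝 t₀, 0 ≤ t → δ t₀ / 2 < δ t :=
      eventually_nhdsWithin_iff.1 ((hδ t₀ ht₀.1).eventually (lt_mem_nhds (half_lt_self hδ₀)))
    rw [nhds_prod_eq]
    filter_upwards [(gt_mem_nhds (half_pos hρ)).prod_mk (h1.and h2)] with p hp ht z hz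
    obtain ⟨hp1, hp2, hp3⟩ := hp
    have hγb := hp2 ht
    have hzb : z ∈ ball (γ t₀) ρ := by
      rw [mem_ball] at hγb ⊢
      rw [← dist_eq_norm] at hz
      linarith [dist_triangle z (γ p.2) (γ t₀)]
    have hz' := hρs hzb
    have hγ' := hρs (ball_subset_ball (by linarith) hγb)
    refine ⟨hz'.1, ?_⟩
    have h3 := hd_triangle z hz'.1 _ hW₀ _ hγ'.1
    rw [hd_symm z hz'.1 _ hW₀] at h3
    linarith [hz'.2, hγ'.2, hp3 ht]
  obtain ⟨ε, hε, hεk⟩ := Metric.eventually_nhds_iff.1 key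
  have hmin : 0 < min (ε / 2) s := lt_min (half_pos hε) hs
  refine ⟨min (ε / 2) s, hmin, min_le_right _ _, fun t ht z hz => hεk ?_ t ht ht.1 z hz⟩
  rw [dist_zero_right, Real.norm_of_nonneg hmin.le]
  linarith [min_le_left (ε / 2) s]

/-- Points in the rooms and gates are close to the curve. -/
theorem IsGateChain.exists_curve_close {γ : ℝ → ℂ} {τ θ : ℕ → ℝ} {ϑ : ℕ → ℂ} {η : ℕ → ℝ}
    (H : IsGateChain γ τ θ ϑ η) {ε : ℝ → ℝ}
    (hε : ∀ n, 2.4 * ‖ϑ n‖ ≤ ε (τ n) ∧ η n ≤ ε (τ n)) {k : ℕ} {z : ℂ}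
    (hz : z ∈ gateRoom γ τ θ ϑ η k ∨ z ∈ chainGate γ τ ϑ k (1 / 8)) :
    ∃ m t, k ≤ m + 1 ∧ 0 ≤ t ∧ gatePrev τ k ≤ t ∧ t ≤ τ m ∧ ‖z - γ t‖ < ε (τ m) := by
  have hco : ∀ m, ‖gateCoord γ τ ϑ m z‖ < 2.4 → ‖z - γ (τ m)‖ < ε (τ m) := fun m hm => by
    rw [← H.norm_gateCoord_mul]
    exact (mul_lt_mul_of_pos_right hm (H.norm_pos m)).trans_le (hε m).1
  have h0 : ∀ m, 0 ≤ τ m := fun m => by linarith [H.one_le' m]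
  have hprev : gatePrev τ k ≤ τ k := by linarith [H.gatePrev_add_one_le k]
  rcases hz with ((hz | hz) | ⟨m, rfl, hz⟩) | hz
  · obtain ⟨t, ht, hzt, -⟩ := H.exists_of_mem_gateTube hz
    exact ⟨k, t, Nat.le_succ k, (H.gateStart_nonneg k).trans ht.1,
      (H.gatePrev_lt_gateStart k).le.trans ht.1, by linarith [ht.2, H.pos k],
      hzt.trans_le (hε k).2⟩
  · exact ⟨k, τ k, Nat.le_succ k, h0 k, hprev, le_rfl, hco k (norm_lt_of_mem_leftDoor hz).1⟩
  · exact ⟨m, τ m, le_rfl, h0 m, le_rfl, le_rfl, hco m (norm_lt_of_mem_rightDoor hz).1⟩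
  · exact ⟨k, τ k, Nat.le_succ k, h0 k, hprev, le_rfl,
      hco k ((norm_lt_of_mem_gateSet le_rfl hz).trans (by norm_num))⟩

/-- A compact subset of `W` meets only finitely many rooms and gates. -/
theorem IsGateChain.exists_inter_subset_chainLeft {W : Set ℂ} (hW : IsOpen W) {γ : ℝ → ℂ}
    {τ θ : ℕ → ℝ} {ϑ : ℕ → ℂ} {η : ℕ → ℝ} (H : IsGateChain γ τ θ ϑ η)
    (hprop : ∀ C : Set ℂ, IsCompact C → C ⊆ W → ∃ T : ℝ, ∀ t : ℝ, T ≤ t → γ t ∉ C)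
    {ε : ℝ → ℝ} (hε : ∀ n, 2.4 * ‖ϑ n‖ ≤ ε (τ n) ∧ η n ≤ ε (τ n))
    (hε0 : Tendsto (fun n => ε (τ n)) atTop (𝓝 0)) {C : Set ℂ} (hC : IsCompact C) (hCW : C ⊆ W) :
    ∃ n, C ∩ (chainUnion γ τ θ ϑ η fun _ => 1 / 8) ⊆ chainLeft γ τ θ ϑ η n := by
  obtain ⟨s, hs, hsW⟩ := hC.exists_cthickening_subset_open hW hCW
  obtain ⟨T, hT⟩ := hprop _ hC.cthickening hsW
  obtain ⟨N, hN⟩ := eventually_atTop.1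
    ((hε0.eventually (gt_mem_nhds hs)).and (H.tendsto.eventually_ge_atTop T))
  refine ⟨N + 1, ?_⟩
  rintro z ⟨hzC, k, hz⟩
  by_cases hk : k ≤ N
  · exact hz.imp (fun hz => ⟨k, by omega, hz⟩) fun hz => ⟨k, by omega, hz⟩
  · obtain ⟨m, t, hkm, -, hprev, -, hzt⟩ := H.exists_curve_close hε hz
    refine absurd (mem_cthickening_of_dist_le (γ t) z s C hzC ?_) (hT t ?_)
    · rw [dist_comm, dist_eq_norm]
      exact (hzt.trans (hN m (by omega)).1).le
    · exact ((hN N le_rfl).2.trans (H.le_gatePrev (not_le.1 hk))).trans hprev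

/-- **Simply connected domain around a `C¹` curve, part (e), planar case.**
Let `W ⊆ ℂ` be a domain, `d` a metric on `W` inducing the subspace topology,
`γ : [0,∞) → W` an injective `C¹` curve tending to the boundary of `W`, and
`δ : [0,∞) → (0,∞)` continuous.  Then there exist a simply connected domain `V` with
`γ ⊆ V ⊆ W` and a holomorphic bijection `φ : H → V` (where `H` is the right
half-plane) such that every point of `V` is within `d`-distance `δ(t)` of some `γ(t)`,
preimages under `φ` of compact subsets of `W` are bounded, and
`Re (φ⁻¹(γ(t))) → ∞` as `t → ∞`. -/
theorem strip_around_C1_curve_real_part_to_infinity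
    (W : Set ℂ) (hWopen : IsOpen W) (hWconn : IsConnected W)
    (d : ℂ → ℂ → ℝ)
    (hd_symm : ∀ x ∈ W, ∀ y ∈ W, d x y = d y x)
    (hd_triangle : ∀ x ∈ W, ∀ y ∈ W, ∀ z ∈ W, d x z ≤ d x y + d y z)
    (hd_eq_zero : ∀ x ∈ W, ∀ y ∈ W, (d x y = 0 ↔ x = y))
    (hd_topology : ∀ x ∈ W, ∀ s : Set ℂ,
      s ∈ nhdsWithin x W ↔ ∃ ε > 0, {y ∈ W | d x y < ε} ⊆ s)
    (γ : ℝ → ℂ) (hγW : ∀ t : ℝ, 0 ≤ t → γ t ∈ W)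
    (hγC1 : ContDiffOn ℝ 1 γ (Set.Ici 0)) (hγinj : Set.InjOn γ (Set.Ici 0))
    (hγbdry : ∀ C : Set ℂ, IsCompact C → C ⊆ W → ∃ T : ℝ, ∀ t : ℝ, T ≤ t → γ t ∉ C)
    (δ : ℝ → ℝ) (hδpos : ∀ t : ℝ, 0 ≤ t → 0 < δ t)
    (hδcont : ContinuousOn δ (Set.Ici 0)) :
    ∃ (V : Set ℂ) (φ : ℂ → ℂ),
      V ⊆ W ∧ IsOpen V ∧ IsConnected V ∧ SimplyConnectedSpace ↥V ∧
      (∀ t : ℝ, 0 ≤ t → γ t ∈ V) ∧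
      DifferentiableOn ℂ φ {ζ : ℂ | 0 < ζ.re} ∧
      Set.BijOn φ {ζ : ℂ | 0 < ζ.re} V ∧
      (∀ z ∈ V, ∃ t : ℝ, 0 ≤ t ∧ d z (γ t) < δ t) ∧
      (∀ C : Set ℂ, IsCompact C → C ⊆ W →
        Bornology.IsBounded {ζ : ℂ | 0 < ζ.re ∧ φ ζ ∈ C}) ∧
      (∀ R : ℝ, ∃ T : ℝ, ∀ t : ℝ, T ≤ t →
        ∀ ζ : ℂ, 0 < ζ.re → φ ζ = γ t → R ≤ ζ.re) := by

  set γ' : ℝ → ℂ := fun t => γ (max t 0) with hγ'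
  have hγ'eq : ∀ t, 0 ≤ t → γ' t = γ t := fun t ht => by simp only [hγ', max_eq_left ht]
  have hcont : Continuous γ' := hγC1.continuousOn.comp_continuous (by fun_prop) fun t =>
    le_max_right t 0
  have hconst : ∀ t ≤ 0, γ' t = γ' 0 := fun t ht => by
    simp only [hγ', max_eq_right ht, max_self]
  have hinj : InjOn γ' (Ici 0) := hγinj.congr fun t ht => (hγ'eq t ht).symm
  have hC1 : ContDiffOn ℝ 1 γ' (Ici 0) := hγC1.congr fun t ht => hγ'eq t ht
  have hγ'W : ∀ t, γ' t ∈ W := fun t => hγW _ (le_max_right t 0)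
  have hprop : ∀ C : Set ℂ, IsCompact C → C ⊆ W → ∃ T : ℝ, ∀ t : ℝ, T ≤ t → γ' t ∉ C :=
    fun C hC hCW => by
      obtain ⟨T, hT⟩ := hγbdry C hC hCW
      exact ⟨T, fun t ht => hT _ (ht.trans (le_max_left t 0))⟩
  choose ε hε hεs hεd using fun T : ℝ => exists_tolerance hWopen hd_symm hd_triangle hd_topology
    hγC1.continuousOn hγW hδpos hδcont T (inv_pos.2 (by positivity : 0 < |T| + 1))
  obtain ⟨τ, θ, ϑ, η, H, hH⟩ := exists_isGateChain hWopen hcont hconst hinj hC1 hγ'W hprop hε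
  obtain ⟨V, F, hV, hVc, hγV, hVU, hF, hFb, hFt, hFM⟩ := H.exists_domain
  have hclose : ∀ z ∈ V, z ∈ W ∧ ∃ t, 0 ≤ t ∧ d z (γ t) < δ t := fun z hz => by
    obtain ⟨k, hk⟩ := hVU hz
    obtain ⟨m, t, -, ht0, -, htm, hzt⟩ := H.exists_curve_close hH hk
    rw [hγ'eq t ht0] at hzt
    have := hεd (τ m) t ⟨ht0, htm⟩ z hzt
    exact ⟨this.1, t, ht0, this.2⟩
  have hε0 : Tendsto (fun n => ε (τ n)) atTop (𝓝 0) := by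
    refine squeeze_zero (fun n => (hε _).le) (fun n => hεs _) (tendsto_inv_atTop_zero.comp ?_)
    exact tendsto_atTop_add_const_right _ _ (tendsto_abs_atTop_atTop.comp H.tendsto)
  set φ := Function.invFunOn F V with hφ
  have hinv : InvOn φ F V {ζ | 0 < ζ.re} := hFb.invOn_invFunOn
  have hφb : BijOn φ {ζ | 0 < ζ.re} V := hFb.symm hinv.symm
  have hφd : DifferentiableOn ℂ φ {ζ | 0 < ζ.re} := by
    rw [← hFb.image_eq]
    exact differentiableOn_of_leftInvOn hV hVc.isPreconnected hF hFb.injOn hinv.1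
  refine ⟨V, φ, fun z hz => (hclose z hz).1, hV, hVc, ?_, fun t ht => hγ'eq t ht ▸ hγV t, hφd,
    hφb, fun z hz => (hclose z hz).2, fun C hC hCW => ?_, fun R => ?_⟩
  · exact simplyConnectedSpace_of_bijOn hφd.continuousOn hF.continuousOn hφb.mapsTo hFb.mapsTo
      hinv.symm (convex_halfSpace_re_gt 0) ⟨1, by simp⟩
  · obtain ⟨n, hn⟩ := H.exists_inter_subset_chainLeft hWopen hprop hH hε0 hC hCW
    obtain ⟨M, hM⟩ := hFM n
    refine isBounded_iff_forall_norm_le.2 ⟨M, fun ζ hζ => ?_⟩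
    have hζV := hφb.mapsTo hζ.1
    have := hM _ ⟨hζV, hn ⟨hζ.2, hVU hζV⟩⟩
    rwa [hinv.2 hζ.1] at this
  · obtain ⟨T, hT⟩ := eventually_atTop.1 (hFt.eventually_ge_atTop R)
    refine ⟨max T 0, fun t ht ζ hζ hζt => ?_⟩
    have := hT t ((le_max_left _ _).trans ht)
    rwa [hγ'eq t ((le_max_right _ _).trans ht), ← hζt, hinv.2 hζ] at this
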